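/- The proportion of matrices γ in Γ_T which are hyperbolic with f_γ = 1 (equivalently, for which the discriminant Δ_γ equals the fundamental discriminant Δ_K of ℚ(√(Tr(γ)²−4))) converges as T → ∞ to (75/112)·∏_{p odd prime} (1 − 2p/(p³−1)) ≈ 0.4269. -/

import Mathlib

noncomputable section

open Matrix Filter Topology

/-- `Γ = SL(2,ℤ)`. -/
abbrev SL2Z := Matrix.SpecialLinearGroup (Fin 2) ℤ

/-- Frobenius norm of a matrix in `SL(2,ℤ)`. -/
noncomputable def frobNorm (γ : SL2Z) : ℝ :=
  Real.sqrt ((γ 0 0 ^ 2 + γ 0 1 ^ 2 + γ 1 0 ^ 2 + γ 1 1 ^ 2 : ℤ) : ℝ)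

/-- Trace of a matrix in `SL(2,ℤ)`. -/
def trZ (γ : SL2Z) : ℤ := γ 0 0 + γ 1 1

/-- `u_γ = gcd(c, d-a, b)` for `γ = (a b; c d)`. -/
def uGamma (γ : SL2Z) : ℕ :=
  Int.gcd (γ 1 0) (Int.gcd (γ 1 1 - γ 0 0) (γ 0 1))

/-- `f_γ = 1`: with `Tr(γ)² - 4 = m_γ² D_γ` (`m_γ ≥ 1`, `D_γ > 1` squarefree) one has
`m_γ = u_γ` if `D_γ ≡ 1 (mod 4)` and `m_γ = 2 u_γ` otherwise. This says the
discriminant `Δ_γ` equals the fundamental discriminant `Δ_K`. -/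
def ConductorOne (γ : SL2Z) : Prop :=
  ∃ mm D : ℤ, 1 ≤ mm ∧ 1 < D ∧ Squarefree D ∧
    (trZ γ) ^ 2 - 4 = mm ^ 2 * D ∧
    (if D % 4 = 1 then mm = (uGamma γ : ℤ) else mm = 2 * (uGamma γ : ℤ))

/-! ### Annihilators in `ℤ/q` -/

/-- The number of `x` in `ℤ/q` killed by `w`. -/
def annCard {q : ℕ} [NeZero q] (w : ZMod q) : ℕ :=
  (Finset.univ.filter fun x : ZMod q => w * x = 0).card

section Annihilator

variable {q : ℕ} [NeZero q]

lemma card_mul_eq_le_annCard (w c : ZMod q) (s : Finset (ZMod q)) (hs : ∀ x ∈ s, w * x = c) :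
    s.card ≤ annCard w := by
  rcases s.eq_empty_or_nonempty with rfl | ⟨y, hy⟩
  · simp
  · refine Finset.card_le_card_of_injOn (fun x => x - y) ?_ ?_
    · intro x hx
      simp [mul_sub, hs x hx, hs y hy]
    · intro a _ b _ h
      simpa using h

lemma annCard_mul_le (u v : ZMod q) : annCard (u * v) ≤ annCard u * annCard v := by
  classical
  rw [mul_comm (annCard u)]
  refine Finset.card_le_mul_card_image_of_maps_to (f := fun x => v * x)
    (t := Finset.univ.filter fun x : ZMod q => u * x = 0) ?_ _ ?_
  · intro x hx
    simpa [mul_assoc] using hx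
  · intro b _
    refine card_mul_eq_le_annCard v b _ ?_
    intro x hx
    simpa using (Finset.mem_filter.1 hx).2

lemma annCard_pos (w : ZMod q) : 0 < annCard w :=
  Finset.card_pos.2 ⟨0, by simp⟩

lemma annCard_natCast_le (m : ℕ) : annCard (m : ZMod q) ≤ Nat.gcd m q := by
  classical
  have hq : 0 < q := Nat.pos_of_ne_zero (NeZero.ne q)
  have h := IsAddCyclic.card_nsmul_eq_zero_le (α := ZMod q) (n := Nat.gcd m q)
    (Nat.gcd_pos_of_pos_right _ hq)
  refine le_trans (Finset.card_le_card ?_) h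
  intro x hx
  simp only [Finset.mem_filter, Finset.mem_univ, true_and] at hx ⊢
  have hb := Nat.gcd_eq_gcd_ab m q
  have : ((Nat.gcd m q : ℤ) : ZMod q) = (m : ZMod q) * (Nat.gcdA m q : ZMod q) := by
    rw [hb]; push_cast; simp
  rw [nsmul_eq_mul]
  have h2 : ((Nat.gcd m q : ℕ) : ZMod q) = (m : ZMod q) * (Nat.gcdA m q : ZMod q) := by
    rw [← this]; push_cast; rfl
  rw [h2, mul_right_comm, hx, zero_mul]

lemma annCard_le_gcd_val (u : ZMod q) : annCard u ≤ Nat.gcd u.val q := by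
  conv_lhs => rw [← ZMod.natCast_zmod_val u]
  exact annCard_natCast_le _

lemma annCard_two_le : annCard (2 : ZMod q) ≤ 2 := by
  have h := annCard_natCast_le (q := q) 2
  have h2 : Nat.gcd 2 q ≤ 2 := Nat.gcd_le_left _ (by norm_num)
  exact_mod_cast h.trans h2

lemma sum_zmod_val {M : Type*} [AddCommMonoid M] (f : ℕ → M) :
    ∑ x : ZMod q, f x.val = ∑ i ∈ Finset.range q, f i := by
  refine Finset.sum_bij (fun x _ => x.val) ?_ ?_ ?_ ?_
  · intro x _; simpa using ZMod.val_lt x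
  · intro x _ y _ h; exact ZMod.val_injective q h
  · intro i hi; exact ⟨(i : ZMod q), Finset.mem_univ _, ZMod.val_cast_of_lt (by simpa using hi)⟩
  · intro _ _; rfl

lemma sum_annCard_le : ∑ u : ZMod q, annCard u ≤ q * q.divisors.card := by
  have hq : 0 < q := Nat.pos_of_ne_zero (NeZero.ne q)
  calc ∑ u : ZMod q, annCard u ≤ ∑ u : ZMod q, Nat.gcd u.val q :=
        Finset.sum_le_sum fun u _ => annCard_le_gcd_val u
    _ = ∑ i ∈ Finset.range q, Nat.gcd i q := sum_zmod_val (fun i => Nat.gcd i q)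
    _ ≤ ∑ i ∈ Finset.range q, ∑ d ∈ q.divisors, if d ∣ i then d else 0 := by
        refine Finset.sum_le_sum fun i _ => ?_
        have := Finset.single_le_sum (f := fun d => if d ∣ i then d else 0)
          (fun d _ => Nat.zero_le _)
          (Nat.mem_divisors.2 ⟨Nat.gcd_dvd_right i q, hq.ne'⟩)
        simpa [Nat.gcd_dvd_left] using this
    _ = ∑ d ∈ q.divisors, ∑ i ∈ Finset.range q, if d ∣ i then d else 0 := Finset.sum_comm
    _ ≤ ∑ d ∈ q.divisors, q := by
        refine Finset.sum_le_sum fun d hd => ?_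
        obtain ⟨⟨e, he⟩, -⟩ := Nat.mem_divisors.1 hd
        rw [← Finset.sum_filter, Finset.sum_const, smul_eq_mul]
        have hd0 : 0 < d := Nat.pos_of_ne_zero (by rintro rfl; simp at he; omega)
        have : ((Finset.range q).filter (d ∣ ·)).card ≤ (Finset.range e).card := by
          refine Finset.card_le_card_of_injOn (fun i => i / d) ?_ ?_
          · intro i hi
            simp only [Finset.coe_filter, Finset.mem_range, Set.mem_ofPred_eq] at hi
            simp only [Finset.coe_range, Set.mem_Iio]
            rw [Nat.div_lt_iff_lt_mul hd0, mul_comm, ← he]; exact hi.1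
          · intro i hi j hj h
            simp only [Finset.coe_filter, Finset.mem_range, Set.mem_ofPred_eq] at hi hj
            obtain ⟨i', rfl⟩ := hi.2
            obtain ⟨j', rfl⟩ := hj.2
            simp only [Nat.mul_div_cancel_left _ hd0] at h
            rw [h]
        rw [Finset.card_range] at this
        calc _ ≤ e * d := Nat.mul_le_mul_right _ this
          _ = q := by rw [he, mul_comm]
    _ = q * q.divisors.card := by rw [Finset.sum_const, smul_eq_mul, mul_comm]

end Annihilator

lemma le_card_divisors_mul_totient (q : ℕ) : q ≤ q.divisors.card * q.totient := by
  rcases Nat.eq_zero_or_pos q with rfl | hq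
  · simp
  calc q = ∑ d ∈ q.divisors, d.totient := (Nat.sum_totient q).symm
    _ ≤ ∑ d ∈ q.divisors, q.totient := by
        refine Finset.sum_le_sum fun d hd => ?_
        exact Nat.le_of_dvd (Nat.totient_pos.2 hq) (Nat.totient_dvd_of_dvd (Nat.dvd_of_mem_divisors hd))
    _ = _ := by rw [Finset.sum_const, smul_eq_mul]

/-! ### Kloosterman sums -/

lemma inv_sum_eq_imp {R : Type*} [CommRing R] (x₁ x₂ x₃ x₄ : Rˣ) (h : (x₁ : R) + x₂ = x₃ + x₄)
    (h' : ((x₁⁻¹ : Rˣ) : R) + ((x₂⁻¹ : Rˣ) : R)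
      = ((x₃⁻¹ : Rˣ) : R) + ((x₄⁻¹ : Rˣ) : R)) :
    ((x₁ : R) + x₂) * ((x₁ : R) - x₃) * ((x₂ : R) - x₃) = 0 := by
  have e1 : (x₁ : R) * ((x₁⁻¹ : Rˣ) : R) = 1 := Units.mul_inv _
  have e2 : (x₂ : R) * ((x₂⁻¹ : Rˣ) : R) = 1 := Units.mul_inv _
  have e3 : (x₃ : R) * ((x₃⁻¹ : Rˣ) : R) = 1 := Units.mul_inv _
  have e4 : (x₄ : R) * ((x₄⁻¹ : Rˣ) : R) = 1 := Units.mul_inv _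
  generalize (x₁ : R) = a at *
  generalize (x₂ : R) = b at *
  generalize (x₃ : R) = c at *
  generalize (x₄ : R) = d at *
  generalize ((x₁⁻¹ : Rˣ) : R) = a' at *
  generalize ((x₂⁻¹ : Rˣ) : R) = b' at *
  generalize ((x₃⁻¹ : Rˣ) : R) = c' at *
  generalize ((x₄⁻¹ : Rˣ) : R) = d' at *
  have hd : d = a + b - c := by rw [h]; ring
  have k : (a + b) * (c * d) = (c + d) * (a * b) := by
    have hl : (a * b * (c * d)) * (a' + b') = (a + b) * (c * d) := by
      linear_combination (b * c * d) * e1 + (a * c * d) * e2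
    have hr : (a * b * (c * d)) * (c' + d') = (c + d) * (a * b) := by
      linear_combination (a * b * d) * e3 + (a * b * c) * e4
    rw [← hl, ← hr, h']
  subst hd
  linear_combination -k

section Kloosterman

variable {q : ℕ} [NeZero q]

lemma stdAddChar_star (x : ZMod q) :
    (starRingEnd ℂ) (ZMod.stdAddChar x) = ZMod.stdAddChar (-x) := by
  rw [AddChar.map_neg_eq_inv, Complex.inv_eq_conj]
  exact AddChar.norm_apply _ _

/-- Parseval for the family of frequencies `(α i, β i)`. -/
lemma sum_norm_sq_charSum {ι : Type*} [Fintype ι] (α β : ι → ZMod q) :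
    ∑ m : ZMod q, ∑ n : ZMod q, ‖∑ i, ZMod.stdAddChar (m * α i + n * β i)‖ ^ 2
      = (q : ℝ) ^ 2 * ((Finset.univ.filter fun p : ι × ι =>
          α p.1 = α p.2 ∧ β p.1 = β p.2).card : ℝ) := by
  classical
  have key : ∀ m n : ZMod q, ((‖∑ i, ZMod.stdAddChar (m * α i + n * β i)‖ ^ 2 : ℝ) : ℂ)
      = ∑ p : ι × ι, ZMod.stdAddChar (m * (α p.1 - α p.2)) *
          ZMod.stdAddChar (n * (β p.1 - β p.2)) := by
    intro m n
    push_cast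
    rw [← Complex.mul_conj', map_sum, Finset.sum_mul_sum, ← Finset.univ_product_univ,
      Finset.sum_product]
    refine Finset.sum_congr rfl fun i _ => Finset.sum_congr rfl fun j _ => ?_
    rw [stdAddChar_star, ← AddChar.map_add_eq_mul, ← AddChar.map_add_eq_mul]
    congr 1
    ring
  have hchar : ∀ b : ZMod q, ∑ x : ZMod q, (ZMod.stdAddChar (x * b) : ℂ)
      = if b = 0 then (q : ℂ) else 0 := by
    intro b
    have := AddChar.sum_mulShift b (ZMod.isPrimitive_stdAddChar q)
    rw [this, ZMod.card]
    push_cast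
    rfl
  have : ((∑ m : ZMod q, ∑ n : ZMod q,
      ‖∑ i, ZMod.stdAddChar (m * α i + n * β i)‖ ^ 2 : ℝ) : ℂ)
      = (q : ℂ) ^ 2 * ((Finset.univ.filter fun p : ι × ι =>
          α p.1 = α p.2 ∧ β p.1 = β p.2).card : ℂ) := by
    rw [Complex.ofReal_sum]
    simp_rw [Complex.ofReal_sum, key]
    calc ∑ m : ZMod q, ∑ n : ZMod q, ∑ p : ι × ι,
            (ZMod.stdAddChar (m * (α p.1 - α p.2)) : ℂ) * ZMod.stdAddChar (n * (β p.1 - β p.2))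
        = ∑ p : ι × ι, (∑ m : ZMod q, (ZMod.stdAddChar (m * (α p.1 - α p.2)) : ℂ)) *
            (∑ n : ZMod q, (ZMod.stdAddChar (n * (β p.1 - β p.2)) : ℂ)) := by
          simp_rw [Finset.sum_mul_sum]
          exact (Finset.sum_congr rfl fun m _ => Finset.sum_comm).trans Finset.sum_comm
      _ = ∑ p : ι × ι, if α p.1 = α p.2 ∧ β p.1 = β p.2 then (q : ℂ) ^ 2 else 0 := by
          refine Finset.sum_congr rfl fun p _ => ?_
          rw [hchar, hchar]
          simp only [sub_eq_zero]
          by_cases h1 : α p.1 = α p.2 <;> by_cases h2 : β p.1 = β p.2 <;> simp [h1, h2, sq]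
      _ = _ := by
          rw [← Finset.sum_filter, Finset.sum_const, nsmul_eq_mul, mul_comm]
  exact_mod_cast this

/-- The Kloosterman sum `S(m, n; q)`. -/
def kloosterman (m n : ZMod q) : ℂ :=
  ∑ x : (ZMod q)ˣ, ZMod.stdAddChar (m * (x : ZMod q) + n * ((x⁻¹ : (ZMod q)ˣ) : ZMod q))

lemma kloosterman_orbit (m n : ZMod q) (l : (ZMod q)ˣ) :
    kloosterman (m * (l : ZMod q)) (n * ((l⁻¹ : (ZMod q)ˣ) : ZMod q)) = kloosterman m n := by
  unfold kloosterman
  refine Fintype.sum_equiv (Equiv.mulLeft l) _ _ fun x => ?_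
  congr 1
  simp only [Equiv.coe_mulLeft, mul_inv, Units.val_mul]
  ring

lemma kloosterman_sq (m n : ZMod q) :
    kloosterman m n ^ 2 = ∑ p : (ZMod q)ˣ × (ZMod q)ˣ,
      ZMod.stdAddChar (m * ((p.1 : ZMod q) + (p.2 : ZMod q)) +
        n * (((p.1⁻¹ : (ZMod q)ˣ) : ZMod q) + ((p.2⁻¹ : (ZMod q)ˣ) : ZMod q))) := by
  unfold kloosterman
  rw [sq, Finset.sum_mul_sum, ← Finset.univ_product_univ, Finset.sum_product]
  refine Finset.sum_congr rfl fun i _ => Finset.sum_congr rfl fun j _ => ?_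
  rw [← AddChar.map_add_eq_mul]
  congr 1
  ring

/-- The number of solutions counted by the fourth moment. -/
lemma card_fourth_moment_le :
    (Finset.univ.filter fun p : ((ZMod q)ˣ × (ZMod q)ˣ) × ((ZMod q)ˣ × (ZMod q)ˣ) =>
      (p.1.1 : ZMod q) + p.1.2 = p.2.1 + p.2.2 ∧
      ((p.1.1⁻¹ : (ZMod q)ˣ) : ZMod q) + ((p.1.2⁻¹ : (ZMod q)ˣ) : ZMod q)
        = ((p.2.1⁻¹ : (ZMod q)ˣ) : ZMod q) + ((p.2.2⁻¹ : (ZMod q)ˣ) : ZMod q)).card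
      ≤ 2 * (q * q.divisors.card) ^ 2 := by
  classical
  set A := Finset.univ.filter fun p : ((ZMod q)ˣ × (ZMod q)ˣ) × ((ZMod q)ˣ × (ZMod q)ˣ) =>
      (p.1.1 : ZMod q) + p.1.2 = p.2.1 + p.2.2 ∧
      ((p.1.1⁻¹ : (ZMod q)ˣ) : ZMod q) + ((p.1.2⁻¹ : (ZMod q)ˣ) : ZMod q)
        = ((p.2.1⁻¹ : (ZMod q)ˣ) : ZMod q) + ((p.2.2⁻¹ : (ZMod q)ˣ) : ZMod q) with hA
  set B := Finset.univ.filter fun t : (ZMod q × ZMod q) × ZMod q =>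
      (t.1.1 + t.1.2 + 2 * t.2) * t.1.1 * t.1.2 = 0 with hB
  have h1 : A.card ≤ B.card := by
    refine Finset.card_le_card_of_injOn
      (fun p => (((p.1.1 : ZMod q) - p.2.1, (p.1.2 : ZMod q) - p.2.1), (p.2.1 : ZMod q))) ?_ ?_
    · intro p hp
      simp only [hA, Finset.coe_filter, Finset.mem_univ, true_and, Set.mem_ofPred_eq] at hp
      simp only [hB, Finset.coe_filter, Finset.mem_univ, true_and, Set.mem_ofPred_eq]
      have := inv_sum_eq_imp p.1.1 p.1.2 p.2.1 p.2.2 hp.1 hp.2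
      linear_combination this
    · rintro ⟨⟨a, b⟩, ⟨c, d⟩⟩ hp ⟨⟨a', b'⟩, ⟨c', d'⟩⟩ hp' h
      simp only [hA, Finset.coe_filter, Finset.mem_univ, true_and, Set.mem_ofPred_eq] at hp hp'
      simp only [Prod.mk.injEq] at h
      obtain ⟨⟨ha, hb⟩, hc⟩ := h
      have hc' : c = c' := Units.ext hc
      subst hc'
      have ha' : a = a' := Units.ext (by linear_combination ha)
      have hb' : b = b' := Units.ext (by linear_combination hb)
      subst ha' hb'
      have hd' : d = d' := Units.ext (by linear_combination hp'.1 - hp.1)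
      subst hd'
      rfl
  have h2 : B.card ≤ ∑ u : ZMod q, ∑ v : ZMod q, 2 * (annCard u * annCard v) := by
    rw [Finset.card_eq_sum_card_fiberwise (f := Prod.fst) (t := Finset.univ)
      (fun _ _ => by simp), ← Finset.univ_product_univ, Finset.sum_product]
    refine Finset.sum_le_sum fun u _ => Finset.sum_le_sum fun v _ => ?_
    have : (B.filter fun t => t.1 = (u, v)).card ≤ annCard (2 * (u * v)) := by
      rw [← Finset.card_image_of_injOn (f := Prod.snd)]
      · refine card_mul_eq_le_annCard _ (-((u + v) * u * v)) _ ?_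
        intro x hx
        simp only [hB, Finset.mem_image, Finset.mem_filter, Finset.mem_univ, true_and] at hx
        obtain ⟨⟨⟨u', v'⟩, w⟩, ⟨ht, huv⟩, rfl⟩ := hx
        simp only [Prod.mk.injEq] at huv
        obtain ⟨rfl, rfl⟩ := huv
        simp only at ht ⊢
        linear_combination ht
      · rintro ⟨x, y⟩ hx ⟨x', y'⟩ hx' h
        simp only [Finset.coe_filter, Set.mem_ofPred_eq] at hx hx' h
        rw [Prod.mk.injEq]
        exact ⟨hx.2.trans hx'.2.symm, h⟩
    refine this.trans ((annCard_mul_le _ _).trans ?_)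
    exact Nat.mul_le_mul annCard_two_le (annCard_mul_le _ _)
  refine h1.trans (h2.trans ?_)
  simp_rw [← Finset.mul_sum]
  rw [← Finset.sum_mul, sq]
  exact Nat.mul_le_mul_left _ (Nat.mul_le_mul sum_annCard_le sum_annCard_le)

lemma kloosterman_fourth_moment :
    ∑ m : ZMod q, ∑ n : ZMod q, ‖kloosterman m n‖ ^ 4
      ≤ 2 * (q : ℝ) ^ 4 * (q.divisors.card : ℝ) ^ 2 := by
  have h := sum_norm_sq_charSum (q := q) (ι := (ZMod q)ˣ × (ZMod q)ˣ)
    (fun p => (p.1 : ZMod q) + (p.2 : ZMod q))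
    (fun p => ((p.1⁻¹ : (ZMod q)ˣ) : ZMod q) + ((p.2⁻¹ : (ZMod q)ˣ) : ZMod q))
  simp_rw [← kloosterman_sq, norm_pow, ← pow_mul] at h
  rw [h]
  have h2 : ((2 * (q * q.divisors.card) ^ 2 : ℕ) : ℝ)
      = 2 * (q : ℝ) ^ 2 * (q.divisors.card : ℝ) ^ 2 := by push_cast; ring
  calc _ ≤ (q : ℝ) ^ 2 * ((2 * (q * q.divisors.card) ^ 2 : ℕ) : ℝ) := by
        gcongr
        exact card_fourth_moment_le
    _ = _ := by rw [h2]; ring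

lemma totient_mul_kloosterman_pow_le (m n : ZMod q) (K : ℕ)
    (hK : annCard m ≤ K ∨ annCard n ≤ K) :
    (q.totient : ℝ) * ‖kloosterman m n‖ ^ 4 ≤
      K * (2 * (q : ℝ) ^ 4 * (q.divisors.card : ℝ) ^ 2) := by
  classical
  have hfib : ∀ b ∈ (Finset.univ : Finset (ZMod q × ZMod q)),
      (Finset.univ.filter fun l : (ZMod q)ˣ =>
        (m * (l : ZMod q), n * ((l⁻¹ : (ZMod q)ˣ) : ZMod q)) = b).card ≤ K := by
    intro b _
    rcases hK with hK | hK
    · refine le_trans ?_ hK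
      rw [← Finset.card_image_of_injective _ Units.val_injective]
      refine card_mul_eq_le_annCard m b.1 _ ?_
      intro x hx
      simp only [Finset.mem_image, Finset.mem_filter, Finset.mem_univ, true_and] at hx
      obtain ⟨l, hl, rfl⟩ := hx
      rw [← hl]
    · refine le_trans ?_ hK
      have hinj : Function.Injective fun l : (ZMod q)ˣ => ((l⁻¹ : (ZMod q)ˣ) : ZMod q) :=
        fun a b h => inv_injective (Units.val_injective h)
      rw [← Finset.card_image_of_injective _ hinj]
      refine card_mul_eq_le_annCard n b.2 _ ?_
      intro x hx
      simp only [Finset.mem_image, Finset.mem_filter, Finset.mem_univ, true_and] at hx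
      obtain ⟨l, hl, rfl⟩ := hx
      rw [← hl]
  have h1 : (q.totient : ℝ) * ‖kloosterman m n‖ ^ 4
      = ∑ l : (ZMod q)ˣ, ‖kloosterman (m * (l : ZMod q)) (n * ((l⁻¹ : (ZMod q)ˣ) : ZMod q))‖ ^ 4 := by
    simp_rw [kloosterman_orbit]
    rw [Finset.sum_const, Finset.card_univ, ZMod.card_units_eq_totient, nsmul_eq_mul]
  rw [h1]
  rw [← Finset.sum_fiberwise (s := Finset.univ)
    (g := fun l : (ZMod q)ˣ => (m * (l : ZMod q), n * ((l⁻¹ : (ZMod q)ˣ) : ZMod q)))]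
  calc _ ≤ ∑ b : ZMod q × ZMod q, K * ‖kloosterman b.1 b.2‖ ^ 4 := by
        refine Finset.sum_le_sum fun b hb => ?_
        have : ∀ l ∈ (Finset.univ.filter fun l : (ZMod q)ˣ =>
            (m * (l : ZMod q), n * ((l⁻¹ : (ZMod q)ˣ) : ZMod q)) = b),
            ‖kloosterman (m * (l : ZMod q)) (n * ((l⁻¹ : (ZMod q)ˣ) : ZMod q))‖ ^ 4
              = ‖kloosterman b.1 b.2‖ ^ 4 := by
          intro l hl
          rw [← (Finset.mem_filter.1 hl).2]
        rw [Finset.sum_congr rfl this, Finset.sum_const, nsmul_eq_mul]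
        gcongr
        exact_mod_cast hfib b hb
    _ = K * ∑ m : ZMod q, ∑ n : ZMod q, ‖kloosterman m n‖ ^ 4 := by
        rw [← Finset.mul_sum, ← Finset.univ_product_univ, Finset.sum_product]
    _ ≤ _ := by
        gcongr
        exact kloosterman_fourth_moment

/-- Pointwise bound for Kloosterman sums coming from the fourth moment. -/
lemma kloosterman_pow_four_le (m n : ZMod q) (K : ℕ)
    (hK : annCard m ≤ K ∨ annCard n ≤ K) :
    ‖kloosterman m n‖ ^ 4 ≤ 2 * (q : ℝ) ^ 3 * (q.divisors.card : ℝ) ^ 3 * K := by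
  have hq : 0 < q := Nat.pos_of_ne_zero (NeZero.ne q)
  have hφ : (0 : ℝ) < q.totient := by exact_mod_cast Nat.totient_pos.2 hq
  have h := totient_mul_kloosterman_pow_le m n K hK
  have h2 : (q : ℝ) ≤ q.divisors.card * q.totient := by
    exact_mod_cast le_card_divisors_mul_totient q
  refine le_of_mul_le_mul_left (h.trans ?_) hφ
  calc (K : ℝ) * (2 * (q : ℝ) ^ 4 * (q.divisors.card : ℝ) ^ 2)
      = (2 * K * (q : ℝ) ^ 3 * (q.divisors.card : ℝ) ^ 2) * q := by ring
    _ ≤ (2 * K * (q : ℝ) ^ 3 * (q.divisors.card : ℝ) ^ 2) * (q.divisors.card * q.totient) := by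
        gcongr
    _ = _ := by ring

end Kloosterman

/-! ### The divisor bound -/

lemma exists_card_divisors_le_rpow {ε : ℝ} (hε : 0 < ε) :
    ∃ C : ℝ, 1 ≤ C ∧ ∀ n : ℕ, n ≠ 0 → (n.divisors.card : ℝ) ≤ C * (n : ℝ) ^ ε := by
  have hl : 0 < Real.log 2 := Real.log_pos (by norm_num)
  set K : ℝ := 1 + 1 / (ε * Real.log 2) with hK
  have hK1 : 1 ≤ K := by
    have : 0 < 1 / (ε * Real.log 2) := by positivity
    linarith
  set P : ℕ := ⌈(2 : ℝ) ^ (1 / ε)⌉₊ with hP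
  refine ⟨K ^ P, one_le_pow₀ hK1, fun n hn => ?_⟩
  have hexp : ∀ (x : ℝ) (a : ℕ), 0 < x → x ^ (ε * a) = (x ^ ε) ^ a := by
    intro x a hx
    rw [Real.rpow_mul hx.le, Real.rpow_natCast]
  have hlocal : ∀ p ∈ n.primeFactors, ((n.factorization p : ℝ) + 1)
      ≤ (if p < P then K else 1) * ((p : ℝ) ^ ε) ^ (n.factorization p) := by
    intro p hp
    have hp2 : (2 : ℝ) ≤ p := by exact_mod_cast (Nat.prime_of_mem_primeFactors hp).two_le
    set a := n.factorization p
    split_ifs with h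
    · have h1 : (1 : ℝ) + a * (ε * Real.log 2) ≤ ((p : ℝ) ^ ε) ^ a := by
        have h2 : ((2 : ℝ) ^ ε) ^ a ≤ ((p : ℝ) ^ ε) ^ a := by gcongr
        refine le_trans ?_ h2
        rw [← hexp _ _ (by norm_num), Real.rpow_def_of_pos (by norm_num)]
        have := Real.add_one_le_exp (Real.log 2 * (ε * a))
        linarith
      have h3 : K * (1 + a * (ε * Real.log 2)) = 1 + a + 1 / (ε * Real.log 2) + a * (ε * Real.log 2) := by
        rw [hK]; field_simp; ring
      have h4 : 0 < 1 / (ε * Real.log 2) := by positivity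
      have h5 : 0 ≤ a * (ε * Real.log 2) := by positivity
      calc (a : ℝ) + 1 ≤ K * (1 + a * (ε * Real.log 2)) := by rw [h3]; linarith
        _ ≤ _ := by gcongr
    · have h1 : (2 : ℝ) ≤ (p : ℝ) ^ ε := by
        have h2 : (2 : ℝ) ^ (1 / ε) ≤ p := by
          have : (P : ℝ) ≤ p := by exact_mod_cast not_lt.1 h
          exact (Nat.le_ceil _).trans this
        calc (2 : ℝ) = ((2 : ℝ) ^ (1 / ε)) ^ ε := by
              rw [← Real.rpow_mul (by norm_num), one_div_mul_cancel hε.ne', Real.rpow_one]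
          _ ≤ _ := by gcongr
      have h2 : (2 : ℝ) ^ a ≤ ((p : ℝ) ^ ε) ^ a := by gcongr
      have h3 : (a : ℝ) + 1 ≤ 2 ^ a := by
        have : a + 1 ≤ 2 ^ a := Nat.lt_two_pow_self
        exact_mod_cast this
      linarith
  rw [Nat.card_divisors hn]
  push_cast
  refine (Finset.prod_le_prod (fun p _ => by positivity) hlocal).trans ?_
  rw [Finset.prod_mul_distrib]
  have e1 : ∏ p ∈ n.primeFactors, ((p : ℝ) ^ ε) ^ (n.factorization p) = (n : ℝ) ^ ε := by
    have h1 := Nat.prod_factorization_pow_eq_self hn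
    conv_rhs => rw [← h1]
    rw [Finsupp.prod, Nat.cast_prod, ← Real.finsetProd_rpow _ _ (fun _ _ => by positivity)]
    refine Finset.prod_congr (by simp) fun p _ => ?_
    push_cast
    rw [← Real.rpow_natCast, ← Real.rpow_natCast, ← Real.rpow_mul (by positivity),
      ← Real.rpow_mul (by positivity), mul_comm]
  rw [e1]
  gcongr
  rw [Finset.prod_ite, Finset.prod_const, Finset.prod_const_one, mul_one]
  refine pow_le_pow_right₀ hK1 ?_
  calc _ ≤ (Finset.range P).card := Finset.card_le_card (by
        intro p hp; simpa using (Finset.mem_filter.1 hp).2)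
    _ = P := Finset.card_range P

/-! ### Characters summed over intervals -/

section Interval

variable {q : ℕ} [NeZero q]

lemma four_mul_min_le_norm_stdAddChar_sub_one (k : ZMod q) :
    4 * (min k.val (q - k.val) : ℕ) / (q : ℝ) ≤ ‖(ZMod.stdAddChar k : ℂ) - 1‖ := by
  have hq : (0 : ℝ) < q := by exact_mod_cast Nat.pos_of_ne_zero (NeZero.ne q)
  have hlt : k.val < q := ZMod.val_lt k
  have h1 : (ZMod.stdAddChar k : ℂ) = Complex.exp (Complex.I * ((2 * Real.pi * k.val / q : ℝ) : ℂ)) := by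
    have := ZMod.stdAddChar_coe (N := q) (k.val : ℤ)
    rw [Int.cast_natCast, ZMod.natCast_zmod_val, Int.cast_natCast] at this
    rw [this]
    congr 1
    push_cast
    ring
  rw [h1, Complex.norm_exp_I_mul_ofReal_sub_one, Real.norm_eq_abs, abs_mul, abs_two]
  have h2 : 2 * Real.pi * k.val / q / 2 = Real.pi * (k.val / q) := by ring
  rw [h2]
  have hv0 : (0 : ℝ) ≤ k.val / q := by positivity
  have hpi := Real.pi_pos
  have hpi0 := Real.pi_ne_zero
  rcases le_total (2 * k.val) q with h | h
  · have hm : min k.val (q - k.val) = k.val := by omega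
    have h3 : (k.val : ℝ) / q ≤ 1 / 2 := by
      rw [div_le_div_iff₀ hq (by norm_num)]
      have : (2 * k.val : ℝ) ≤ q := by exact_mod_cast h
      linarith
    have := Real.mul_le_sin (x := Real.pi * (k.val / q)) (by positivity) (by nlinarith)
    have e : 2 / Real.pi * (Real.pi * ((k.val : ℝ) / q)) = 2 * (k.val / q) := by
      field_simp
    rw [e] at this
    rw [hm]
    have h4 := le_abs_self (Real.sin (Real.pi * (k.val / q)))
    calc 4 * (k.val : ℝ) / q = 2 * (2 * (k.val / q)) := by ring
      _ ≤ _ := by linarith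
  · have hm : min k.val (q - k.val) = q - k.val := by omega
    have h3 : 1 / 2 ≤ (k.val : ℝ) / q := by
      rw [div_le_div_iff₀ (by norm_num) hq]
      have : (q : ℝ) ≤ 2 * k.val := by exact_mod_cast h
      linarith
    have h3' : (k.val : ℝ) / q ≤ 1 := by
      rw [div_le_one hq]; exact_mod_cast hlt.le
    have := Real.mul_le_sin (x := Real.pi - Real.pi * (k.val / q)) (by nlinarith) (by nlinarith)
    rw [Real.sin_pi_sub] at this
    have e : 2 / Real.pi * (Real.pi - Real.pi * ((k.val : ℝ) / q)) = 2 * (1 - k.val / q) := by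
      field_simp
    rw [e] at this
    rw [hm, Nat.cast_sub hlt.le]
    have h4 := le_abs_self (Real.sin (Real.pi * (k.val / q)))
    calc 4 * ((q : ℝ) - k.val) / q = 2 * (2 * (1 - k.val / q)) := by field_simp; ring
      _ ≤ _ := by linarith

/-- Fourier coefficient of the interval `[A, A + l)`. -/
def intervalSum (A : ℤ) (l : ℕ) (m : ZMod q) : ℂ :=
  ∑ i ∈ Finset.range l, ZMod.stdAddChar (-(m * ((A + i : ℤ) : ZMod q)))

lemma intervalSum_zero (A : ℤ) (l : ℕ) : intervalSum A l (0 : ZMod q) = l := by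
  simp [intervalSum]

lemma norm_intervalSum_mul_le (A : ℤ) (l : ℕ) (m : ZMod q) :
    ‖intervalSum A l m‖ * ‖(ZMod.stdAddChar m : ℂ) - 1‖ ≤ 2 := by
  have h1 : intervalSum A l m = ZMod.stdAddChar (-(m * (A : ZMod q))) *
      ∑ i ∈ Finset.range l, (ZMod.stdAddChar (-m) : ℂ) ^ i := by
    unfold intervalSum
    rw [Finset.mul_sum]
    refine Finset.sum_congr rfl fun i _ => ?_
    rw [← AddChar.map_nsmul_eq_pow, ← AddChar.map_add_eq_mul]
    congr 1
    push_cast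
    rw [nsmul_eq_mul]
    ring
  have h2 : ‖(ZMod.stdAddChar m : ℂ) - 1‖ = ‖(ZMod.stdAddChar (-m) : ℂ) - 1‖ := by
    rw [← stdAddChar_star, ← RCLike.norm_conj, map_sub, map_one]
  rw [h1, h2, norm_mul, AddChar.norm_apply, one_mul, ← norm_mul, geom_sum_mul]
  refine (norm_sub_le _ _).trans ?_
  rw [norm_pow, AddChar.norm_apply, one_pow, norm_one]
  norm_num

lemma norm_intervalSum_le (A : ℤ) (l : ℕ) (m : ZMod q) (hm : m ≠ 0) :
    ‖intervalSum A l m‖ ≤ (q : ℝ) / 2 * (1 / (m.val : ℝ) + 1 / ((q - m.val : ℕ) : ℝ)) := by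
  have hq : (0 : ℝ) < q := by exact_mod_cast Nat.pos_of_ne_zero (NeZero.ne q)
  have hlt : m.val < q := ZMod.val_lt m
  have hv : 0 < m.val := Nat.pos_of_ne_zero (by simpa using hm)
  have hw : 0 < q - m.val := by omega
  set v := m.val with hvd
  set w := q - v with hwd
  have h1 := four_mul_min_le_norm_stdAddChar_sub_one m
  have h2 := norm_intervalSum_mul_le A l m
  have hmin : (0 : ℝ) < (min v w : ℕ) := by exact_mod_cast lt_min hv hw
  have h3 : ‖intervalSum A l m‖ * (4 * (min v w : ℕ) / (q : ℝ)) ≤ 2 :=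
    le_trans (mul_le_mul_of_nonneg_left h1 (norm_nonneg _)) h2
  have h4 : ‖intervalSum A l m‖ ≤ (q : ℝ) / 2 * (1 / ((min v w : ℕ) : ℝ)) := by
    have : ‖intervalSum A l m‖ * (4 * (min v w : ℕ) / (q : ℝ)) * (q / (4 * (min v w : ℕ)))
      ≤ 2 * (q / (4 * (min v w : ℕ))) := by gcongr
    calc ‖intervalSum A l m‖ = _ := by field_simp
      _ ≤ _ := this
      _ = _ := by field_simp; norm_num
  refine h4.trans ?_
  gcongr
  have p1 : 0 ≤ 1 / (v : ℝ) := by positivity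
  have p2 : 0 ≤ 1 / (w : ℝ) := by positivity
  rcases min_choice v w with h | h <;> rw [h] <;> linarith

lemma sum_gcd_div_le (q : ℕ) (hq : q ≠ 0) :
    ∑ m ∈ Finset.Ico 1 q, (Nat.gcd m q : ℝ) / m ≤ q.divisors.card * (1 + Real.log q) := by
  have hq1 : 1 ≤ q := Nat.pos_of_ne_zero hq
  calc ∑ m ∈ Finset.Ico 1 q, (Nat.gcd m q : ℝ) / m
      ≤ ∑ m ∈ Finset.Ico 1 q, ∑ d ∈ q.divisors, if d ∣ m then (d : ℝ) / m else 0 := by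
        refine Finset.sum_le_sum fun m _ => ?_
        have := Finset.single_le_sum (f := fun d => if d ∣ m then (d : ℝ) / m else 0)
          (fun d _ => by split_ifs <;> positivity)
          (Nat.mem_divisors.2 ⟨Nat.gcd_dvd_right m q, hq⟩)
        simpa [Nat.gcd_dvd_left] using this
    _ = ∑ d ∈ q.divisors, ∑ m ∈ Finset.Ico 1 q, if d ∣ m then (d : ℝ) / m else 0 :=
        Finset.sum_comm
    _ ≤ ∑ d ∈ q.divisors, (1 + Real.log q) := by
        refine Finset.sum_le_sum fun d hd => ?_
        have hd0 : 0 < d := Nat.pos_of_mem_divisors hd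
        rw [← Finset.sum_filter]
        calc ∑ m ∈ (Finset.Ico 1 q).filter (d ∣ ·), (d : ℝ) / m
            ≤ ∑ e ∈ Finset.Icc 1 q, ((e : ℝ))⁻¹ := by
              have hsub : (Finset.Ico 1 q).filter (d ∣ ·) ⊆ (Finset.Icc 1 q).image (d * ·) := by
                intro m hm
                simp only [Finset.mem_filter, Finset.mem_Ico] at hm
                obtain ⟨⟨hm1, hmq⟩, e, rfl⟩ := hm
                refine Finset.mem_image.2 ⟨e, Finset.mem_Icc.2 ⟨?_, ?_⟩, rfl⟩
                · exact Nat.pos_of_ne_zero (by rintro rfl; simp at hm1)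
                · nlinarith
              refine (Finset.sum_le_sum_of_subset_of_nonneg hsub
                (fun _ _ _ => by positivity)).trans ?_
              rw [Finset.sum_image (fun a _ b _ h => Nat.eq_of_mul_eq_mul_left hd0 h)]
              refine Finset.sum_le_sum fun e _ => ?_
              have hd' : (d : ℝ) ≠ 0 := by positivity
              push_cast
              rw [div_eq_mul_inv, mul_inv, ← mul_assoc, mul_inv_cancel₀ hd', one_mul]
          _ = ((harmonic q : ℚ) : ℝ) := by rw [harmonic_eq_sum_Icc]; push_cast; rfl
          _ ≤ _ := harmonic_le_one_add_log q
    _ = _ := by rw [Finset.sum_const, nsmul_eq_mul]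

/-- The weighted `ℓ¹` norm of the non-trivial Fourier coefficients of an interval. -/
lemma sum_norm_intervalSum_mul_gcd_le (A : ℤ) (l : ℕ) :
    ∑ m ∈ Finset.univ.erase (0 : ZMod q), ‖intervalSum A l m‖ * (Nat.gcd m.val q : ℝ)
      ≤ q * (q.divisors.card * (1 + Real.log q)) := by
  have hq : q ≠ 0 := NeZero.ne q
  set f : ℕ → ℝ := fun v => (q : ℝ) / 2 * (1 / (v : ℝ) + 1 / ((q - v : ℕ) : ℝ)) * (Nat.gcd v q : ℝ)
  have h1 : ∑ m ∈ Finset.univ.erase (0 : ZMod q), ‖intervalSum A l m‖ * (Nat.gcd m.val q : ℝ)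
      ≤ ∑ m ∈ Finset.univ.erase (0 : ZMod q), f m.val := by
    refine Finset.sum_le_sum fun m hm => ?_
    have := norm_intervalSum_le A l m (Finset.ne_of_mem_erase hm)
    simp only [f]
    gcongr
  have h2 : ∑ m ∈ Finset.univ.erase (0 : ZMod q), f m.val = ∑ v ∈ Finset.Ico 1 q, f v := by
    refine Finset.sum_bij (fun x _ => x.val) ?_ ?_ ?_ ?_
    · intro x hx
      have := ZMod.val_lt x
      have h0 : x.val ≠ 0 := by simpa using Finset.ne_of_mem_erase hx
      simp; omega
    · intro x _ y _ h; exact ZMod.val_injective q h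
    · intro i hi
      simp only [Finset.mem_Ico] at hi
      have hv : ((i : ZMod q)).val = i := ZMod.val_cast_of_lt hi.2
      refine ⟨(i : ZMod q), ?_, hv⟩
      simp only [Finset.mem_erase, Finset.mem_univ, and_true]
      intro h0
      rw [h0] at hv
      simp at hv
      omega
    · intro _ _; rfl
  have h3 : ∑ v ∈ Finset.Ico 1 q, f v
      = (q : ℝ) / 2 * (∑ v ∈ Finset.Ico 1 q, (Nat.gcd v q : ℝ) / v +
        ∑ v ∈ Finset.Ico 1 q, (Nat.gcd v q : ℝ) / ((q - v : ℕ) : ℝ)) := by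
    rw [← Finset.sum_add_distrib, Finset.mul_sum]
    refine Finset.sum_congr rfl fun v _ => ?_
    simp only [f]
    ring
  have h4 : ∑ v ∈ Finset.Ico 1 q, (Nat.gcd v q : ℝ) / ((q - v : ℕ) : ℝ)
      = ∑ v ∈ Finset.Ico 1 q, (Nat.gcd v q : ℝ) / v := by
    refine Finset.sum_bij' (fun v _ => q - v) (fun v _ => q - v) ?_ ?_ ?_ ?_ ?_
    · intro v hv; simp at hv ⊢; omega
    · intro v hv; simp at hv ⊢; omega
    · intro v hv; simp at hv ⊢; omega
    · intro v hv; simp at hv ⊢; omega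
    · intro v hv
      simp only [Finset.mem_Ico] at hv
      rw [Nat.gcd_comm (q - v), Nat.gcd_self_sub_right hv.2.le, Nat.gcd_comm]
  rw [h2, h3, h4] at h1
  refine h1.trans ?_
  have := sum_gcd_div_le q hq
  calc _ = (q : ℝ) * ∑ v ∈ Finset.Ico 1 q, (Nat.gcd v q : ℝ) / v := by ring
    _ ≤ _ := by gcongr

end Interval

/-! ### Points on the modular hyperbola in boxes -/

section Hyperbola

variable {q : ℕ} [NeZero q]

lemma annCard_mul_unit_le (n : ZMod q) (r : (ZMod q)ˣ) : annCard (n * (r : ZMod q)) ≤ annCard n := by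
  refine Finset.card_le_card_of_injOn (fun x => (r : ZMod q) * x) ?_ ?_
  · intro x hx
    simp only [Finset.coe_filter, Finset.mem_univ, true_and, Set.mem_ofPred_eq] at hx ⊢
    rw [← mul_assoc]; exact hx
  · intro a _ b _ h
    exact (Units.mul_right_inj r).1 h

lemma norm_kloosterman_le (m n : ZMod q) (K : ℕ) (hK : annCard m ≤ K ∨ annCard n ≤ K) :
    ‖kloosterman m n‖ ≤ 2 * (q : ℝ) ^ (3 / 4 : ℝ) * q.divisors.card * K := by
  have hq : 0 < q := Nat.pos_of_ne_zero (NeZero.ne q)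
  have h := kloosterman_pow_four_le m n K hK
  have hd : (1 : ℝ) ≤ q.divisors.card := by
    exact_mod_cast Finset.card_pos.2 ⟨1, by simp [hq.ne']⟩
  have hK1 : (1 : ℝ) ≤ K := by
    have : 1 ≤ K := by
      rcases hK with hK | hK
      · exact (annCard_pos m).trans_le hK
      · exact (annCard_pos n).trans_le hK
    exact_mod_cast this
  refine le_of_pow_le_pow_left₀ (n := 4) (by norm_num) (by positivity) (h.trans ?_)
  have e : ((q : ℝ) ^ (3 / 4 : ℝ)) ^ 4 = (q : ℝ) ^ 3 := by
    rw [← Real.rpow_natCast, ← Real.rpow_mul (by positivity), ← Real.rpow_natCast]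
    norm_num
  rw [mul_pow, mul_pow, mul_pow, e]
  have hd4 : (q.divisors.card : ℝ) ^ 3 ≤ (q.divisors.card : ℝ) ^ 4 :=
    pow_le_pow_right₀ hd (by norm_num)
  have hK4 : (K : ℝ) ≤ (K : ℝ) ^ 4 := le_self_pow₀ hK1 (by norm_num)
  gcongr
  norm_num

/-- The number of points of `x y = ρ` in `[A, A + l₁) × [B, B + l₂)`. -/
def hyperbolaCount (q : ℕ) (ρ : ZMod q) (A B : ℤ) (l₁ l₂ : ℕ) : ℕ :=
  ((Finset.range l₁ ×ˢ Finset.range l₂).filter fun p =>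
    ((A + p.1 : ℤ) : ZMod q) * ((B + p.2 : ℤ) : ZMod q) = ρ).card

lemma indicator_mul_eq (ρ : (ZMod q)ˣ) (x y : ZMod q) :
    ∑ m : ZMod q, ∑ n : ZMod q, kloosterman m (n * (ρ : ZMod q)) *
      (ZMod.stdAddChar (-(m * x)) * ZMod.stdAddChar (-(n * y)))
      = if x * y = (ρ : ZMod q) then (q : ℂ) ^ 2 else 0 := by
  classical
  have hchar : ∀ b : ZMod q, ∑ x : ZMod q, (ZMod.stdAddChar (x * b) : ℂ)
      = if b = 0 then (q : ℂ) else 0 := by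
    intro b
    have := AddChar.sum_mulShift b (ZMod.isPrimitive_stdAddChar q)
    rw [this, ZMod.card]
    push_cast
    rfl
  have h1 : ∀ m n : ZMod q, kloosterman m (n * (ρ : ZMod q)) *
      (ZMod.stdAddChar (-(m * x)) * ZMod.stdAddChar (-(n * y)))
      = ∑ u : (ZMod q)ˣ, (ZMod.stdAddChar (m * ((u : ZMod q) - x)) : ℂ) *
          ZMod.stdAddChar (n * ((ρ : ZMod q) * ((u⁻¹ : (ZMod q)ˣ) : ZMod q) - y)) := by
    intro m n
    unfold kloosterman
    rw [Finset.sum_mul]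
    refine Finset.sum_congr rfl fun u _ => ?_
    rw [← AddChar.map_add_eq_mul, ← AddChar.map_add_eq_mul, ← AddChar.map_add_eq_mul]
    congr 1
    ring
  simp_rw [h1]
  calc _ = ∑ u : (ZMod q)ˣ, (∑ m : ZMod q, (ZMod.stdAddChar (m * ((u : ZMod q) - x)) : ℂ)) *
          ∑ n : ZMod q, (ZMod.stdAddChar
            (n * ((ρ : ZMod q) * ((u⁻¹ : (ZMod q)ˣ) : ZMod q) - y)) : ℂ) := by
        simp_rw [Finset.sum_mul_sum]
        exact (Finset.sum_congr rfl fun m _ => Finset.sum_comm).trans Finset.sum_comm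
    _ = ∑ u : (ZMod q)ˣ, if (u : ZMod q) = x ∧ x * y = (ρ : ZMod q) then (q : ℂ) ^ 2 else 0 := by
        refine Finset.sum_congr rfl fun u _ => ?_
        rw [hchar, hchar]
        simp only [sub_eq_zero]
        by_cases hu : (u : ZMod q) = x
        · subst hu
          have : (ρ : ZMod q) * ((u⁻¹ : (ZMod q)ˣ) : ZMod q) = y ↔ (u : ZMod q) * y = ρ := by
            rw [Units.mul_inv_eq_iff_eq_mul, mul_comm y, eq_comm]
          simp only [this, true_and]
          split_ifs <;> simp [sq]
        · simp [hu]
    _ = _ := by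
        split_ifs with h
        · have hx : IsUnit x := isUnit_of_mul_isUnit_left (h ▸ ρ.isUnit)
          obtain ⟨v, rfl⟩ := hx
          rw [Finset.sum_eq_single v]
          · simp [h]
          · intro b _ hb
            rw [if_neg]
            rintro ⟨h', -⟩
            exact hb (Units.ext h')
          · simp
        · simp [h]

lemma hyperbolaCount_eq (ρ : (ZMod q)ˣ) (A B : ℤ) (l₁ l₂ : ℕ) :
    (q : ℂ) ^ 2 * (hyperbolaCount q ρ A B l₁ l₂ : ℂ)
      = ∑ m : ZMod q, ∑ n : ZMod q, kloosterman m (n * (ρ : ZMod q)) *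
          (intervalSum A l₁ m * intervalSum B l₂ n) := by
  classical
  unfold hyperbolaCount intervalSum
  rw [Finset.card_filter, Nat.cast_sum, Finset.mul_sum]
  have h1 : ∀ m n : ZMod q, kloosterman m (n * (ρ : ZMod q)) *
      ((∑ i ∈ Finset.range l₁, (ZMod.stdAddChar (-(m * ((A + i : ℤ) : ZMod q))) : ℂ)) *
        ∑ i ∈ Finset.range l₂, (ZMod.stdAddChar (-(n * ((B + i : ℤ) : ZMod q))) : ℂ))
      = ∑ p ∈ Finset.range l₁ ×ˢ Finset.range l₂, kloosterman m (n * (ρ : ZMod q)) *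
          (ZMod.stdAddChar (-(m * ((A + p.1 : ℤ) : ZMod q))) *
            ZMod.stdAddChar (-(n * ((B + p.2 : ℤ) : ZMod q)))) := by
    intro m n
    rw [Finset.sum_mul_sum, ← Finset.sum_product', Finset.mul_sum]
  simp_rw [h1]
  rw [(Finset.sum_congr rfl fun m _ => Finset.sum_comm).trans Finset.sum_comm]
  refine Finset.sum_congr rfl fun p _ => ?_
  rw [indicator_mul_eq]
  split_ifs <;> simp

lemma kloosterman_zero_zero : kloosterman (0 : ZMod q) 0 = q.totient := by
  simp [kloosterman, ZMod.card_units_eq_totient]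

lemma abs_hyperbolaCount_sub_le (ρ : (ZMod q)ˣ) (A B : ℤ) (l₁ l₂ : ℕ) :
    |(hyperbolaCount q ρ A B l₁ l₂ : ℝ) - l₁ * l₂ * q.totient / (q : ℝ) ^ 2|
      ≤ 2 * (q : ℝ) ^ (3 / 4 : ℝ) * q.divisors.card *
        (q.divisors.card * (1 + Real.log q)) ^ 2 * (1 + (l₁ + l₂) / q) := by
  classical
  have hq : 0 < q := Nat.pos_of_ne_zero (NeZero.ne q)
  have hq' : (0 : ℝ) < q := by exact_mod_cast hq
  set b : ℝ := 2 * (q : ℝ) ^ (3 / 4 : ℝ) * q.divisors.card with hb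
  set Q : ℝ := q.divisors.card * (1 + Real.log q) with hQ
  have hb0 : 0 ≤ b := by positivity
  have hQ1 : 1 ≤ Q := by
    have hd : (1 : ℝ) ≤ q.divisors.card := by
      exact_mod_cast Finset.card_pos.2 ⟨1, by simp [hq.ne']⟩
    have hl : 0 ≤ Real.log q := Real.log_natCast_nonneg q
    nlinarith
  set F : ZMod q → ℂ := intervalSum A l₁ with hF
  set G : ZMod q → ℂ := intervalSum B l₂ with hG
  have hgF := sum_norm_intervalSum_mul_gcd_le (q := q) A l₁
  have hgG := sum_norm_intervalSum_mul_gcd_le (q := q) B l₂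
  rw [← hF, ← hQ] at hgF
  rw [← hG, ← hQ] at hgG
  have hGsum : ∑ n : ZMod q, ‖G n‖ ≤ l₂ + q * Q := by
    rw [← Finset.add_sum_erase _ _ (Finset.mem_univ (0 : ZMod q))]
    refine add_le_add ?_ (le_trans ?_ hgG)
    · rw [hG, intervalSum_zero]; simp
    · refine Finset.sum_le_sum fun n _ => ?_
      refine le_mul_of_one_le_right (norm_nonneg _) ?_
      exact_mod_cast Nat.gcd_pos_of_pos_right _ hq
  have hid : (q : ℂ) ^ 2 * (hyperbolaCount q ρ A B l₁ l₂ : ℂ)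
      = ∑ m : ZMod q, ∑ n : ZMod q, kloosterman m (n * (ρ : ZMod q)) * (F m * G n) :=
    hyperbolaCount_eq ρ A B l₁ l₂
  have hF0 : F 0 = l₁ := intervalSum_zero A l₁
  have hG0 : G 0 = l₂ := intervalSum_zero B l₂
  have hsplit : (q : ℂ) ^ 2 * (hyperbolaCount q ρ A B l₁ l₂ : ℂ) - l₁ * l₂ * q.totient
      = ∑ m ∈ Finset.univ.erase (0 : ZMod q), ∑ n : ZMod q,
          kloosterman m (n * (ρ : ZMod q)) * (F m * G n)
        + ∑ n ∈ Finset.univ.erase (0 : ZMod q),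
          kloosterman 0 (n * (ρ : ZMod q)) * (F 0 * G n) := by
    rw [hid, ← Finset.add_sum_erase _ _ (Finset.mem_univ (0 : ZMod q)),
      ← Finset.add_sum_erase _ (fun n => kloosterman 0 (n * (ρ : ZMod q)) * (F 0 * G n))
        (Finset.mem_univ (0 : ZMod q)), zero_mul, kloosterman_zero_zero, hF0, hG0]
    ring
  have hbd1 : ‖∑ m ∈ Finset.univ.erase (0 : ZMod q), ∑ n : ZMod q,
          kloosterman m (n * (ρ : ZMod q)) * (F m * G n)‖ ≤ b * (q * Q) * (l₂ + q * Q) := by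
    calc _ ≤ ∑ m ∈ Finset.univ.erase (0 : ZMod q), ∑ n : ZMod q,
          ‖kloosterman m (n * (ρ : ZMod q)) * (F m * G n)‖ :=
          (norm_sum_le _ _).trans (Finset.sum_le_sum fun m _ => norm_sum_le _ _)
      _ ≤ ∑ m ∈ Finset.univ.erase (0 : ZMod q), ∑ n : ZMod q,
          b * ((‖F m‖ * (Nat.gcd m.val q : ℝ)) * ‖G n‖) := by
          refine Finset.sum_le_sum fun m _ => Finset.sum_le_sum fun n _ => ?_
          rw [norm_mul, norm_mul]
          have := norm_kloosterman_le m (n * (ρ : ZMod q)) _ (Or.inl (annCard_le_gcd_val m))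
          calc _ ≤ (b * (Nat.gcd m.val q : ℝ)) * (‖F m‖ * ‖G n‖) := by gcongr
            _ = _ := by ring
      _ = b * ((∑ m ∈ Finset.univ.erase (0 : ZMod q), ‖F m‖ * (Nat.gcd m.val q : ℝ)) *
            ∑ n : ZMod q, ‖G n‖) := by
          rw [Finset.sum_mul_sum, Finset.mul_sum]
          simp_rw [Finset.mul_sum]
      _ ≤ b * ((q * Q) * (l₂ + q * Q)) := by gcongr
      _ = _ := by ring
  have hbd2 : ‖∑ n ∈ Finset.univ.erase (0 : ZMod q),
          kloosterman 0 (n * (ρ : ZMod q)) * (F 0 * G n)‖ ≤ b * (q * Q) * l₁ := by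
    calc _ ≤ ∑ n ∈ Finset.univ.erase (0 : ZMod q),
          ‖kloosterman 0 (n * (ρ : ZMod q)) * (F 0 * G n)‖ := norm_sum_le _ _
      _ ≤ ∑ n ∈ Finset.univ.erase (0 : ZMod q), b * l₁ * (‖G n‖ * (Nat.gcd n.val q : ℝ)) := by
          refine Finset.sum_le_sum fun n _ => ?_
          rw [norm_mul, norm_mul, hF0]
          have := norm_kloosterman_le 0 (n * (ρ : ZMod q)) _
            (Or.inr ((annCard_mul_unit_le n ρ).trans (annCard_le_gcd_val n)))
          rw [RCLike.norm_natCast]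
          calc _ ≤ (b * (Nat.gcd n.val q : ℝ)) * (l₁ * ‖G n‖) := by gcongr
            _ = _ := by ring
      _ ≤ b * l₁ * (q * Q) := by
          rw [← Finset.mul_sum]
          gcongr
      _ = _ := by ring
  have htot : |(q : ℝ) ^ 2 * (hyperbolaCount q ρ A B l₁ l₂ : ℝ) - l₁ * l₂ * q.totient|
      ≤ b * (q * Q) * (l₂ + q * Q) + b * (q * Q) * l₁ := by
    have h1 : ((((q : ℝ) ^ 2 * (hyperbolaCount q ρ A B l₁ l₂ : ℝ) - l₁ * l₂ * q.totient : ℝ)) : ℂ)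
        = (q : ℂ) ^ 2 * (hyperbolaCount q ρ A B l₁ l₂ : ℂ) - l₁ * l₂ * q.totient := by
      push_cast; ring
    rw [← Real.norm_eq_abs, ← Complex.norm_real, h1, hsplit]
    exact (norm_add_le _ _).trans (add_le_add hbd1 hbd2)
  have hdiv : (hyperbolaCount q ρ A B l₁ l₂ : ℝ) - l₁ * l₂ * q.totient / (q : ℝ) ^ 2
      = ((q : ℝ) ^ 2 * (hyperbolaCount q ρ A B l₁ l₂ : ℝ) - l₁ * l₂ * q.totient) / (q : ℝ) ^ 2 := by
    field_simp
  rw [hdiv, abs_div, abs_of_pos (by positivity : (0 : ℝ) < (q : ℝ) ^ 2), div_le_iff₀ (by positivity)]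
  refine htot.trans ?_
  have e1 : b * (q * Q) * (l₂ + q * Q) + b * (q * Q) * l₁
      = b * (q : ℝ) ^ 2 * (Q ^ 2 + Q * ((l₁ + l₂) / q)) := by
    field_simp
    ring
  have e2 : b * Q ^ 2 * (1 + (l₁ + l₂) / q) * (q : ℝ) ^ 2
      = b * (q : ℝ) ^ 2 * (Q ^ 2 + Q ^ 2 * ((l₁ + l₂) / q)) := by ring
  rw [e1, e2]
  have : Q ≤ Q ^ 2 := le_self_pow₀ hQ1 (by norm_num)
  gcongr

end Hyperbola

lemma exists_abs_hyperbolaCount_sub_le :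
    ∃ C : ℝ, 1 ≤ C ∧ ∀ (q : ℕ) [NeZero q] (ρ : (ZMod q)ˣ) (A B : ℤ) (l₁ l₂ : ℕ),
      |(hyperbolaCount q ρ A B l₁ l₂ : ℝ) - l₁ * l₂ * q.totient / (q : ℝ) ^ 2|
        ≤ C * (q : ℝ) ^ (7 / 8 : ℝ) * (1 + (l₁ + l₂) / q) := by
  obtain ⟨C, hC1, hC⟩ := exists_card_divisors_le_rpow (ε := 1 / 40) (by norm_num)
  refine ⟨2 * C ^ 3 * 41 ^ 2, ?_, ?_⟩
  · have := one_le_pow₀ (n := 3) hC1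
    linarith
  intro q _ ρ A B l₁ l₂
  refine (abs_hyperbolaCount_sub_le ρ A B l₁ l₂).trans ?_
  have hq : 0 < q := Nat.pos_of_ne_zero (NeZero.ne q)
  have hq1 : (1 : ℝ) ≤ q := by exact_mod_cast hq
  refine mul_le_mul_of_nonneg_right ?_ (by positivity)
  have hd := hC q hq.ne'
  have hl : 1 + Real.log q ≤ 41 * (q : ℝ) ^ (1 / 40 : ℝ) := by
    have h1 := Real.log_le_rpow_div (x := q) (ε := 1 / 40) (by positivity) (by norm_num)
    have h2 : (1 : ℝ) ≤ (q : ℝ) ^ (1 / 40 : ℝ) := Real.one_le_rpow hq1 (by norm_num)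
    linarith
  have hl0 : 0 ≤ 1 + Real.log q := by
    have : 0 ≤ Real.log q := Real.log_natCast_nonneg q
    linarith
  calc 2 * (q : ℝ) ^ (3 / 4 : ℝ) * q.divisors.card * (q.divisors.card * (1 + Real.log q)) ^ 2
      ≤ 2 * (q : ℝ) ^ (3 / 4 : ℝ) * (C * (q : ℝ) ^ (1 / 40 : ℝ)) *
        ((C * (q : ℝ) ^ (1 / 40 : ℝ)) * (41 * (q : ℝ) ^ (1 / 40 : ℝ))) ^ 2 := by gcongr
    _ = 2 * C ^ 3 * 41 ^ 2 * ((q : ℝ) ^ (3 / 4 : ℝ) * ((q : ℝ) ^ (1 / 40 : ℝ)) ^ 5) := by ring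
    _ = 2 * C ^ 3 * 41 ^ 2 * (q : ℝ) ^ (7 / 8 : ℝ) := by
        congr 1
        rw [← Real.rpow_natCast, ← Real.rpow_mul (by positivity), ← Real.rpow_add (by positivity)]
        norm_num

/-- The number of points of `a d ≡ 1 (mod q)` in the box `[A, A + l₁) × [B, B + l₂)` with
`a ≡ a₀` and `d ≡ d₀ (mod N)`. -/
def apCount (q N : ℕ) (a₀ d₀ A B : ℤ) (l₁ l₂ : ℕ) : ℕ :=
  ((Finset.Ico A (A + l₁) ×ˢ Finset.Ico B (B + l₂)).filter fun p =>
    p.1 ≡ a₀ [ZMOD N] ∧ p.2 ≡ d₀ [ZMOD N] ∧ p.1 * p.2 ≡ 1 [ZMOD q]).card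

lemma exists_interval_of_progression (N : ℕ) (hN : 0 < N) (a₀ A : ℤ) (l : ℕ) :
    ∃ (A' : ℤ) (l' : ℕ), |(l' : ℝ) - (l : ℝ) / N| ≤ 1 ∧
      ∀ i : ℤ, (A ≤ a₀ + N * i ∧ a₀ + N * i < A + l) ↔ (A' ≤ i ∧ i < A' + l') := by
  have hN' : (0 : ℝ) < N := by exact_mod_cast hN
  set x : ℝ := ((A : ℝ) - a₀) / N with hx
  set y : ℝ := ((A : ℝ) + l - a₀) / N with hy
  have hxy : y - x = l / N := by rw [hx, hy]; ring
  have hl : (0 : ℝ) ≤ l / N := by positivity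
  have hle : ⌈x⌉ ≤ ⌈y⌉ := Int.ceil_mono (by linarith)
  refine ⟨⌈x⌉, (⌈y⌉ - ⌈x⌉).toNat, ?_, ?_⟩
  · have h1 : (((⌈y⌉ - ⌈x⌉).toNat : ℕ) : ℝ) = ⌈y⌉ - ⌈x⌉ := by
      have : (((⌈y⌉ - ⌈x⌉).toNat : ℕ) : ℤ) = ⌈y⌉ - ⌈x⌉ := Int.toNat_of_nonneg (by omega)
      exact_mod_cast this
    rw [h1, ← hxy, abs_le]
    have := Int.ceil_lt_add_one x
    have := Int.ceil_lt_add_one y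
    have := Int.le_ceil x
    have := Int.le_ceil y
    constructor <;> linarith
  · intro i
    have h1 : (((⌈y⌉ - ⌈x⌉).toNat : ℕ) : ℤ) = ⌈y⌉ - ⌈x⌉ := Int.toNat_of_nonneg (by omega)
    rw [h1, add_sub_cancel, Int.ceil_le, Int.lt_ceil, hx, hy, div_le_iff₀ hN', lt_div_iff₀ hN']
    constructor
    · rintro ⟨h2, h3⟩
      have h2' : (A : ℝ) ≤ a₀ + N * i := by exact_mod_cast h2
      have h3' : (a₀ : ℝ) + N * i < A + l := by exact_mod_cast h3
      constructor <;> linarith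
    · rintro ⟨h2, h3⟩
      have h2' : (A : ℝ) ≤ a₀ + N * i := by linarith
      have h3' : (a₀ : ℝ) + N * i < A + l := by linarith
      exact ⟨by exact_mod_cast h2', by exact_mod_cast h3'⟩

lemma exists_apCount_eq (q N : ℕ) [NeZero q] (hN : 0 < N) (hqN : N.Coprime q) (a₀ d₀ A B : ℤ)
    (l₁ l₂ : ℕ) : ∃ (ρ : (ZMod q)ˣ) (A' B' : ℤ) (l₁' l₂' : ℕ),
      |(l₁' : ℝ) - (l₁ : ℝ) / N| ≤ 1 ∧ |(l₂' : ℝ) - (l₂ : ℝ) / N| ≤ 1 ∧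
      apCount q N a₀ d₀ A B l₁ l₂ = hyperbolaCount q ρ A' B' l₁' l₂' := by
  obtain ⟨A', l₁', hl₁, hA⟩ := exists_interval_of_progression N hN a₀ A l₁
  obtain ⟨B', l₂', hl₂, hB⟩ := exists_interval_of_progression N hN d₀ B l₂
  set v : (ZMod q)ˣ := ZMod.unitOfCoprime N hqN with hv
  have hvN : (v : ZMod q) = N := ZMod.coe_unitOfCoprime N hqN
  obtain ⟨s, hs⟩ := ZMod.intCast_surjective (((v⁻¹ : (ZMod q)ˣ) : ZMod q) * (a₀ : ZMod q))
  obtain ⟨t, ht⟩ := ZMod.intCast_surjective (((v⁻¹ : (ZMod q)ˣ) : ZMod q) * (d₀ : ZMod q))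
  have hs' : (N : ZMod q) * (s : ZMod q) = a₀ := by
    rw [hs, ← hvN, ← mul_assoc, Units.mul_inv, one_mul]
  have ht' : (N : ZMod q) * (t : ZMod q) = d₀ := by
    rw [ht, ← hvN, ← mul_assoc, Units.mul_inv, one_mul]
  refine ⟨v⁻¹ * v⁻¹, A' + s, B' + t, l₁', l₂', hl₁, hl₂, ?_⟩
  unfold apCount hyperbolaCount
  have hNz : (N : ℤ) ≠ 0 := by exact_mod_cast hN.ne'
  symm
  refine Finset.card_bij (fun p _ => (a₀ + N * (A' + p.1), d₀ + N * (B' + p.2))) ?_ ?_ ?_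
  · rintro ⟨i, j⟩ hp
    simp only [Finset.mem_filter, Finset.mem_product, Finset.mem_range, Finset.mem_Ico] at hp ⊢
    obtain ⟨⟨hi, hj⟩, h⟩ := hp
    have hA' := (hA (A' + i)).2 (by omega)
    have hB' := (hB (B' + j)).2 (by omega)
    refine ⟨⟨hA', hB'⟩, ?_, ?_, ?_⟩
    · exact (Int.modEq_iff_dvd.2 ⟨-(A' + i), by ring⟩)
    · exact (Int.modEq_iff_dvd.2 ⟨-(B' + j), by ring⟩)
    · rw [← ZMod.intCast_eq_intCast_iff]
      push_cast at h ⊢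
      rw [← hs', ← ht', ← hvN]
      calc _ = (v : ZMod q) * v * ((A' + s + i) * (B' + t + j)) := by ring
        _ = (v * ((v⁻¹ : (ZMod q)ˣ) : ZMod q)) * (v * ((v⁻¹ : (ZMod q)ˣ) : ZMod q)) := by
            rw [h]; ring
        _ = 1 := by rw [Units.mul_inv, one_mul]
  · rintro ⟨i, j⟩ _ ⟨i', j'⟩ _ h
    simp only [Prod.mk.injEq, add_right_inj, mul_eq_mul_left_iff, hNz, or_false,
      Nat.cast_inj] at h
    rw [h.1, h.2]
  · rintro ⟨a, d⟩ hp
    simp only [Finset.mem_filter, Finset.mem_product, Finset.mem_Ico] at hp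
    obtain ⟨⟨ha, hd⟩, h1, h2, h3⟩ := hp
    obtain ⟨i, hi⟩ := Int.modEq_iff_dvd.1 h1.symm
    obtain ⟨j, hj⟩ := Int.modEq_iff_dvd.1 h2.symm
    have ha' : a = a₀ + N * i := by linarith
    have hd' : d = d₀ + N * j := by linarith
    subst ha' hd'
    have hi' := (hA i).1 ha
    have hj' := (hB j).1 hd
    have ei : (((i - A').toNat : ℕ) : ℤ) = i - A' := Int.toNat_of_nonneg (by omega)
    have ej : (((j - B').toNat : ℕ) : ℤ) = j - B' := Int.toNat_of_nonneg (by omega)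
    refine ⟨((i - A').toNat, (j - B').toNat), ?_, ?_⟩
    · simp only [Finset.mem_filter, Finset.mem_product, Finset.mem_range]
      refine ⟨⟨by omega, by omega⟩, ?_⟩
      rw [ei, ej]
      rw [← ZMod.intCast_eq_intCast_iff] at h3
      push_cast at h3 ⊢
      rw [← hs', ← ht', ← hvN] at h3
      calc _ = ((v⁻¹ : (ZMod q)ˣ) : ZMod q) * v * (((v⁻¹ : (ZMod q)ˣ) : ZMod q) * v) *
            ((s + i) * (t + j)) := by rw [Units.inv_mul]; ring
        _ = ((v⁻¹ : (ZMod q)ˣ) : ZMod q) * ((v⁻¹ : (ZMod q)ˣ) : ZMod q) *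
            ((v * s + v * i) * (v * t + v * j)) := by ring
        _ = _ := by rw [h3, mul_one]
    · simp only [ei, ej, add_sub_cancel]

/-- Equidistribution on the modular hyperbola in boxes and arithmetic progressions. -/
lemma exists_abs_apCount_sub_le :
    ∃ C : ℝ, 1 ≤ C ∧ ∀ (q N : ℕ), 0 < q → 0 < N → N.Coprime q →
      ∀ (a₀ d₀ A B : ℤ) (l₁ l₂ : ℕ),
      |(apCount q N a₀ d₀ A B l₁ l₂ : ℝ) - q.totient / ((q : ℝ) ^ 2 * (N : ℝ) ^ 2) * (l₁ * l₂)|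
        ≤ C * (q : ℝ) ^ (7 / 8 : ℝ) * (1 + (l₁ + l₂) / q) := by
  obtain ⟨C, hC1, hC⟩ := exists_abs_hyperbolaCount_sub_le
  refine ⟨4 * C, by linarith, ?_⟩
  intro q N hq hN hqN a₀ d₀ A B l₁ l₂
  have : NeZero q := ⟨hq.ne'⟩
  obtain ⟨ρ, A', B', l₁', l₂', h1, h2, he⟩ := exists_apCount_eq q N hN hqN a₀ d₀ A B l₁ l₂
  have h := hC q ρ A' B' l₁' l₂'
  rw [he]
  have hq1 : (1 : ℝ) ≤ q := by exact_mod_cast hq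
  have hN1 : (1 : ℝ) ≤ N := by exact_mod_cast hN
  have hx1 : (l₁ : ℝ) / N ≤ l₁ := div_le_self (by positivity) hN1
  have hx2 : (l₂ : ℝ) / N ≤ l₂ := div_le_self (by positivity) hN1
  have hx1' : 0 ≤ (l₁ : ℝ) / N := by positivity
  have hx2' : 0 ≤ (l₂ : ℝ) / N := by positivity
  set x := (l₁ : ℝ) / N with hx
  set y := (l₂ : ℝ) / N with hy
  set X : ℝ := 1 + (l₁ + l₂) / q with hX
  have hX1 : 1 ≤ X := by
    have : (0 : ℝ) ≤ (l₁ + l₂) / q := by positivity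
    linarith
  have hpow : 1 ≤ (q : ℝ) ^ (7 / 8 : ℝ) := Real.one_le_rpow hq1 (by norm_num)
  have hmain : (q.totient : ℝ) / ((q : ℝ) ^ 2 * (N : ℝ) ^ 2) * (l₁ * l₂)
      = x * y * q.totient / (q : ℝ) ^ 2 := by
    rw [hx, hy]
    field_simp
  rw [hmain]
  rw [abs_le] at h1 h2
  have hl1 : (l₁' : ℝ) ≤ l₁ + 1 := by linarith
  have hl2 : (l₂' : ℝ) ≤ l₂ + 1 := by linarith
  have hprod : |(l₁' : ℝ) * l₂' - x * y| ≤ l₁ + l₂ + 1 := by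
    have e : (l₁' : ℝ) * l₂' - x * y = (l₁' - x) * l₂' + x * (l₂' - y) := by ring
    rw [e]
    have hp := abs_add_le ((l₁' - x) * (l₂' : ℝ)) (x * (l₂' - y))
    have a1 : |((l₁' : ℝ) - x) * l₂'| ≤ l₂' := by
      rw [abs_mul, abs_of_nonneg (by positivity : (0 : ℝ) ≤ (l₂' : ℝ))]
      exact mul_le_of_le_one_left (by positivity) (abs_le.2 h1)
    have a2 : |x * ((l₂' : ℝ) - y)| ≤ x := by
      rw [abs_mul, abs_of_nonneg hx1']
      exact mul_le_of_le_one_right hx1' (abs_le.2 h2)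
    linarith
  have hφ : (q.totient : ℝ) ≤ q := by exact_mod_cast Nat.totient_le q
  have hdiff : |(l₁' : ℝ) * l₂' * q.totient / (q : ℝ) ^ 2 - x * y * q.totient / (q : ℝ) ^ 2|
      ≤ X := by
    have e : (l₁' : ℝ) * l₂' * q.totient / (q : ℝ) ^ 2 - x * y * q.totient / (q : ℝ) ^ 2
        = (l₁' * l₂' - x * y) * (q.totient / (q : ℝ) ^ 2) := by ring
    rw [e, abs_mul, abs_of_nonneg (by positivity : (0 : ℝ) ≤ q.totient / (q : ℝ) ^ 2)]
    have hr : (q.totient : ℝ) / (q : ℝ) ^ 2 ≤ 1 / q := by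
      rw [div_le_div_iff₀ (by positivity) (by positivity)]
      nlinarith
    calc _ ≤ ((l₁ : ℝ) + l₂ + 1) * (1 / q) := by gcongr
      _ = (l₁ + l₂) / q + 1 / q := by ring
      _ ≤ X := by
        have : 1 / (q : ℝ) ≤ 1 := by rw [div_le_one (by positivity)]; exact hq1
        linarith
  have hX3 : 1 + ((l₁' : ℝ) + l₂') / q ≤ 3 * X := by
    have : ((l₁' : ℝ) + l₂') / q ≤ (l₁ + l₂) / q + 2 := by
      calc ((l₁' : ℝ) + l₂') / q ≤ (l₁ + l₂ + 2) / q := by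
            apply div_le_div_of_nonneg_right _ (by positivity)
            linarith
        _ = (l₁ + l₂) / q + 2 / q := by ring
        _ ≤ _ := by
          have : 2 / (q : ℝ) ≤ 2 := div_le_self (by norm_num) hq1
          linarith
    linarith
  calc _ ≤ |(hyperbolaCount q ρ A' B' l₁' l₂' : ℝ) - l₁' * l₂' * q.totient / (q : ℝ) ^ 2| +
        |(l₁' : ℝ) * l₂' * q.totient / (q : ℝ) ^ 2 - x * y * q.totient / (q : ℝ) ^ 2| :=
        abs_sub_le _ _ _
    _ ≤ C * (q : ℝ) ^ (7 / 8 : ℝ) * (3 * X) + X := by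
        refine add_le_add (h.trans ?_) hdiff
        gcongr
    _ ≤ C * (q : ℝ) ^ (7 / 8 : ℝ) * (3 * X) + C * (q : ℝ) ^ (7 / 8 : ℝ) * X := by
        have : 1 ≤ C * (q : ℝ) ^ (7 / 8 : ℝ) := one_le_mul_of_one_le_of_one_le hC1 hpow
        have := le_mul_of_one_le_left (by linarith : 0 ≤ X) this
        linarith
    _ = _ := by ring

/-! ### Counting in norm balls -/

theorem frobNorm_le_iff {γ : SL2Z} {T : ℝ} (hT : 0 ≤ T) :
    frobNorm γ ≤ T ↔
      (γ 0 0 : ℝ) ^ 2 + (γ 0 1 : ℝ) ^ 2 + (γ 1 0 : ℝ) ^ 2 + (γ 1 1 : ℝ) ^ 2 ≤ T ^ 2 := by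
  unfold frobNorm
  rw [Real.sqrt_le_left hT]
  push_cast
  rfl

theorem abs_le_of_sum_sq_le {x y z w T : ℝ} (hT : 0 ≤ T)
    (h : x ^ 2 + y ^ 2 + z ^ 2 + w ^ 2 ≤ T ^ 2) : |x| ≤ T :=
  abs_le_of_sq_le_sq (by nlinarith [sq_nonneg y, sq_nonneg z, sq_nonneg w]) hT

theorem nonneg_of_frobNorm_le {γ : SL2Z} {T : ℝ} (h : frobNorm γ ≤ T) : 0 ≤ T :=
  (Real.sqrt_nonneg _).trans h

theorem abs_entry_le {γ : SL2Z} {T : ℝ} (h : frobNorm γ ≤ T) (i j : Fin 2) :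
    |(γ i j : ℝ)| ≤ T := by
  have hT := nonneg_of_frobNorm_le h
  rw [frobNorm_le_iff hT] at h
  fin_cases i <;> fin_cases j <;> simp only [Fin.zero_eta, Fin.mk_one, Fin.isValue]
  · exact abs_le_of_sum_sq_le hT h
  · exact abs_le_of_sum_sq_le (y := γ 0 0) (z := γ 1 0) (w := γ 1 1) hT (by linarith)
  · exact abs_le_of_sum_sq_le (y := γ 0 0) (z := γ 0 1) (w := γ 1 1) hT (by linarith)
  · exact abs_le_of_sum_sq_le (y := γ 0 0) (z := γ 0 1) (w := γ 1 0) hT (by linarith)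

theorem det_entries (γ : SL2Z) : γ 0 0 * γ 1 1 - γ 0 1 * γ 1 0 = 1 := by
  have := γ.det_coe
  rwa [Matrix.det_fin_two] at this

theorem SL2Z_ext {γ γ' : SL2Z} (h₀₀ : γ 0 0 = γ' 0 0) (h₀₁ : γ 0 1 = γ' 0 1)
    (h₁₀ : γ 1 0 = γ' 1 0) (h₁₁ : γ 1 1 = γ' 1 1) : γ = γ' := by
  ext i j
  fin_cases i <;> fin_cases j <;> assumption

theorem finite_ball (T : ℝ) : {γ : SL2Z | frobNorm γ ≤ T}.Finite := by
  let f : SL2Z → ℤ × ℤ × ℤ × ℤ := fun γ => (γ 0 0, γ 0 1, γ 1 0, γ 1 1)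
  have hf : Function.Injective f := by
    intro γ γ' h
    simp only [f, Prod.mk.injEq] at h
    exact SL2Z_ext h.1 h.2.1 h.2.2.1 h.2.2.2
  refine Set.Finite.of_finite_image (f := f) ?_ hf.injOn
  let I := Set.Icc (-⌊T⌋) ⌊T⌋
  refine Set.Finite.subset (s := I ×ˢ I ×ˢ I ×ˢ I) ?_ ?_
  · exact (Set.finite_Icc _ _).prod ((Set.finite_Icc _ _).prod
      ((Set.finite_Icc _ _).prod (Set.finite_Icc _ _)))
  · rintro _ ⟨γ, hγ, rfl⟩
    have key : ∀ i j, γ i j ∈ I := by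
      intro i j
      have h := abs_le.1 (abs_entry_le hγ i j)
      have h₁ : γ i j ≤ ⌊T⌋ := Int.le_floor.2 h.2
      have h₂ : -γ i j ≤ ⌊T⌋ := Int.le_floor.2 (by push_cast; linarith)
      exact ⟨by linarith, h₁⟩
    exact ⟨key 0 0, key 0 1, key 1 0, key 1 1⟩

/-- The elements of `SL(2,ℤ)` of Frobenius norm at most `T`. -/
def ballF (T : ℝ) : Finset SL2Z := (finite_ball T).toFinset

theorem mem_ballF {γ : SL2Z} {T : ℝ} : γ ∈ ballF T ↔ frobNorm γ ≤ T := by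
  simp [ballF]

open Classical in
/-- The number of elements of `S` of Frobenius norm at most `T`. -/
def cnt (S : Set SL2Z) (T : ℝ) : ℕ := ((ballF T).filter (· ∈ S)).card

theorem cnt_mono {S S' : Set SL2Z} {T : ℝ} (h : ∀ γ ∈ S, frobNorm γ ≤ T → γ ∈ S') :
    cnt S T ≤ cnt S' T := by
  classical
  refine Finset.card_le_card fun γ hγ => ?_
  simp only [Finset.mem_filter, mem_ballF] at hγ ⊢
  exact ⟨hγ.1, h γ hγ.2 hγ.1⟩

theorem cnt_union_le (S S' : Set SL2Z) (T : ℝ) : cnt (S ∪ S') T ≤ cnt S T + cnt S' T := by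
  classical
  unfold cnt
  refine (Finset.card_le_card ?_).trans (Finset.card_union_le _ _)
  intro γ hγ
  simp only [Finset.mem_filter, Finset.mem_union, Set.mem_union] at hγ ⊢
  tauto

theorem card_le_of_abs_le {s : Finset ℤ} {R : ℝ} (hR : 0 ≤ R) (h : ∀ x ∈ s, |(x : ℝ)| ≤ R) :
    (s.card : ℝ) ≤ 2 * R + 1 := by
  have hsub : s ⊆ Finset.Icc (-⌊R⌋) ⌊R⌋ := by
    intro x hx
    have h' := abs_le.1 (h x hx)
    have h₁ : x ≤ ⌊R⌋ := Int.le_floor.2 h'.2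
    have h₂ : -x ≤ ⌊R⌋ := Int.le_floor.2 (by push_cast; linarith)
    exact Finset.mem_Icc.2 ⟨by linarith, h₁⟩
  have h₁ := Finset.card_le_card hsub
  rw [Int.card_Icc] at h₁
  have h₀ : 0 ≤ ⌊R⌋ := Int.floor_nonneg.2 hR
  have h₂ : (s.card : ℤ) ≤ 2 * ⌊R⌋ + 1 := by omega
  have h₃ : (s.card : ℝ) ≤ 2 * ⌊R⌋ + 1 := by exact_mod_cast h₂
  linarith [Int.floor_le R]

theorem card_le_of_abs_le_prod {s : Finset (ℤ × ℤ)} {R R' : ℝ} (hR : 0 ≤ R) (hR' : 0 ≤ R')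
    (h : ∀ x ∈ s, |(x.1 : ℝ)| ≤ R ∧ |(x.2 : ℝ)| ≤ R') :
    (s.card : ℝ) ≤ (2 * R + 1) * (2 * R' + 1) := by
  have hsub : s ⊆ s.image Prod.fst ×ˢ s.image Prod.snd := Finset.subset_product
  have h₁ := Finset.card_le_card hsub
  rw [Finset.card_product] at h₁
  have h₂ : ((s.image Prod.fst).card : ℝ) ≤ 2 * R + 1 := by
    refine card_le_of_abs_le hR fun x hx => ?_
    obtain ⟨y, hy, rfl⟩ := Finset.mem_image.1 hx
    exact (h y hy).1
  have h₃ : ((s.image Prod.snd).card : ℝ) ≤ 2 * R' + 1 := by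
    refine card_le_of_abs_le hR' fun x hx => ?_
    obtain ⟨y, hy, rfl⟩ := Finset.mem_image.1 hx
    exact (h y hy).2
  calc (s.card : ℝ) ≤ ((s.image Prod.fst).card : ℝ) * ((s.image Prod.snd).card : ℝ) := by
        exact_mod_cast h₁
    _ ≤ _ := by gcongr

/-- A primitive vector `(x, y)` has at most five complements `(z, w)` of determinant `e = ±1`
that are no longer than itself. -/
theorem card_complement_le {x y e : ℤ} (he : IsUnit e) {s : Finset (ℤ × ℤ)}
    (hdet : ∀ v ∈ s, x * v.2 - y * v.1 = e)
    (hlen : ∀ v ∈ s, v.1 ^ 2 + v.2 ^ 2 ≤ x ^ 2 + y ^ 2) : s.card ≤ 5 := by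
  rcases s.eq_empty_or_nonempty with rfl | ⟨v₀, hv₀⟩
  · simp
  have hd₀ := hdet v₀ hv₀
  have hcop : IsCoprime x y := by
    obtain ⟨u, rfl⟩ := he
    refine ⟨v₀.2 * ↑u⁻¹, -v₀.1 * ↑u⁻¹, ?_⟩
    have : (u : ℤ) * ↑u⁻¹ = 1 := by simp
    linear_combination ((u⁻¹ : ℤˣ) : ℤ) * hd₀ + this
  have key : ∀ v ∈ s, ∃ k ∈ Finset.Icc (-2 : ℤ) 2, v = (v₀.1 + k * x, v₀.2 + k * y) := by
    intro v hv
    have hd := hdet v hv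
    obtain ⟨u, w, huw⟩ := hcop
    refine ⟨u * (v.1 - v₀.1) + w * (v.2 - v₀.2), ?_, ?_⟩
    · set k := u * (v.1 - v₀.1) + w * (v.2 - v₀.2) with hk
      have h1 : v.1 - v₀.1 = k * x := by
        rw [hk]; linear_combination -(v.1 - v₀.1) * huw + w * (hd₀ - hd)
      have h2 : v.2 - v₀.2 = k * y := by
        rw [hk]; linear_combination -(v.2 - v₀.2) * huw - u * (hd₀ - hd)
      have hn := hlen v hv
      have hn₀ := hlen v₀ hv₀
      have hpos : 0 < x ^ 2 + y ^ 2 := by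
        by_contra hcon
        have hx : x = 0 := by nlinarith [sq_nonneg x, sq_nonneg y]
        have hy : y = 0 := by nlinarith [sq_nonneg x, sq_nonneg y]
        simp [hx, hy] at huw
      have hk2 : k ^ 2 * (x ^ 2 + y ^ 2) ≤ 4 * (x ^ 2 + y ^ 2) := by
        have : k ^ 2 * (x ^ 2 + y ^ 2) = (v.1 - v₀.1) ^ 2 + (v.2 - v₀.2) ^ 2 := by
          rw [h1, h2]; ring
        rw [this]
        nlinarith [sq_nonneg (v.1 + v₀.1), sq_nonneg (v.2 + v₀.2)]
      have hk4 : k ^ 2 ≤ 2 ^ 2 := by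
        have := le_of_mul_le_mul_right hk2 hpos
        linarith
      exact Finset.mem_Icc.2 (abs_le.1 (abs_le_of_sq_le_sq hk4 (by norm_num)))
    · ext
      · simp only
        linear_combination -(v.1 - v₀.1) * huw + w * (hd₀ - hd)
      · simp only
        linear_combination -(v.2 - v₀.2) * huw - u * (hd₀ - hd)
  have hsub : s ⊆ (Finset.Icc (-2 : ℤ) 2).image fun k => (v₀.1 + k * x, v₀.2 + k * y) := by
    intro v hv
    obtain ⟨k, hk, rfl⟩ := key v hv
    exact Finset.mem_image.2 ⟨k, hk, rfl⟩
  exact (Finset.card_le_card hsub).trans (Finset.card_image_le.trans (by simp))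

theorem card_le_five_mul_box {e : ℤ} (he : IsUnit e) (f g : SL2Z → ℤ × ℤ)
    (hinj : ∀ γ γ', f γ = f γ' → g γ = g γ' → γ = γ')
    (hdet : ∀ γ, (f γ).1 * (g γ).2 - (f γ).2 * (g γ).1 = e) (s : Finset SL2Z) {R R' : ℝ}
    (hR : 0 ≤ R) (hR' : 0 ≤ R')
    (hlen : ∀ γ ∈ s, (g γ).1 ^ 2 + (g γ).2 ^ 2 ≤ (f γ).1 ^ 2 + (f γ).2 ^ 2)
    (hbox : ∀ γ ∈ s, |((f γ).1 : ℝ)| ≤ R ∧ |((f γ).2 : ℝ)| ≤ R') :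
    (s.card : ℝ) ≤ 5 * ((2 * R + 1) * (2 * R' + 1)) := by
  have h₁ : s.card ≤ 5 * (s.image f).card := by
    refine Finset.card_le_mul_card_image s 5 fun v _ => ?_
    have hcard : ((s.filter fun γ => f γ = v).image g).card = (s.filter fun γ => f γ = v).card := by
      refine Finset.card_image_of_injOn fun γ hγ γ' hγ' h => ?_
      simp only [Finset.coe_filter, Set.mem_ofPred_eq] at hγ hγ'
      exact hinj _ _ (hγ.2.trans hγ'.2.symm) h
    rw [← hcard]
    refine card_complement_le (x := v.1) (y := v.2) he ?_ ?_
    · intro w hw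
      obtain ⟨γ, hγ, rfl⟩ := Finset.mem_image.1 hw
      obtain ⟨_, rfl⟩ := Finset.mem_filter.1 hγ
      exact hdet γ
    · intro w hw
      obtain ⟨γ, hγ, rfl⟩ := Finset.mem_image.1 hw
      obtain ⟨hγs, rfl⟩ := Finset.mem_filter.1 hγ
      exact hlen γ hγs
  have h₂ : ((s.image f).card : ℝ) ≤ (2 * R + 1) * (2 * R' + 1) := by
    refine card_le_of_abs_le_prod hR hR' fun v hv => ?_
    obtain ⟨γ, hγ, rfl⟩ := Finset.mem_image.1 hv
    exact hbox γ hγ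
  calc (s.card : ℝ) ≤ 5 * ((s.image f).card : ℝ) := by exact_mod_cast h₁
    _ ≤ _ := by gcongr

/-- There are few matrices with small lower left entry. -/
theorem cnt_abs_le_le {σ T : ℝ} (hσ : 0 < σ) (hσ1 : σ ≤ 1) (hT : 1 / σ ≤ T) :
    (cnt {γ | |(γ 1 0 : ℝ)| ≤ σ ^ 2 * T} T : ℝ) ≤ 300 * σ * T ^ 2 := by
  classical
  have hσT : 1 ≤ σ * T := by
    rw [div_le_iff₀ hσ] at hT; linarith
  have hT1 : 1 ≤ T := by nlinarith
  have hT0 : 0 ≤ T := by linarith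
  set s := (ballF T).filter (· ∈ {γ : SL2Z | |(γ 1 0 : ℝ)| ≤ σ ^ 2 * T}) with hs
  have hsT : ∀ γ ∈ s, ∀ i j, |(γ i j : ℝ)| ≤ T := fun γ hγ =>
    abs_entry_le (mem_ballF.1 (Finset.mem_filter.1 hγ).1)
  have hsc : ∀ γ ∈ s, |(γ 1 0 : ℝ)| ≤ σ ^ 2 * T := fun γ hγ => (Finset.mem_filter.1 hγ).2
  set s₁ := s.filter fun γ => γ 0 0 ^ 2 + γ 0 1 ^ 2 ≤ γ 1 0 ^ 2 + γ 1 1 ^ 2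
  set s₂ := s.filter fun γ => γ 0 1 ^ 2 + γ 1 1 ^ 2 ≤ γ 0 0 ^ 2 + γ 1 0 ^ 2
  set s₃ := s.filter fun γ => |(γ 0 0 : ℝ)| ≤ 2 * σ * T ∧
    γ 1 0 ^ 2 + γ 1 1 ^ 2 ≤ γ 0 0 ^ 2 + γ 0 1 ^ 2
  set s₄ := s.filter fun γ => |(γ 1 1 : ℝ)| ≤ 2 * σ * T ∧
    γ 0 0 ^ 2 + γ 1 0 ^ 2 ≤ γ 0 1 ^ 2 + γ 1 1 ^ 2
  have hsub : s ⊆ (s₁ ∪ s₂) ∪ (s₃ ∪ s₄) := by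
    intro γ hγ
    simp only [s₁, s₂, s₃, s₄, Finset.mem_union, Finset.mem_filter, hγ, true_and]
    by_contra! hcon
    obtain ⟨⟨h₁, h₂⟩, h₃, h₄⟩ := hcon
    have ha : 2 * σ * T < |(γ 0 0 : ℝ)| := by
      by_contra! h; linarith [h₃ h]
    have hd : 2 * σ * T < |(γ 1 1 : ℝ)| := by
      by_contra! h; linarith [h₄ h]
    have hdet : (γ 0 0 : ℝ) * γ 1 1 = 1 + γ 0 1 * γ 1 0 := by
      have := det_entries γ
      exact_mod_cast (by linarith : γ 0 0 * γ 1 1 = 1 + γ 0 1 * γ 1 0)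
    have h₅ : |(γ 0 0 : ℝ)| * |(γ 1 1 : ℝ)| ≤ 1 + T * (σ ^ 2 * T) := by
      rw [← abs_mul, hdet]
      refine (abs_add_le _ _).trans ?_
      rw [abs_one, abs_mul]
      have := mul_le_mul (hsT γ hγ 0 1) (hsc γ hγ) (abs_nonneg _) hT0
      linarith
    have h₆ : (2 * σ * T) * (2 * σ * T) ≤ |(γ 0 0 : ℝ)| * |(γ 1 1 : ℝ)| :=
      mul_le_mul ha.le hd.le (by positivity) (abs_nonneg _)
    nlinarith
  have hcard := (Finset.card_le_card hsub).trans ((Finset.card_union_le _ _).trans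
    (add_le_add (Finset.card_union_le _ _) (Finset.card_union_le _ _)))
  have hu : IsUnit (-1 : ℤ) := by simp
  have hσT0 : 0 ≤ σ ^ 2 * T := by positivity
  have hσT1 : 0 ≤ 2 * σ * T := by positivity
  have b₁ : (s₁.card : ℝ) ≤ 5 * ((2 * (σ ^ 2 * T) + 1) * (2 * T + 1)) := by
    refine card_le_five_mul_box hu (fun γ => (γ 1 0, γ 1 1)) (fun γ => (γ 0 0, γ 0 1)) ?_ ?_ s₁
      hσT0 hT0 (fun γ hγ => (Finset.mem_filter.1 hγ).2) ?_
    · intro γ γ' h h'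
      simp only [Prod.mk.injEq] at h h'
      exact SL2Z_ext h'.1 h'.2 h.1 h.2
    · intro γ
      have := det_entries γ
      simp only
      linarith
    · intro γ hγ
      exact ⟨hsc γ (Finset.mem_filter.1 hγ).1, hsT γ (Finset.mem_filter.1 hγ).1 1 1⟩
  have b₂ : (s₂.card : ℝ) ≤ 5 * ((2 * T + 1) * (2 * (σ ^ 2 * T) + 1)) := by
    refine card_le_five_mul_box isUnit_one (fun γ => (γ 0 0, γ 1 0)) (fun γ => (γ 0 1, γ 1 1))
      ?_ ?_ s₂ hT0 hσT0 (fun γ hγ => (Finset.mem_filter.1 hγ).2) ?_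
    · intro γ γ' h h'
      simp only [Prod.mk.injEq] at h h'
      exact SL2Z_ext h.1 h'.1 h.2 h'.2
    · intro γ
      have := det_entries γ
      simp only
      linarith
    · intro γ hγ
      exact ⟨hsT γ (Finset.mem_filter.1 hγ).1 0 0, hsc γ (Finset.mem_filter.1 hγ).1⟩
  have b₃ : (s₃.card : ℝ) ≤ 5 * ((2 * (2 * σ * T) + 1) * (2 * T + 1)) := by
    refine card_le_five_mul_box isUnit_one (fun γ => (γ 0 0, γ 0 1)) (fun γ => (γ 1 0, γ 1 1))
      ?_ ?_ s₃ hσT1 hT0 (fun γ hγ => (Finset.mem_filter.1 hγ).2.2) ?_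
    · intro γ γ' h h'
      simp only [Prod.mk.injEq] at h h'
      exact SL2Z_ext h.1 h.2 h'.1 h'.2
    · intro γ
      have := det_entries γ
      simp only
      linarith
    · intro γ hγ
      exact ⟨(Finset.mem_filter.1 hγ).2.1, hsT γ (Finset.mem_filter.1 hγ).1 0 1⟩
  have b₄ : (s₄.card : ℝ) ≤ 5 * ((2 * T + 1) * (2 * (2 * σ * T) + 1)) := by
    refine card_le_five_mul_box hu (fun γ => (γ 0 1, γ 1 1)) (fun γ => (γ 0 0, γ 1 0))
      ?_ ?_ s₄ hT0 hσT1 (fun γ hγ => (Finset.mem_filter.1 hγ).2.2) ?_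
    · intro γ γ' h h'
      simp only [Prod.mk.injEq] at h h'
      exact SL2Z_ext h'.1 h.1 h'.2 h.2
    · intro γ
      have := det_entries γ
      simp only
      linarith
    · intro γ hγ
      exact ⟨hsT γ (Finset.mem_filter.1 hγ).1 0 1, (Finset.mem_filter.1 hγ).2.1⟩
  have hcard' : (s.card : ℝ) ≤ (s₁.card + s₂.card) + (s₃.card + s₄.card) := by exact_mod_cast hcard
  have hx : 2 * (σ ^ 2 * T) + 1 ≤ 3 * (σ * T) := by nlinarith [mul_nonneg hσ.le hT0]
  have hy : 2 * (2 * σ * T) + 1 ≤ 5 * (σ * T) := by nlinarith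
  have hz : 2 * T + 1 ≤ 3 * T := by linarith
  have p₁ : (2 * (σ ^ 2 * T) + 1) * (2 * T + 1) ≤ 3 * (σ * T) * (3 * T) :=
    mul_le_mul hx hz (by positivity) (by positivity)
  have p₂ : (2 * (2 * σ * T) + 1) * (2 * T + 1) ≤ 5 * (σ * T) * (3 * T) :=
    mul_le_mul hy hz (by positivity) (by positivity)
  have : (cnt {γ | |(γ 1 0 : ℝ)| ≤ σ ^ 2 * T} T : ℝ) = s.card := by
    rw [hs]; rfl
  rw [this]
  have hpos : 0 ≤ σ * T ^ 2 := by positivity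
  nlinarith

/-! ### Matrices with a given lower left entry in a congruence class -/

/-- The conditions on `(a, d)` for `(a b; c d)` with `b = (a d - 1) / c` to be an integral matrix
with `a ≡ α`, `b ≡ β` and `d ≡ δ (mod N)`. -/
def ClassPair (N : ℕ) (α β δ c : ℤ) (p : ℤ × ℤ) : Prop :=
  p.1 ≡ α [ZMOD N] ∧ p.2 ≡ δ [ZMOD N] ∧ p.1 * p.2 ≡ 1 + β * c [ZMOD c * N]

open Classical in
/-- The number of elements of `X` in the box `[A, A + l₁) × [B, B + l₂)`. -/
def boxCount (X : ℤ × ℤ → Prop) (A B : ℤ) (l₁ l₂ : ℕ) : ℕ :=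
  ((Finset.Ico A (A + l₁) ×ˢ Finset.Ico B (B + l₂)).filter X).card

theorem exists_abs_boxCount_classPair_sub_le : ∃ C : ℝ, 1 ≤ C ∧ ∀ N k c : ℕ, 0 < N → 0 < c →
    (c / c.gcd (N ^ k)).Coprime N → ∀ α β δ : ℤ, ∃ κ : ℝ, 0 ≤ κ ∧ κ ≤ (N : ℝ) ^ k / c ∧
      ∀ (A B : ℤ) (l₁ l₂ : ℕ), |(boxCount (ClassPair N α β δ c) A B l₁ l₂ : ℝ) - κ * (l₁ * l₂)| ≤
        C * ((N : ℝ) ^ 2 * ((N : ℝ) ^ k) ^ 3) * (c : ℝ) ^ (7 / 8 : ℝ) * (1 + (l₁ + l₂) / c) := by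
  classical
  obtain ⟨C, hC1, hC⟩ := exists_abs_apCount_sub_le
  refine ⟨C, hC1, fun N k c hN hc hcop α β δ => ?_⟩
  set c₀ := c.gcd (N ^ k) with hc₀
  set q := c / c₀ with hq
  have hc₀pos : 0 < c₀ := Nat.gcd_pos_of_pos_left _ hc
  have hcq : c₀ * q = c := Nat.mul_div_cancel' (Nat.gcd_dvd_left _ _)
  have hqpos : 0 < q := by
    rcases Nat.eq_zero_or_pos q with h | h
    · rw [h] at hcq; omega
    · exact h
  have hc₀K : c₀ ≤ N ^ k := Nat.le_of_dvd (by positivity) (Nat.gcd_dvd_right _ _)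
  set M := N * c₀ with hM
  have hMpos : 0 < M := by positivity
  have hMq : M.Coprime q := by
    refine Nat.Coprime.mul_left hcop.symm ?_
    exact Nat.Coprime.coprime_dvd_left (Nat.gcd_dvd_right _ _) (hcop.symm.pow_left k)
  set R := (Finset.Ico (0 : ℤ) M ×ˢ Finset.Ico (0 : ℤ) M).filter fun p =>
    p.1 ≡ α [ZMOD N] ∧ p.2 ≡ δ [ZMOD N] ∧ p.1 * p.2 ≡ 1 + β * c [ZMOD M] with hR
  have hRcard : R.card ≤ M ^ 2 := by
    refine (Finset.card_filter_le _ _).trans ?_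
    simp [sq]
  have hcN : ((c : ℤ) * N) = (M : ℤ) * q := by
    rw [← hcq, hM]; push_cast; ring
  have hNM : (N : ℤ) ∣ M := by rw [hM]; push_cast; exact dvd_mul_right _ _
  have hcq' : (q : ℤ) ∣ c := ⟨c₀, by rw [← hcq]; push_cast; ring⟩
  have hX : ∀ p : ℤ × ℤ, p.1 * p.2 ≡ 1 + β * c [ZMOD c * N] ↔
      p.1 * p.2 ≡ 1 + β * c [ZMOD M] ∧ p.1 * p.2 ≡ 1 [ZMOD q] := by
    intro p
    rw [hcN, ← Int.modEq_and_modEq_iff_modEq_mul (by simpa using hMq)]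
    refine and_congr_right fun _ => ?_
    have h1 : 1 + β * c ≡ 1 [ZMOD q] := by
      refine (Int.modEq_iff_dvd.2 ?_)
      have : (1 : ℤ) - (1 + β * c) = -β * c := by ring
      rw [this]
      exact Dvd.dvd.mul_left hcq' _
    exact ⟨fun h => h.trans h1, fun h => h.trans h1.symm⟩
  have hsum : ∀ (A B : ℤ) (l₁ l₂ : ℕ), boxCount (ClassPair N α β δ c) A B l₁ l₂ =
      ∑ r ∈ R, apCount q M r.1 r.2 A B l₁ l₂ := by
    intro A B l₁ l₂
    unfold boxCount
    rw [Finset.card_eq_sum_card_fiberwise (f := fun p : ℤ × ℤ => (p.1 % M, p.2 % M)) (t := R)]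
    · refine Finset.sum_congr rfl fun r hr => ?_
      unfold apCount
      congr 1
      ext p
      simp only [hR, Finset.mem_filter, Finset.mem_product, Finset.mem_Ico, ClassPair, hX,
        Prod.ext_iff] at hr ⊢
      obtain ⟨⟨⟨hr1, hr2⟩, hr3, hr4⟩, hr5, hr6, hr7⟩ := hr
      have e1 : p.1 % M = r.1 ↔ p.1 ≡ r.1 [ZMOD M] := by
        rw [Int.ModEq, Int.emod_eq_of_lt hr1 hr2]
      have e2 : p.2 % M = r.2 ↔ p.2 ≡ r.2 [ZMOD M] := by
        rw [Int.ModEq, Int.emod_eq_of_lt hr3 hr4]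
      rw [e1, e2]
      constructor
      · rintro ⟨⟨hb, -, -, -, h⟩, h', h''⟩
        exact ⟨hb, h', h'', h⟩
      · rintro ⟨hb, h', h'', h⟩
        exact ⟨⟨hb, (h'.of_dvd hNM).trans hr5, (h''.of_dvd hNM).trans hr6,
          (h'.mul h'').trans hr7, h⟩, h', h''⟩
    · intro p hp
      simp only [Finset.coe_filter, Set.mem_ofPred_eq, ClassPair, hX, hR, Finset.mem_product,
        Finset.mem_Ico] at hp ⊢
      obtain ⟨-, h1, h2, h3, -⟩ := hp
      have hM0 : (M : ℤ) ≠ 0 := by exact_mod_cast hMpos.ne'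
      have hM1 : (0 : ℤ) < M := by exact_mod_cast hMpos
      have e1 : p.1 % M ≡ p.1 [ZMOD M] := Int.mod_modEq _ _
      have e2 : p.2 % M ≡ p.2 [ZMOD M] := Int.mod_modEq _ _
      exact ⟨⟨⟨Int.emod_nonneg _ hM0, Int.emod_lt_of_pos _ hM1⟩,
        ⟨Int.emod_nonneg _ hM0, Int.emod_lt_of_pos _ hM1⟩⟩,
        (e1.of_dvd hNM).trans h1, (e2.of_dvd hNM).trans h2, (e1.mul e2).trans h3⟩
  set K : ℝ := (N : ℝ) ^ k with hK
  have hc₀K' : (c₀ : ℝ) ≤ K := by rw [hK]; exact_mod_cast hc₀K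
  have hc₀1 : (1 : ℝ) ≤ c₀ := by exact_mod_cast hc₀pos
  have hK1 : 1 ≤ K := hc₀1.trans hc₀K'
  have hc' : (0 : ℝ) < c := by exact_mod_cast hc
  have hq' : (0 : ℝ) < q := by exact_mod_cast hqpos
  have hcq'' : (c₀ : ℝ) * q = c := by exact_mod_cast hcq
  have hM' : (0 : ℝ) < M := by exact_mod_cast hMpos
  have hRM : (R.card : ℝ) ≤ (M : ℝ) ^ 2 := by exact_mod_cast hRcard
  refine ⟨R.card * (q.totient / ((q : ℝ) ^ 2 * (M : ℝ) ^ 2)), by positivity, ?_, ?_⟩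
  · have ht : (q.totient : ℝ) ≤ q := by exact_mod_cast Nat.totient_le q
    calc (R.card : ℝ) * (q.totient / ((q : ℝ) ^ 2 * (M : ℝ) ^ 2))
        ≤ (M : ℝ) ^ 2 * ((q : ℝ) / ((q : ℝ) ^ 2 * (M : ℝ) ^ 2)) := by gcongr
      _ = (c₀ : ℝ) / c := by rw [← hcq'']; field_simp
      _ ≤ K / c := by gcongr
  · intro A B l₁ l₂
    rw [hsum]
    push_cast
    have hcs : (R.card : ℝ) * (q.totient / ((q : ℝ) ^ 2 * (M : ℝ) ^ 2)) * (l₁ * l₂) =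
        ∑ r ∈ R, q.totient / ((q : ℝ) ^ 2 * (M : ℝ) ^ 2) * (l₁ * l₂) := by
      rw [Finset.sum_const, nsmul_eq_mul]; ring
    rw [hcs, ← Finset.sum_sub_distrib]
    refine (Finset.abs_sum_le_sum_abs _ _).trans ?_
    refine (Finset.sum_le_sum fun r _ => hC q M hqpos hMpos hMq r.1 r.2 A B l₁ l₂).trans ?_
    rw [Finset.sum_const, nsmul_eq_mul]
    have hqc : (q : ℝ) ≤ c := by rw [← hcq'']; nlinarith
    have h1 : (q : ℝ) ^ (7 / 8 : ℝ) ≤ (c : ℝ) ^ (7 / 8 : ℝ) :=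
      Real.rpow_le_rpow hq'.le hqc (by norm_num)
    have h2 : 1 + ((l₁ : ℝ) + l₂) / q ≤ K * (1 + (l₁ + l₂) / c) := by
      have : ((l₁ : ℝ) + l₂) / q = c₀ * ((l₁ + l₂) / c) := by
        rw [← hcq'']; field_simp
      rw [this]
      have h3 : (0 : ℝ) ≤ ((l₁ : ℝ) + l₂) / c := by positivity
      nlinarith
    have h3 : (R.card : ℝ) ≤ (N : ℝ) ^ 2 * K ^ 2 := by
      refine hRM.trans ?_
      rw [hM]; push_cast; rw [mul_pow]
      gcongr
    calc (R.card : ℝ) * (C * (q : ℝ) ^ (7 / 8 : ℝ) * (1 + (l₁ + l₂) / q))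
        ≤ ((N : ℝ) ^ 2 * K ^ 2) * (C * (c : ℝ) ^ (7 / 8 : ℝ) * (K * (1 + (l₁ + l₂) / c))) := by
          have hC0 : 0 ≤ C := by linarith
          refine mul_le_mul h3 ?_ (by positivity) (by positivity)
          refine mul_le_mul ?_ h2 (by positivity) (by positivity)
          exact mul_le_mul_of_nonneg_left h1 hC0
      _ = _ := by ring

/-- If `N`-smooth parts of `c` beyond `N ^ k` occur, then `c` is divisible by a high power of a
prime factor of `N`. -/
theorem exists_prime_pow_dvd_of_not_coprime {N k c : ℕ}
    (h : ¬ (c / c.gcd (N ^ k)).Coprime N) : ∃ p, p.Prime ∧ p ∣ N ∧ p ^ k ∣ c := by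
  obtain ⟨p, hp, hp1, hp2⟩ := Nat.Prime.not_coprime_iff_dvd.1 h
  refine ⟨p, hp, hp2, ?_⟩
  have hd : c.gcd (N ^ k) * p ∣ c := by
    obtain ⟨e, he⟩ := hp1
    refine ⟨e, ?_⟩
    rw [mul_assoc, ← he, Nat.mul_div_cancel' (Nat.gcd_dvd_left _ _)]
  have key : ∀ j, j ≤ k → p ^ j ∣ c := by
    intro j
    induction j with
    | zero => simp
    | succ j ih =>
      intro hj
      have h1 : p ^ j ∣ c.gcd (N ^ k) :=
        Nat.dvd_gcd (ih (by omega)) ((pow_dvd_pow_of_dvd hp2 j).trans (pow_dvd_pow N (by omega)))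
      rw [pow_succ]
      exact (Nat.mul_dvd_mul_right h1 p).trans hd
  exact key k le_rfl

open Classical in
theorem card_filter_le_of_strips (Ω : Finset (ℤ × ℤ)) (X X' : ℤ × ℤ → Prop) (L S : ℕ)
    (w w' : ℤ → ℕ) {κ E D : ℝ} (hκ : 0 ≤ κ)
    (hout : ∀ p ∈ Ω, ∃ s ∈ Finset.Ico (-S : ℤ) S, p.1 ∈ Finset.Ico (s * L) (s * L + L) ∧
      p.2 ∈ Finset.Ico (-w' s : ℤ) (-w' s + (2 * w' s : ℕ)))
    (hin : ∀ s ∈ Finset.Ico (-S : ℤ) S, ∀ p : ℤ × ℤ, p.1 ∈ Finset.Ico (s * L) (s * L + L) →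
      p.2 ∈ Finset.Ico (-w s : ℤ) (-w s + (2 * w s : ℕ)) → p ∈ Ω)
    (hw : ∀ s ∈ Finset.Ico (-S : ℤ) S, (w' s : ℝ) ≤ w s + D)
    (hX : ∀ s ∈ Finset.Ico (-S : ℤ) S,
      |(boxCount X (s * L) (-w' s) L (2 * w' s) : ℝ) - κ * (L * (2 * w' s : ℕ))| ≤ E)
    (hX' : ∀ s ∈ Finset.Ico (-S : ℤ) S,
      |(boxCount X' (s * L) (-w s) L (2 * w s) : ℝ) - κ * (L * (2 * w s : ℕ))| ≤ E) :
    ((Ω.filter X).card : ℝ) ≤ (Ω.filter X').card + 2 * S * (2 * κ * L * D + 2 * E) := by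
  set I := Finset.Ico (-S : ℤ) S with hI
  set Q : ℤ → ℕ → Finset (ℤ × ℤ) := fun s v =>
    Finset.Ico (s * L) (s * L + L) ×ˢ Finset.Ico (-v : ℤ) (-v + (2 * v : ℕ)) with hQ
  have hup : (Ω.filter X).card ≤ ∑ s ∈ I, boxCount X (s * L) (-w' s) L (2 * w' s) := by
    refine (Finset.card_le_card (t := I.biUnion fun s => (Q s (w' s)).filter X) ?_).trans
      Finset.card_biUnion_le
    intro p hp
    obtain ⟨hpΩ, hpX⟩ := Finset.mem_filter.1 hp
    obtain ⟨s, hs, h1, h2⟩ := hout p hpΩ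
    exact Finset.mem_biUnion.2 ⟨s, hs, Finset.mem_filter.2 ⟨Finset.mem_product.2 ⟨h1, h2⟩, hpX⟩⟩
  have hlo : ∑ s ∈ I, boxCount X' (s * L) (-w s) L (2 * w s) ≤ (Ω.filter X').card := by
    have hdisj : (I : Set ℤ).PairwiseDisjoint fun s => (Q s (w s)).filter X' := by
      intro s _ s' _ hss'
      refine Finset.disjoint_left.2 fun p hp hp' => hss' ?_
      simp only [hQ, Finset.mem_filter, Finset.mem_product, Finset.mem_Ico] at hp hp'
      obtain ⟨⟨⟨h1, h2⟩, -⟩, -⟩ := hp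
      obtain ⟨⟨⟨h3, h4⟩, -⟩, -⟩ := hp'
      have hL : (0 : ℤ) < L := by omega
      have h5 : s * L < (s' + 1) * L := by linarith
      have h6 : s' * L < (s + 1) * L := by linarith
      have h7 := lt_of_mul_lt_mul_right h5 hL.le
      have h8 := lt_of_mul_lt_mul_right h6 hL.le
      omega
    have := Finset.card_biUnion hdisj
    refine this.symm.le.trans (Finset.card_le_card fun p hp => ?_)
    obtain ⟨s, hs, hp⟩ := Finset.mem_biUnion.1 hp
    obtain ⟨hp, hpX⟩ := Finset.mem_filter.1 hp
    obtain ⟨h1, h2⟩ := Finset.mem_product.1 hp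
    exact Finset.mem_filter.2 ⟨hin s hs p h1 h2, hpX⟩
  have hIc : (I.card : ℝ) = 2 * S := by
    have : I.card = 2 * S := by rw [hI, Int.card_Ico]; omega
    rw [this]; push_cast; ring
  have hup' : ((Ω.filter X).card : ℝ) ≤
      ∑ s ∈ I, (boxCount X (s * L) (-w' s) L (2 * w' s) : ℝ) := by exact_mod_cast hup
  have hlo' : ∑ s ∈ I, (boxCount X' (s * L) (-w s) L (2 * w s) : ℝ) ≤ ((Ω.filter X').card : ℝ) := by
    exact_mod_cast hlo
  have hdiff : ∑ s ∈ I, ((boxCount X (s * L) (-w' s) L (2 * w' s) : ℝ) -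
      boxCount X' (s * L) (-w s) L (2 * w s)) ≤ ∑ s ∈ I, (2 * κ * L * D + 2 * E) := by
    refine Finset.sum_le_sum fun s hs => ?_
    have h1 := (abs_le.1 (hX s hs)).2
    have h2 := (abs_le.1 (hX' s hs)).1
    have h3 : κ * L * (w' s : ℝ) ≤ κ * L * (w s + D) :=
      mul_le_mul_of_nonneg_left (hw s hs) (by positivity)
    push_cast at h1 h2
    nlinarith
  rw [Finset.sum_sub_distrib, Finset.sum_const, nsmul_eq_mul, hIc] at hdiff
  linarith

/-! ### Points in a slice of the norm ball -/

/-- The pairs `(a, d)` for which `(a b; c d)` with `b = (a d - 1) / c` has norm at most `T`. -/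
def sliceRegion (c : ℕ) (T : ℝ) : Finset (ℤ × ℤ) :=
  (Finset.Icc (-⌊T⌋) ⌊T⌋ ×ˢ Finset.Icc (-⌊T⌋) ⌊T⌋).filter fun p =>
    ((p.1 : ℝ) ^ 2 + c ^ 2) * ((p.2 : ℝ) ^ 2 + c ^ 2) - 2 * p.1 * p.2 + 1 ≤ c ^ 2 * T ^ 2

theorem abs_le_of_slice {a d c T : ℝ} (hc : 0 < c) (hT : 0 ≤ T)
    (h : (a ^ 2 + c ^ 2) * (d ^ 2 + c ^ 2) - 2 * a * d + 1 ≤ c ^ 2 * T ^ 2) :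
    |a| ≤ T ∧ |d| ≤ T := by
  have h1 : c ^ 2 * (a ^ 2 + d ^ 2) ≤ c ^ 2 * T ^ 2 := by
    nlinarith [sq_nonneg (a * d - 1), sq_nonneg (c ^ 2)]
  have h2 : a ^ 2 + d ^ 2 ≤ T ^ 2 := le_of_mul_le_mul_left h1 (by positivity)
  exact ⟨abs_le_of_sq_le_sq (by nlinarith [sq_nonneg d]) hT,
    abs_le_of_sq_le_sq (by nlinarith [sq_nonneg a]) hT⟩

theorem mem_sliceRegion {c : ℕ} {T : ℝ} (hc : 0 < c) (hT : 0 ≤ T) {p : ℤ × ℤ} :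
    p ∈ sliceRegion c T ↔
      ((p.1 : ℝ) ^ 2 + c ^ 2) * ((p.2 : ℝ) ^ 2 + c ^ 2) - 2 * p.1 * p.2 + 1 ≤ c ^ 2 * T ^ 2 := by
  refine ⟨fun h => (Finset.mem_filter.1 h).2, fun h => Finset.mem_filter.2 ⟨?_, h⟩⟩
  have hc' : (0 : ℝ) < c := by exact_mod_cast hc
  obtain ⟨h1, h2⟩ := abs_le_of_slice hc' hT h
  have key : ∀ x : ℤ, |(x : ℝ)| ≤ T → x ∈ Finset.Icc (-⌊T⌋) ⌊T⌋ := by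
    intro x hx
    have h' := abs_le.1 hx
    have h₁ : x ≤ ⌊T⌋ := Int.le_floor.2 h'.2
    have h₂ : -x ≤ ⌊T⌋ := Int.le_floor.2 (by push_cast; linarith)
    exact Finset.mem_Icc.2 ⟨by linarith, h₁⟩
  exact Finset.mem_product.2 ⟨key _ h1, key _ h2⟩

theorem abs_section_sub_le {a A c T δ η : ℝ} (hδ : 0 < δ) (hT : 0 < T) (hη : 0 < η)
    (hc : δ * T ≤ c) (h : |A ^ 2 - a ^ 2| ≤ 28 * η * T ^ 2) :
    |c ^ 2 * T ^ 2 / (a ^ 2 + c ^ 2) - c ^ 2 * T ^ 2 / (A ^ 2 + c ^ 2)| ≤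
      28 * η / δ ^ 2 * T ^ 2 := by
  have hc0 : 0 < c := lt_of_lt_of_le (by positivity) hc
  have e : c ^ 2 * T ^ 2 / (a ^ 2 + c ^ 2) - c ^ 2 * T ^ 2 / (A ^ 2 + c ^ 2) =
      c ^ 2 * T ^ 2 * (A ^ 2 - a ^ 2) / ((a ^ 2 + c ^ 2) * (A ^ 2 + c ^ 2)) := by
    field_simp; ring
  rw [e, abs_div, abs_mul, abs_of_pos (by positivity : 0 < c ^ 2 * T ^ 2),
    abs_of_pos (by positivity : 0 < (a ^ 2 + c ^ 2) * (A ^ 2 + c ^ 2))]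
  have h1 : c ^ 2 * c ^ 2 ≤ (a ^ 2 + c ^ 2) * (A ^ 2 + c ^ 2) := by
    have := sq_nonneg a
    have := sq_nonneg A
    exact mul_le_mul (by linarith) (by linarith) (by positivity) (by positivity)
  calc c ^ 2 * T ^ 2 * |A ^ 2 - a ^ 2| / ((a ^ 2 + c ^ 2) * (A ^ 2 + c ^ 2))
      ≤ c ^ 2 * T ^ 2 * (28 * η * T ^ 2) / (c ^ 2 * c ^ 2) := by gcongr
    _ = 28 * η * T ^ 2 * T ^ 2 / c ^ 2 := by field_simp
    _ ≤ 28 * η * T ^ 2 * T ^ 2 / (δ * T) ^ 2 := by gcongr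
    _ = _ := by field_simp

theorem abs_sq_sub_sq_le {x y B L : ℝ} (h1 : |x - y| ≤ L) (h2 : |x + y| ≤ B) :
    |x ^ 2 - y ^ 2| ≤ L * B := by
  have : x ^ 2 - y ^ 2 = (x - y) * (x + y) := by ring
  rw [this, abs_mul]
  exact mul_le_mul h1 h2 (abs_nonneg _) ((abs_nonneg _).trans h1)

set_option maxHeartbeats 2000000 in
/-- The region `sliceRegion c T` is sandwiched between two unions of boxes over vertical strips
of width about `η T`, whose heights differ by at most a small multiple of `T`. -/
theorem exists_strips {δ η T : ℝ} (hδ : 0 < δ) (hη : 0 < η) (hη1 : η ≤ 1)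
    (hT : 1 / η ≤ T) {c : ℕ} (hc : δ * T ≤ c) (hcT : (c : ℝ) ≤ T) :
    ∃ w w' : ℤ → ℕ, (∀ p ∈ sliceRegion c T, ∃ s ∈ Finset.Ico (-(⌈1 / η⌉₊ + 1 : ℕ) : ℤ)
        (⌈1 / η⌉₊ + 1 : ℕ), p.1 ∈ Finset.Ico (s * ⌈η * T⌉₊) (s * ⌈η * T⌉₊ + ⌈η * T⌉₊) ∧
        p.2 ∈ Finset.Ico (-w' s : ℤ) (-w' s + (2 * w' s : ℕ))) ∧
      (∀ s ∈ Finset.Ico (-(⌈1 / η⌉₊ + 1 : ℕ) : ℤ) (⌈1 / η⌉₊ + 1 : ℕ), ∀ p : ℤ × ℤ,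
        p.1 ∈ Finset.Ico (s * ⌈η * T⌉₊) (s * ⌈η * T⌉₊ + ⌈η * T⌉₊) →
        p.2 ∈ Finset.Ico (-w s : ℤ) (-w s + (2 * w s : ℕ)) → p ∈ sliceRegion c T) ∧
      (∀ s, (w' s : ℝ) ≤ w s + (√(90 * η / δ ^ 2) * T + 2)) ∧
      (∀ s, (w s : ℝ) ≤ w' s) ∧ ∀ s, (w' s : ℝ) ≤ (1 + 45 * η / δ ^ 2) * T + 1 := by
  have hT1 : 1 ≤ η * T := by rw [div_le_iff₀ hη] at hT; linarith
  have hT0 : 0 < T := by nlinarith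
  have hTT : 1 ≤ T := by nlinarith
  have hc0 : (0 : ℝ) < c := lt_of_lt_of_le (by positivity) hc
  have hc0' : 0 < c := by exact_mod_cast hc0
  set L := ⌈η * T⌉₊ with hL
  set S := ⌈1 / η⌉₊ + 1 with hS
  have hL1 : η * T ≤ L := Nat.le_ceil _
  have hL2 : (L : ℝ) ≤ 2 * (η * T) := by
    have := Nat.ceil_lt_add_one (by positivity : 0 ≤ η * T)
    rw [← hL] at this; linarith
  have hLpos : (0 : ℝ) < L := by linarith
  have hLpos' : (0 : ℤ) < L := by exact_mod_cast hLpos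
  have hS1 : 1 / η + 1 ≤ S := by
    rw [hS]; push_cast; linarith [Nat.le_ceil (1 / η)]
  have hS2 : (S : ℝ) ≤ 1 / η + 2 := by
    have := Nat.ceil_lt_add_one (by positivity : 0 ≤ 1 / η)
    rw [hS]; push_cast; linarith
  set θ := 45 * η / δ ^ 2 with hθ
  have hθ0 : 0 < θ := by positivity
  set V : ℤ → ℝ := fun s => c ^ 2 * T ^ 2 / ((s * L : ℝ) ^ 2 + c ^ 2) - c ^ 2 with hV
  have hVT : ∀ s, V s ≤ T ^ 2 := by
    intro s
    have : c ^ 2 * T ^ 2 / ((s * L : ℝ) ^ 2 + c ^ 2) ≤ T ^ 2 := by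
      rw [div_le_iff₀ (by positivity)]
      nlinarith [mul_nonneg (sq_nonneg (s * L : ℝ)) (sq_nonneg T)]
    simp only [hV]
    nlinarith
  have hsq : 90 * η / δ ^ 2 = 2 * θ := by rw [hθ]; ring
  have hη2 : 1 ≤ η * T ^ 2 := by nlinarith
  refine ⟨fun s => ⌊√(V s - θ * T ^ 2)⌋₊, fun s => ⌊√(V s + θ * T ^ 2)⌋₊ + 1, ?_, ?_, ?_, ?_, ?_⟩
  · intro p hp
    rw [mem_sliceRegion hc0' hT0.le] at hp
    obtain ⟨ha, hd⟩ := abs_le_of_slice hc0 hT0.le hp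
    obtain ⟨ha1, ha2⟩ := abs_le.1 ha
    set s := p.1 / (L : ℤ) with hs
    have e1 : s * L ≤ p.1 := Int.ediv_mul_le _ hLpos'.ne'
    have e2 : p.1 < s * L + L := by
      have := Int.lt_ediv_add_one_mul_self p.1 hLpos'
      rw [add_mul, one_mul] at this; exact this
    have e1' : (s : ℝ) * L ≤ p.1 := by exact_mod_cast e1
    have e2' : (p.1 : ℝ) < s * L + L := by exact_mod_cast e2
    refine ⟨s, Finset.mem_Ico.2 ⟨?_, ?_⟩, Finset.mem_Ico.2 ⟨e1, e2⟩, ?_⟩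
    · have h1 : (-(S : ℝ)) * L < (s + 1) * L := by
        have : T ≤ (S - 1) * L := by
          calc T = 1 / η * (η * T) := by field_simp
            _ ≤ (S - 1) * L := mul_le_mul (by linarith) hL1 (by positivity) (by linarith [
              (by positivity : 0 < 1 / η)])
        nlinarith
      have h2 := lt_of_mul_lt_mul_right h1 hLpos.le
      have h3 : (-(S : ℤ)) < s + 1 := by exact_mod_cast h2
      omega
    · have h1 : (s : ℝ) * L < S * L := by
        have : T ≤ (S - 1) * L := by
          calc T = 1 / η * (η * T) := by field_simp
            _ ≤ (S - 1) * L := mul_le_mul (by linarith) hL1 (by positivity) (by linarith [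
              (by positivity : 0 < 1 / η)])
        nlinarith
      have h2 := lt_of_mul_lt_mul_right h1 hLpos.le
      exact_mod_cast h2
    · have hdV : (p.2 : ℝ) ^ 2 ≤ V s + θ * T ^ 2 := by
        have hA : |(s * L : ℝ) ^ 2 - (p.1 : ℝ) ^ 2| ≤ 28 * η * T ^ 2 := by
          refine (abs_sq_sub_sq_le (L := 2 * (η * T)) (B := 4 * T) ?_ ?_).trans ?_
          · rw [abs_le]; constructor <;> linarith
          · have : η * T ≤ T := by nlinarith
            rw [abs_le]; constructor <;> linarith
          · nlinarith
        have h1 := (abs_le.1 (abs_section_sub_le hδ hT0 hη hc hA)).2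
        have h2 : 2 * (p.1 : ℝ) * p.2 ≤ 2 * T ^ 2 := by
          have : (p.1 : ℝ) * p.2 ≤ T * T := (le_abs_self _).trans (by
            rw [abs_mul]; exact mul_le_mul ha hd (abs_nonneg _) hT0.le)
          nlinarith
        have h3 : (p.2 : ℝ) ^ 2 + c ^ 2 ≤
            c ^ 2 * T ^ 2 / ((p.1 : ℝ) ^ 2 + c ^ 2) + 2 * T ^ 2 / ((p.1 : ℝ) ^ 2 + c ^ 2) := by
          rw [← add_div, le_div_iff₀ (by positivity)]
          linarith
        have h4 : 2 * T ^ 2 / ((p.1 : ℝ) ^ 2 + c ^ 2) ≤ 2 * η / δ ^ 2 * T ^ 2 := by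
          calc 2 * T ^ 2 / ((p.1 : ℝ) ^ 2 + c ^ 2) ≤ 2 * T ^ 2 / (δ * T) ^ 2 := by
                have : (δ * T) ^ 2 ≤ (p.1 : ℝ) ^ 2 + c ^ 2 := by
                  have : (δ * T) ^ 2 ≤ c ^ 2 := by gcongr
                  nlinarith [sq_nonneg (p.1 : ℝ)]
                gcongr
            _ = 2 * 1 / δ ^ 2 := by field_simp
            _ ≤ 2 * (η * T ^ 2) / δ ^ 2 := by gcongr
            _ = _ := by ring
        have h5 : 28 * η / δ ^ 2 * T ^ 2 + 2 * η / δ ^ 2 * T ^ 2 ≤ θ * T ^ 2 := by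
          have e : θ * T ^ 2 = 28 * η / δ ^ 2 * T ^ 2 + 2 * η / δ ^ 2 * T ^ 2 +
            15 * η / δ ^ 2 * T ^ 2 := by rw [hθ]; ring
          have : 0 ≤ 15 * η / δ ^ 2 * T ^ 2 := by positivity
          linarith
        simp only [hV]
        linarith
      have hd' : |(p.2 : ℝ)| ≤ √(V s + θ * T ^ 2) := Real.abs_le_sqrt hdV
      have h6 := Nat.lt_floor_add_one (√(V s + θ * T ^ 2))
      obtain ⟨h7, h8⟩ := abs_lt.1 (lt_of_le_of_lt hd' h6)
      have h7' : -((⌊√(V s + θ * T ^ 2)⌋₊ : ℤ) + 1) < p.2 := by exact_mod_cast h7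
      have h8' : p.2 < (⌊√(V s + θ * T ^ 2)⌋₊ : ℤ) + 1 := by exact_mod_cast h8
      rw [Finset.mem_Ico]
      push_cast
      constructor <;> linarith
  · intro s hs p hp1 hp2
    rw [mem_sliceRegion hc0' hT0.le]
    rw [Finset.mem_Ico] at hs hp1 hp2
    set w := ⌊√(V s - θ * T ^ 2)⌋₊ with hw
    change -(w : ℤ) ≤ p.2 ∧ p.2 < -(w : ℤ) + (2 * w : ℕ) at hp2
    have hwpos : 0 < w := by
      by_contra! h
      have : w = 0 := by omega
      rw [this] at hp2
      simp at hp2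
      omega
    have hpos : 0 < V s - θ * T ^ 2 := by
      by_contra! h
      rw [hw, Real.sqrt_eq_zero_of_nonpos h] at hwpos
      simp at hwpos
    have hwle : (w : ℝ) ≤ √(V s - θ * T ^ 2) := Nat.floor_le (Real.sqrt_nonneg _)
    have hd : |p.2| ≤ (w : ℤ) := by
      rw [abs_le]; push_cast at hp2; constructor <;> linarith
    have hd' : |(p.2 : ℝ)| ≤ √(V s - θ * T ^ 2) := by
      refine le_trans ?_ hwle
      exact_mod_cast hd
    have hdV : (p.2 : ℝ) ^ 2 ≤ V s - θ * T ^ 2 := by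
      rw [← Real.sq_sqrt hpos.le, ← sq_abs]
      gcongr
    have hdT : |(p.2 : ℝ)| ≤ T := abs_le_of_sq_le_sq (by
      have := hVT s; nlinarith [mul_pos hθ0 (pow_pos hT0 2)]) hT0.le
    have hs1 : |(s : ℝ)| ≤ S := by
      rw [abs_le]; exact ⟨by exact_mod_cast hs.1, by exact_mod_cast hs.2.le⟩
    have hA : |(s * L : ℝ)| ≤ 6 * T := by
      rw [abs_mul, abs_of_pos hLpos]
      calc |(s : ℝ)| * L ≤ (1 / η + 2) * (2 * (η * T)) :=
            mul_le_mul (hs1.trans hS2) hL2 hLpos.le (by positivity)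
        _ = 2 * T + 4 * (η * T) := by field_simp; ring
        _ ≤ 6 * T := by nlinarith
    obtain ⟨hA1, hA2⟩ := abs_le.1 hA
    have e1' : (s : ℝ) * L ≤ p.1 := by exact_mod_cast hp1.1
    have e2' : (p.1 : ℝ) < s * L + L := by exact_mod_cast hp1.2
    have hηT : η * T ≤ T := by nlinarith
    have hA' : |(s * L : ℝ) ^ 2 - (p.1 : ℝ) ^ 2| ≤ 28 * η * T ^ 2 := by
      refine (abs_sq_sub_sq_le (L := 2 * (η * T)) (B := 14 * T) ?_ ?_).trans ?_
      · rw [abs_le]; constructor <;> linarith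
      · rw [abs_le]; constructor <;> linarith
      · nlinarith
    have ha : |(p.1 : ℝ)| ≤ 8 * T := by rw [abs_le]; constructor <;> linarith
    have h1 := (abs_le.1 (abs_section_sub_le hδ hT0 hη hc hA')).1
    have h2 : -(2 * (p.1 : ℝ) * p.2) ≤ 16 * T ^ 2 := by
      have : -((p.1 : ℝ) * p.2) ≤ 8 * T * T := (neg_le_abs _).trans (by
        rw [abs_mul]; exact mul_le_mul ha hdT (abs_nonneg _) (by positivity))
      nlinarith
    have h3 : (p.2 : ℝ) ^ 2 + c ^ 2 ≤
        c ^ 2 * T ^ 2 / ((p.1 : ℝ) ^ 2 + c ^ 2) - 17 * η / δ ^ 2 * T ^ 2 := by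
      have e : θ * T ^ 2 = 28 * η / δ ^ 2 * T ^ 2 + 17 * η / δ ^ 2 * T ^ 2 := by rw [hθ]; ring
      simp only [hV] at hdV
      linarith
    have hpc : (δ * T) ^ 2 ≤ (p.1 : ℝ) ^ 2 + c ^ 2 := by
      have : (δ * T) ^ 2 ≤ c ^ 2 := by gcongr
      nlinarith [sq_nonneg (p.1 : ℝ)]
    have h4 : ((p.1 : ℝ) ^ 2 + c ^ 2) * ((p.2 : ℝ) ^ 2 + c ^ 2) ≤
        c ^ 2 * T ^ 2 - 17 * T ^ 2 := by
      calc ((p.1 : ℝ) ^ 2 + c ^ 2) * ((p.2 : ℝ) ^ 2 + c ^ 2)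
          ≤ ((p.1 : ℝ) ^ 2 + c ^ 2) *
            (c ^ 2 * T ^ 2 / ((p.1 : ℝ) ^ 2 + c ^ 2) - 17 * η / δ ^ 2 * T ^ 2) := by gcongr
        _ = c ^ 2 * T ^ 2 - ((p.1 : ℝ) ^ 2 + c ^ 2) * (17 * η / δ ^ 2 * T ^ 2) := by field_simp
        _ ≤ c ^ 2 * T ^ 2 - (δ * T) ^ 2 * (17 * η / δ ^ 2 * T ^ 2) := by gcongr
        _ = c ^ 2 * T ^ 2 - 17 * (η * T ^ 2) * T ^ 2 := by field_simp
        _ ≤ c ^ 2 * T ^ 2 - 17 * 1 * T ^ 2 := by gcongr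
        _ = _ := by ring
    nlinarith
  · intro s
    have h1 := Nat.floor_le (Real.sqrt_nonneg (V s + θ * T ^ 2))
    have h2 := Nat.lt_floor_add_one (√(V s - θ * T ^ 2))
    have h3 : √(V s + θ * T ^ 2) ≤ √(V s - θ * T ^ 2) + √(90 * η / δ ^ 2) * T := by
      rw [Real.sqrt_le_left (by positivity)]
      have h4 : V s - θ * T ^ 2 ≤ √(V s - θ * T ^ 2) ^ 2 := by
        rcases le_total 0 (V s - θ * T ^ 2) with h | h
        · rw [Real.sq_sqrt h]
        · exact h.trans (sq_nonneg _)
      have h5 : √(90 * η / δ ^ 2) ^ 2 = 2 * θ := by rw [Real.sq_sqrt (by positivity), hsq]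
      have h6 : 0 ≤ √(V s - θ * T ^ 2) * (√(90 * η / δ ^ 2) * T) := by positivity
      nlinarith
    push_cast
    linarith
  · intro s
    have : ⌊√(V s - θ * T ^ 2)⌋₊ ≤ ⌊√(V s + θ * T ^ 2)⌋₊ := by
      refine Nat.floor_le_floor (Real.sqrt_le_sqrt ?_)
      nlinarith [mul_pos hθ0 (pow_pos hT0 2)]
    push_cast
    have : (⌊√(V s - θ * T ^ 2)⌋₊ : ℝ) ≤ ⌊√(V s + θ * T ^ 2)⌋₊ := by exact_mod_cast this
    linarith
  · intro s
    have h1 := Nat.floor_le (Real.sqrt_nonneg (V s + θ * T ^ 2))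
    have h2 : √(V s + θ * T ^ 2) ≤ (1 + θ) * T := by
      rw [Real.sqrt_le_left (by positivity)]
      have := hVT s
      nlinarith [mul_pos hθ0 (pow_pos hT0 2), mul_pos (pow_pos hθ0 2) (pow_pos hT0 2)]
    push_cast
    linarith

theorem classPair_shift {N : ℕ} {α β γ₀ δ₀ c : ℤ} (hc : c ≡ γ₀ [ZMOD N]) (p : ℤ × ℤ) :
    ClassPair N α (α + β) (δ₀ + γ₀) c p ↔ ClassPair N α β δ₀ c (p.1, p.2 - c) := by
  unfold ClassPair
  refine and_congr_right fun h1 => and_congr ?_ ?_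
  · constructor
    · intro h
      have := h.sub hc
      rwa [add_sub_cancel_right] at this
    · intro h
      have := h.add hc
      rwa [sub_add_cancel] at this
  · have h2 : p.1 * c ≡ α * c [ZMOD c * N] := by
      obtain ⟨e, he⟩ := Int.modEq_iff_dvd.1 h1
      exact Int.modEq_iff_dvd.2 ⟨e, by linear_combination c * he⟩
    simp only
    constructor
    · intro h
      have := h.sub h2
      convert this using 1 <;> ring
    · intro h
      have := h.add h2
      convert this using 1 <;> ring

theorem boxCount_shift {N : ℕ} {α β γ₀ δ₀ c : ℤ} (hc : c ≡ γ₀ [ZMOD N]) (A B : ℤ) (l₁ l₂ : ℕ) :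
    boxCount (ClassPair N α (α + β) (δ₀ + γ₀) c) A B l₁ l₂ =
      boxCount (ClassPair N α β δ₀ c) A (B - c) l₁ l₂ := by
  classical
  unfold boxCount
  refine Finset.card_bij' (fun p _ => (p.1, p.2 - c)) (fun p _ => (p.1, p.2 + c)) ?_ ?_ ?_ ?_
  · intro p hp
    simp only [Finset.mem_filter, Finset.mem_product, Finset.mem_Ico] at hp ⊢
    exact ⟨⟨hp.1.1, by constructor <;> linarith [hp.1.2.1, hp.1.2.2]⟩,
      (classPair_shift hc p).1 hp.2⟩
  · intro p hp
    simp only [Finset.mem_filter, Finset.mem_product, Finset.mem_Ico] at hp ⊢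
    refine ⟨⟨hp.1.1, by constructor <;> linarith [hp.1.2.1, hp.1.2.2]⟩,
      (classPair_shift hc _).2 ?_⟩
    simpa using hp.2
  · intro p _
    simp
  · intro p _
    simp

open Classical in
theorem exists_abs_slice_sub_le {N k : ℕ} (hN : 0 < N) {δ : ℝ} (hδ : 0 < δ) :
    ∃ E₀ : ℝ, 0 ≤ E₀ ∧ ∀ η T : ℝ, 0 < η → η ≤ 1 → 1 / η ≤ T → ∀ c : ℕ, δ * T ≤ c → (c : ℝ) ≤ T →
      (c / c.gcd (N ^ k)).Coprime N → ∀ α β γ₀ δ₀ : ℤ, (c : ℤ) ≡ γ₀ [ZMOD N] →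
      |(((sliceRegion c T).filter (ClassPair N α β δ₀ c)).card : ℝ) -
        ((sliceRegion c T).filter (ClassPair N α (α + β) (δ₀ + γ₀) c)).card| ≤
        24 * ((N : ℝ) ^ k / δ) * (√(90 * η / δ ^ 2) * T + 2) + 12 / η * E₀ * T ^ (7 / 8 : ℝ) := by
  obtain ⟨C, hC1, hC⟩ := exists_abs_boxCount_classPair_sub_le
  set E₀ := C * ((N : ℝ) ^ 2 * ((N : ℝ) ^ k) ^ 3) * (1 + (6 + 90 / δ ^ 2) / δ) with hE₀
  have hE₀0 : 0 ≤ E₀ := by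
    have : 0 ≤ C := by linarith
    positivity
  refine ⟨E₀, hE₀0, fun η T hη hη1 hT c hc hcT hcop α β γ₀ δ₀ hcγ => ?_⟩
  have hT1 : 1 ≤ η * T := by rw [div_le_iff₀ hη] at hT; linarith
  have hT0 : 0 < T := by nlinarith
  have hTT : 1 ≤ T := by nlinarith
  have hc0 : (0 : ℝ) < c := lt_of_lt_of_le (by positivity) hc
  have hc0' : 0 < c := by exact_mod_cast hc0
  obtain ⟨κ, hκ0, hκ1, hbox⟩ := hC N k c hN hc0' hcop α β δ₀
  obtain ⟨w, w', hout, hin, hw, hww', hw'⟩ := exists_strips hδ hη hη1 hT hc hcT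
  set L := ⌈η * T⌉₊ with hL
  set S := ⌈1 / η⌉₊ + 1 with hS
  set E := E₀ * T ^ (7 / 8 : ℝ) with hE
  set D := √(90 * η / δ ^ 2) * T + 2 with hD
  have hL2 : (L : ℝ) ≤ 2 * (η * T) := by
    have := Nat.ceil_lt_add_one (by positivity : 0 ≤ η * T)
    rw [← hL] at this; linarith
  have hS2 : (S : ℝ) ≤ 3 / η := by
    have h1 := Nat.ceil_lt_add_one (by positivity : 0 ≤ 1 / η)
    have h2 : 1 ≤ 1 / η := by rw [le_div_iff₀ hη]; linarith
    have h3 : 3 / η = 3 * (1 / η) := by ring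
    rw [hS, h3]; push_cast; linarith
  have hηT : η * T ≤ T := by nlinarith
  have herr : ∀ v : ℕ, (v : ℝ) ≤ (1 + 45 * η / δ ^ 2) * T + 1 → ∀ A B : ℤ,
      |(boxCount (ClassPair N α β δ₀ c) A B L (2 * v) : ℝ) - κ * (L * (2 * v : ℕ))| ≤ E := by
    intro v hv A B
    refine (hbox A B L (2 * v)).trans ?_
    have h1 : (c : ℝ) ^ (7 / 8 : ℝ) ≤ T ^ (7 / 8 : ℝ) :=
      Real.rpow_le_rpow hc0.le hcT (by norm_num)
    have h2 : ((L : ℝ) + (2 * v : ℕ)) / c ≤ (6 + 90 / δ ^ 2) / δ := by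
      have h3 : (L : ℝ) + (2 * v : ℕ) ≤ (6 + 90 / δ ^ 2) * T := by
        have h4 : 45 * η / δ ^ 2 * T ≤ 45 * 1 / δ ^ 2 * T := by gcongr
        have h5 : (6 + 90 / δ ^ 2) * T = 6 * T + 2 * (45 * 1 / δ ^ 2 * T) := by ring
        push_cast
        rw [h5]
        linarith
      calc ((L : ℝ) + (2 * v : ℕ)) / c ≤ (6 + 90 / δ ^ 2) * T / (δ * T) := by gcongr
        _ = _ := by field_simp
    have hC0 : 0 ≤ C := by linarith
    calc C * ((N : ℝ) ^ 2 * ((N : ℝ) ^ k) ^ 3) * (c : ℝ) ^ (7 / 8 : ℝ) *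
          (1 + ((L : ℝ) + (2 * v : ℕ)) / c)
        ≤ C * ((N : ℝ) ^ 2 * ((N : ℝ) ^ k) ^ 3) * T ^ (7 / 8 : ℝ) *
          (1 + (6 + 90 / δ ^ 2) / δ) := by
          refine mul_le_mul ?_ (by linarith) (by positivity) (by positivity)
          exact mul_le_mul_of_nonneg_left h1 (by positivity)
      _ = E := by rw [hE, hE₀]; ring
  have hwv : ∀ s, (w s : ℝ) ≤ (1 + 45 * η / δ ^ 2) * T + 1 := fun s => (hww' s).trans (hw' s)
  have hD0 : 0 ≤ D := by positivity
  have hE0 : 0 ≤ E := by positivity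
  have hfin : 2 * (S : ℝ) * (2 * κ * L * D + 2 * E) ≤
      24 * ((N : ℝ) ^ k / δ) * D + 12 / η * E₀ * T ^ (7 / 8 : ℝ) := by
    have hκ2 : κ ≤ (N : ℝ) ^ k / (δ * T) := hκ1.trans (by gcongr)
    calc 2 * (S : ℝ) * (2 * κ * L * D + 2 * E)
        ≤ 2 * (3 / η) * (2 * ((N : ℝ) ^ k / (δ * T)) * (2 * (η * T)) * D + 2 * E) := by gcongr
      _ = _ := by rw [hE]; field_simp; ring
  rw [abs_le]
  constructor
  · have := card_filter_le_of_strips (sliceRegion c T) (ClassPair N α (α + β) (δ₀ + γ₀) c)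
      (ClassPair N α β δ₀ c) L S w w' hκ0 hout hin (fun s _ => hw s) (E := E)
      (fun s _ => by rw [boxCount_shift hcγ]; exact herr _ (hw' s) _ _)
      (fun s _ => herr _ (hwv s) _ _)
    linarith
  · have := card_filter_le_of_strips (sliceRegion c T) (ClassPair N α β δ₀ c)
      (ClassPair N α (α + β) (δ₀ + γ₀) c) L S w w' hκ0 hout hin (fun s _ => hw s) (E := E)
      (fun s _ => herr _ (hw' s) _ _)
      (fun s _ => by rw [boxCount_shift hcγ]; exact herr _ (hwv s) _ _)
    linarith

theorem card_le_of_mem_Icc {s : Finset ℤ} {x y : ℝ} (hxy : x ≤ y)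
    (h : ∀ k ∈ s, x ≤ (k : ℝ) ∧ (k : ℝ) ≤ y) : (s.card : ℝ) ≤ y - x + 1 := by
  have hsub : s ⊆ Finset.Icc ⌈x⌉ ⌊y⌋ := fun k hk =>
    Finset.mem_Icc.2 ⟨Int.ceil_le.2 (h k hk).1, Int.le_floor.2 (h k hk).2⟩
  have h1 := Finset.card_le_card hsub
  rw [Int.card_Icc] at h1
  have h2 : ((⌊y⌋ + 1 - ⌈x⌉).toNat : ℝ) ≤ y - x + 1 := by
    rcases le_total 0 (⌊y⌋ + 1 - ⌈x⌉) with h3 | h3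
    · have : ((⌊y⌋ + 1 - ⌈x⌉).toNat : ℝ) = ((⌊y⌋ + 1 - ⌈x⌉ : ℤ) : ℝ) := by
        exact_mod_cast Int.toNat_of_nonneg h3
      rw [this]
      push_cast
      linarith [Int.floor_le y, Int.le_ceil x]
    · rw [Int.toNat_of_nonpos h3]
      push_cast
      linarith
  exact le_trans (by exact_mod_cast h1) h2

theorem card_le_of_modEq {s : Finset ℤ} {T : ℝ} {c : ℕ} (hT : 0 ≤ T) (hc : 0 < c)
    (hbox : ∀ x ∈ s, |(x : ℝ)| ≤ T) (h : ∀ x ∈ s, ∀ y ∈ s, x ≡ y [ZMOD c]) :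
    (s.card : ℝ) ≤ 2 * T / c + 1 := by
  rcases s.eq_empty_or_nonempty with rfl | ⟨x₀, hx₀⟩
  · simp; positivity
  have hc' : (0 : ℝ) < c := by exact_mod_cast hc
  have hinj : Set.InjOn (fun x : ℤ => x / c) s := by
    intro x hx y hy hxy
    have h1 := h x hx y hy
    simp only at hxy
    rw [Int.ModEq] at h1
    rw [← Int.emod_add_mul_ediv x c, ← Int.emod_add_mul_ediv y c, h1, hxy]
  rw [← Finset.card_image_of_injOn hinj]
  set r : ℤ := x₀ % c with hr
  refine (card_le_of_mem_Icc (x := (-T - r) / c) (y := (T - r) / c) (by gcongr; linarith) ?_).trans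
    (le_of_eq (by field_simp; ring))
  intro k hk
  obtain ⟨x, hx, rfl⟩ := Finset.mem_image.1 hk
  have h1 : x % c = r := h x hx x₀ hx₀
  have h2 : (x : ℝ) = r + c * ((x / c : ℤ) : ℝ) := by
    rw [← h1]
    exact_mod_cast (Int.emod_add_mul_ediv x c).symm
  have h3 := abs_le.1 (hbox x hx)
  rw [div_le_iff₀ hc', le_div_iff₀ hc']
  constructor <;> linarith

/-- Trivial bound for the number of pairs in a box with `a d ≡ 1 (mod c)`. -/
theorem card_mul_modEq_one_le {s : Finset (ℤ × ℤ)} {T : ℝ} {c : ℕ} (hT : 0 ≤ T) (hc : 0 < c)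
    (hbox : ∀ p ∈ s, |(p.1 : ℝ)| ≤ T ∧ |(p.2 : ℝ)| ≤ T)
    (h : ∀ p ∈ s, p.1 * p.2 ≡ 1 [ZMOD c]) :
    (s.card : ℝ) ≤ (2 * T + 1) * (2 * T / c + 1) := by
  have h1 : s.card = ∑ a ∈ s.image Prod.fst, (s.filter fun p => p.1 = a).card :=
    Finset.card_eq_sum_card_image _ _
  have h2 : ∀ a ∈ s.image Prod.fst,
      ((s.filter fun p => p.1 = a).card : ℝ) ≤ 2 * T / c + 1 := by
    intro a _
    have hinj : Set.InjOn Prod.snd (s.filter fun p => p.1 = a : Set (ℤ × ℤ)) := by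
      intro p hp q hq hpq
      simp only [Finset.coe_filter, Set.mem_ofPred_eq] at hp hq
      exact Prod.ext (hp.2.trans hq.2.symm) hpq
    rw [← Finset.card_image_of_injOn hinj]
    refine card_le_of_modEq hT hc ?_ ?_
    · intro x hx
      obtain ⟨p, hp, rfl⟩ := Finset.mem_image.1 hx
      exact (hbox p (Finset.mem_filter.1 hp).1).2
    · intro x hx y hy
      obtain ⟨p, hp, rfl⟩ := Finset.mem_image.1 hx
      obtain ⟨q, hq, rfl⟩ := Finset.mem_image.1 hy
      obtain ⟨hp, hp'⟩ := Finset.mem_filter.1 hp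
      obtain ⟨hq, hq'⟩ := Finset.mem_filter.1 hq
      have e1 := h p hp
      have e2 := h q hq
      rw [hp'] at e1
      rw [hq'] at e2
      calc p.2 = 1 * p.2 := (one_mul _).symm
        _ ≡ (a * q.2) * p.2 [ZMOD c] := e2.symm.mul_right _
        _ = (a * p.2) * q.2 := by ring
        _ ≡ 1 * q.2 [ZMOD c] := e1.mul_right _
        _ = q.2 := one_mul _
  have h3 : ((s.image Prod.fst).card : ℝ) ≤ 2 * T + 1 := by
    refine card_le_of_abs_le hT fun x hx => ?_
    obtain ⟨p, hp, rfl⟩ := Finset.mem_image.1 hx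
    exact (hbox p hp).1
  rw [h1]
  push_cast
  refine (Finset.sum_le_sum h2).trans ?_
  rw [Finset.sum_const, nsmul_eq_mul]
  gcongr

theorem eventually_mul_rpow_le (A : ℝ) {ε r s : ℝ} (hε : 0 < ε) (hrs : r < s) :
    ∀ᶠ T : ℝ in atTop, A * T ^ r ≤ ε * T ^ s := by
  have h := tendsto_rpow_atTop (sub_pos.2 hrs)
  filter_upwards [h.eventually_ge_atTop (A / ε), eventually_gt_atTop 0] with T hT hT0
  rw [div_le_iff₀ hε] at hT
  have : T ^ s = T ^ (s - r) * T ^ r := by rw [← Real.rpow_add hT0]; ring_nf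
  rw [this]
  have := Real.rpow_nonneg hT0.le r
  nlinarith

/-! ### Counting in congruence classes -/

/-- The matrices congruent to `(α β; γ₀ δ₀)` modulo `N`. -/
def matClass (N : ℕ) (α β γ₀ δ₀ : ℤ) : Set SL2Z :=
  {γ | γ 0 0 ≡ α [ZMOD N] ∧ γ 0 1 ≡ β [ZMOD N] ∧ γ 1 0 ≡ γ₀ [ZMOD N] ∧ γ 1 1 ≡ δ₀ [ZMOD N]}

theorem real_det_entries (γ : SL2Z) : (γ 0 0 : ℝ) * γ 1 1 - γ 0 1 * γ 1 0 = 1 := by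
  exact_mod_cast det_entries γ

theorem mem_sliceRegion_of_entries {γ : SL2Z} {c : ℕ} {T : ℝ} (hc : 0 < c) (hT : 0 ≤ T)
    (hγ : γ 1 0 = c) : (γ 0 0, γ 1 1) ∈ sliceRegion c T ↔ frobNorm γ ≤ T := by
  rw [mem_sliceRegion hc hT, frobNorm_le_iff hT]
  have hdet := real_det_entries γ
  have hc' : (0 : ℝ) < c := by exact_mod_cast hc
  have hγ' : (γ 1 0 : ℝ) = c := by exact_mod_cast hγ
  rw [hγ'] at hdet ⊢
  have e : ((γ 0 0 : ℝ) ^ 2 + c ^ 2) * ((γ 1 1 : ℝ) ^ 2 + c ^ 2) - 2 * γ 0 0 * γ 1 1 + 1 =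
      c ^ 2 * ((γ 0 0 : ℝ) ^ 2 + (γ 0 1 : ℝ) ^ 2 + c ^ 2 + (γ 1 1 : ℝ) ^ 2) := by
    have : (γ 0 1 : ℝ) * c = γ 0 0 * γ 1 1 - 1 := by linarith
    linear_combination (-(γ 0 1 : ℝ) * c - γ 0 0 * γ 1 1 + 1) * this
  simp only
  rw [e, mul_le_mul_iff_right₀ (by positivity)]

theorem classPair_of_mem_matClass {N c : ℕ} {α β γ₀ δ₀ : ℤ} {γ : SL2Z} (hγ : γ 1 0 = c)
    (h : γ ∈ matClass N α β γ₀ δ₀) : ClassPair N α β δ₀ c (γ 0 0, γ 1 1) := by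
  obtain ⟨h1, h2, -, h4⟩ := h
  refine ⟨h1, h4, ?_⟩
  have hdet := det_entries γ
  obtain ⟨e, he⟩ := Int.modEq_iff_dvd.1 h2
  refine Int.modEq_iff_dvd.2 ⟨e, ?_⟩
  simp only
  rw [hγ] at hdet
  linear_combination c * he - hdet

theorem exists_of_classPair {N c : ℕ} {α β γ₀ δ₀ : ℤ}
    (hcγ : (c : ℤ) ≡ γ₀ [ZMOD N]) {p : ℤ × ℤ} (h : ClassPair N α β δ₀ c p) :
    ∃ γ ∈ matClass N α β γ₀ δ₀, γ 1 0 = c ∧ (γ 0 0, γ 1 1) = p := by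
  obtain ⟨h1, h2, h3⟩ := h
  obtain ⟨e, he⟩ := Int.modEq_iff_dvd.1 h3
  let M : Matrix (Fin 2) (Fin 2) ℤ := !![p.1, β - N * e; c, p.2]
  have hM : M.det = 1 := by
    rw [Matrix.det_fin_two]
    simp only [M, Matrix.of_apply, Matrix.cons_val', Matrix.cons_val_zero, Matrix.cons_val_one,
      Matrix.cons_val_fin_one]
    linear_combination -he
  refine ⟨⟨M, hM⟩, ⟨?_, ?_, ?_, ?_⟩, ?_, ?_⟩
  · exact h1
  · change β - N * e ≡ β [ZMOD N]
    exact Int.modEq_iff_dvd.2 ⟨e, by ring⟩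
  · exact hcγ
  · exact h2
  · rfl
  · rfl

open Classical in
theorem cnt_matClass_eq_sum {N : ℕ} {α β γ₀ δ₀ : ℤ} {δ T : ℝ} (hδ : 0 < δ) (hT : 0 < T) :
    cnt (matClass N α β γ₀ δ₀ ∩ {γ | δ * T < γ 1 0}) T =
      ∑ c ∈ (Finset.Ioc 0 ⌊T⌋₊).filter fun c : ℕ => δ * T < c ∧ (c : ℤ) ≡ γ₀ [ZMOD N],
        ((sliceRegion c T).filter (ClassPair N α β δ₀ c)).card := by
  unfold cnt
  rw [Finset.card_eq_sum_card_fiberwise (f := fun γ : SL2Z => (γ 1 0).toNat)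
    (t := (Finset.Ioc 0 ⌊T⌋₊).filter fun c : ℕ => δ * T < c ∧ (c : ℤ) ≡ γ₀ [ZMOD N])]
  · refine Finset.sum_congr rfl fun c hc => ?_
    simp only [Finset.mem_filter, Finset.mem_Ioc] at hc
    obtain ⟨⟨hc0, -⟩, hcδ, hcγ⟩ := hc
    refine Finset.card_bij (fun γ _ => (γ 0 0, γ 1 1)) ?_ ?_ ?_
    · intro γ hγ
      simp only [Finset.mem_filter, mem_ballF] at hγ ⊢
      have hγc : γ 1 0 = c := by omega
      exact ⟨(mem_sliceRegion_of_entries hc0 hT.le hγc).2 hγ.1.1,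
        classPair_of_mem_matClass hγc hγ.1.2.1⟩
    · intro γ hγ γ' hγ' h
      simp only [Finset.mem_filter, Prod.mk.injEq] at hγ hγ' h
      have hγc : γ 1 0 = c := by omega
      have hγc' : γ' 1 0 = c := by omega
      have d1 := det_entries γ
      have d2 := det_entries γ'
      refine SL2Z_ext h.1 ?_ (hγc.trans hγc'.symm) h.2
      have hc1 : (c : ℤ) ≠ 0 := by omega
      refine mul_right_cancel₀ hc1 ?_
      rw [hγc] at d1
      rw [hγc', ← h.1, ← h.2] at d2
      linarith
    · intro p hp
      obtain ⟨hp1, hp2⟩ := Finset.mem_filter.1 hp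
      obtain ⟨γ, hγ, hγc, hγp⟩ := exists_of_classPair hcγ hp2
      refine ⟨γ, ?_, hγp⟩
      rw [← hγp, mem_sliceRegion_of_entries hc0 hT.le hγc] at hp1
      simp only [Finset.mem_filter, mem_ballF]
      refine ⟨⟨hp1, hγ, ?_⟩, by omega⟩
      change δ * T < (γ 1 0 : ℤ)
      rw [hγc]
      exact_mod_cast hcδ
  · intro γ hγ
    simp only [Finset.coe_filter, Set.mem_ofPred_eq, mem_ballF, Set.mem_inter_iff,
      Finset.mem_Ioc] at hγ ⊢
    obtain ⟨hγ1, hγ2, hγ3⟩ := hγ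
    have hpos : (0 : ℝ) < γ 1 0 := lt_trans (by positivity) hγ3
    have hpos' : 0 < γ 1 0 := by exact_mod_cast hpos
    have e : (((γ 1 0).toNat : ℕ) : ℤ) = γ 1 0 := Int.toNat_of_nonneg hpos'.le
    have e' : (((γ 1 0).toNat : ℕ) : ℝ) = γ 1 0 := by exact_mod_cast e
    refine ⟨⟨by omega, ?_⟩, by rw [e']; exact hγ3, by rw [e]; exact hγ2.2.2.1⟩
    refine Nat.le_floor ?_
    rw [e']
    exact (le_abs_self _).trans (abs_entry_le hγ1 1 0)

theorem card_filter_dvd_le {m : ℕ} {T : ℝ} (hT : 0 ≤ T) :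
    (((Finset.Ioc 0 ⌊T⌋₊).filter fun c => m ∣ c).card : ℝ) ≤ T / m := by
  rw [Nat.Ioc_filter_dvd_card_eq_div]
  exact Nat.cast_div_le.trans (by gcongr; exact Nat.floor_le hT)

open Classical in
theorem card_filter_not_coprime_le {N k : ℕ} (hN : 0 < N) {T : ℝ} (hT : 0 ≤ T) :
    (((Finset.Ioc 0 ⌊T⌋₊).filter fun c => ¬ (c / c.gcd (N ^ k)).Coprime N).card : ℝ) ≤
      N * (T / 2 ^ k) := by
  have h1 : ((Finset.Ioc 0 ⌊T⌋₊).filter fun c => ¬ (c / c.gcd (N ^ k)).Coprime N).card ≤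
      ∑ p ∈ N.primeFactors, ((Finset.Ioc 0 ⌊T⌋₊).filter fun c => p ^ k ∣ c).card := by
    refine (Finset.card_le_card ?_).trans Finset.card_biUnion_le
    intro c hc
    obtain ⟨hc1, hc2⟩ := Finset.mem_filter.1 hc
    obtain ⟨p, hp, hpN, hpc⟩ := exists_prime_pow_dvd_of_not_coprime hc2
    exact Finset.mem_biUnion.2 ⟨p, Nat.mem_primeFactors.2 ⟨hp, hpN, hN.ne'⟩,
      Finset.mem_filter.2 ⟨hc1, hpc⟩⟩
  have h2 : ∀ p ∈ N.primeFactors,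
      (((Finset.Ioc 0 ⌊T⌋₊).filter fun c => p ^ k ∣ c).card : ℝ) ≤ T / 2 ^ k := by
    intro p hp
    refine (card_filter_dvd_le hT).trans ?_
    have : (2 : ℝ) ≤ p := by exact_mod_cast (Nat.prime_of_mem_primeFactors hp).two_le
    push_cast
    gcongr
  calc _ ≤ ∑ p ∈ N.primeFactors, (((Finset.Ioc 0 ⌊T⌋₊).filter fun c => p ^ k ∣ c).card : ℝ) := by
        exact_mod_cast h1
    _ ≤ ∑ p ∈ N.primeFactors, T / 2 ^ k := Finset.sum_le_sum h2
    _ = N.primeFactors.card * (T / 2 ^ k) := by rw [Finset.sum_const, nsmul_eq_mul]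
    _ ≤ _ := by
      have : N.primeFactors.card ≤ N := by
        refine (Finset.card_le_card (t := Finset.Ioc 0 N) fun p hp => ?_).trans (by simp)
        exact Finset.mem_Ioc.2 ⟨(Nat.prime_of_mem_primeFactors hp).pos,
          Nat.le_of_mem_primeFactors hp⟩
      gcongr

open Classical in
theorem card_slice_filter_le {N c : ℕ} {α β δ₀ : ℤ} {δ T : ℝ} (hδ : 0 < δ) (hδ1 : δ ≤ 1)
    (hT : 1 ≤ T) (hc : δ * T < c) :
    (((sliceRegion c T).filter (ClassPair N α β δ₀ c)).card : ℝ) ≤ 9 * T / δ := by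
  have hc' : (0 : ℝ) < c := lt_trans (by positivity) hc
  have hc0 : 0 < c := by exact_mod_cast hc'
  refine (card_mul_modEq_one_le (c := c) (T := T) (by linarith) hc0 ?_ ?_).trans ?_
  · intro p hp
    have := (Finset.mem_filter.1 hp).1
    rw [mem_sliceRegion hc0 (by linarith)] at this
    exact abs_le_of_slice hc' (by linarith) this
  · intro p hp
    obtain ⟨-, -, h⟩ := (Finset.mem_filter.1 hp).2
    have h1 : p.1 * p.2 ≡ 1 + β * c [ZMOD c] := h.of_dvd (dvd_mul_right _ _)
    refine h1.trans (Int.modEq_iff_dvd.2 ⟨-β, by ring⟩)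
  · have h1 : 2 * T / c ≤ 2 / δ := by
      calc 2 * T / c ≤ 2 * T / (δ * T) := by gcongr
        _ = _ := by field_simp
    have h2 : 1 ≤ 1 / δ := by rw [le_div_iff₀ hδ]; linarith
    have h3 : 2 * T / c + 1 ≤ 3 / δ := by
      have : 3 / δ = 2 / δ + 1 / δ := by ring
      linarith
    calc (2 * T + 1) * (2 * T / c + 1) ≤ (3 * T) * (3 / δ) :=
          mul_le_mul (by linarith) h3 (by positivity) (by positivity)
      _ = _ := by ring

theorem eventually_abs_cnt_sub_le {N : ℕ} (hN : 0 < N) (α β γ₀ δ₀ : ℤ) {δ ε : ℝ} (hδ : 0 < δ)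
    (hδ1 : δ ≤ 1) (hε : 0 < ε) :
    ∀ᶠ T : ℝ in atTop,
      |(cnt (matClass N α β γ₀ δ₀ ∩ {γ | δ * T < γ 1 0}) T : ℝ) -
        cnt (matClass N α (α + β) γ₀ (δ₀ + γ₀) ∩ {γ | δ * T < γ 1 0}) T| ≤ ε * T ^ 2 := by
  classical
  obtain ⟨k, hk⟩ : ∃ k : ℕ, 9 * N / δ / (ε / 3) ≤ 2 ^ k := by
    obtain ⟨k, hk⟩ := pow_unbounded_of_one_lt (9 * N / δ / (ε / 3)) (one_lt_two : (1 : ℝ) < 2)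
    exact ⟨k, hk.le⟩
  obtain ⟨E₀, hE₀, hslice⟩ := exists_abs_slice_sub_le (k := k) hN hδ
  set K : ℝ := (N : ℝ) ^ k / δ with hK
  have hN' : (0 : ℝ) < N := by exact_mod_cast hN
  have hK0 : 0 < K := by positivity
  set η : ℝ := min 1 ((ε / 3 / (24 * K)) ^ 2 / (90 / δ ^ 2)) with hη
  have hη0 : 0 < η := lt_min one_pos (by positivity)
  have hη1 : η ≤ 1 := min_le_left _ _
  have hη2 : 24 * K * √(90 * η / δ ^ 2) ≤ ε / 3 := by
    rw [← le_div_iff₀' (by positivity), Real.sqrt_le_left (by positivity)]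
    have : η ≤ (ε / 3 / (24 * K)) ^ 2 / (90 / δ ^ 2) := min_le_right _ _
    rw [le_div_iff₀ (by positivity)] at this
    calc 90 * η / δ ^ 2 = η * (90 / δ ^ 2) := by ring
      _ ≤ _ := this
  filter_upwards [eventually_mul_rpow_le (24 * K * 2) (ε := ε / 6) (by positivity) zero_lt_one,
    eventually_mul_rpow_le (12 / η * E₀) (ε := ε / 6) (r := 7 / 8) (s := 1) (by positivity)
      (by norm_num), eventually_ge_atTop (1 / η), eventually_ge_atTop 1] with T h1 h2 h3 h4
  rw [Real.rpow_zero, Real.rpow_one] at h1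
  rw [Real.rpow_one] at h2
  have hT0 : 0 < T := by linarith
  rw [cnt_matClass_eq_sum hδ hT0, cnt_matClass_eq_sum hδ hT0]
  push_cast
  rw [← Finset.sum_sub_distrib]
  refine (Finset.abs_sum_le_sum_abs _ _).trans ?_
  set F := (Finset.Ioc 0 ⌊T⌋₊).filter fun c : ℕ => δ * T < c ∧ (c : ℤ) ≡ γ₀ [ZMOD N] with hF
  rw [← Finset.sum_filter_add_sum_filter_not F fun c : ℕ => (c / c.gcd (N ^ k)).Coprime N]
  have hcard : ∀ s ⊆ Finset.Ioc 0 ⌊T⌋₊, (s.card : ℝ) ≤ T := by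
    intro s hs
    have := Finset.card_le_card hs
    rw [Nat.card_Ioc, Nat.sub_zero] at this
    exact le_trans (by exact_mod_cast this) (Nat.floor_le hT0.le)
  have hgood : ∑ c ∈ F.filter fun c : ℕ => (c / c.gcd (N ^ k)).Coprime N,
      |(((sliceRegion c T).filter (ClassPair N α β δ₀ c)).card : ℝ) -
        ((sliceRegion c T).filter (ClassPair N α (α + β) (δ₀ + γ₀) c)).card| ≤
      T * (ε / 3 * T + ε / 6 * T + ε / 6 * T) := by
    refine (Finset.sum_le_card_nsmul _ _ (ε / 3 * T + ε / 6 * T + ε / 6 * T) fun c hc => ?_).trans ?_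
    · simp only [hF, Finset.mem_filter, Finset.mem_Ioc] at hc
      obtain ⟨⟨⟨hc0, hcT⟩, hcδ, hcγ⟩, hcop⟩ := hc
      have hcT' : (c : ℝ) ≤ T := (Nat.cast_le.2 hcT).trans (Nat.floor_le hT0.le)
      refine (hslice η T hη0 hη1 h3 c hcδ.le hcT' hcop α β γ₀ δ₀ hcγ).trans ?_
      have : 24 * K * √(90 * η / δ ^ 2) * T ≤ ε / 3 * T := by gcongr
      linarith
    · rw [nsmul_eq_mul]
      refine mul_le_mul_of_nonneg_right (hcard _ ?_) (by positivity)
      exact (Finset.filter_subset _ _).trans (Finset.filter_subset _ _)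
  have hbad : ∑ c ∈ F.filter fun c : ℕ => ¬ (c / c.gcd (N ^ k)).Coprime N,
      |(((sliceRegion c T).filter (ClassPair N α β δ₀ c)).card : ℝ) -
        ((sliceRegion c T).filter (ClassPair N α (α + β) (δ₀ + γ₀) c)).card| ≤ ε / 3 * T ^ 2 := by
    refine (Finset.sum_le_card_nsmul _ _ (9 * T / δ) fun c hc => ?_).trans ?_
    · simp only [hF, Finset.mem_filter, Finset.mem_Ioc] at hc
      obtain ⟨⟨-, hcδ, -⟩, -⟩ := hc
      have b1 := card_slice_filter_le (N := N) (α := α) (β := β) (δ₀ := δ₀) hδ hδ1 h4 hcδ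
      have b2 := card_slice_filter_le (N := N) (α := α) (β := α + β) (δ₀ := δ₀ + γ₀) hδ hδ1 h4 hcδ
      rw [abs_le]
      constructor <;> linarith [(Nat.cast_nonneg _ :
        (0 : ℝ) ≤ ((sliceRegion c T).filter (ClassPair N α β δ₀ c)).card), (Nat.cast_nonneg _ :
        (0 : ℝ) ≤ ((sliceRegion c T).filter (ClassPair N α (α + β) (δ₀ + γ₀) c)).card)]
    · rw [nsmul_eq_mul]
      have hb : ((F.filter fun c : ℕ => ¬ (c / c.gcd (N ^ k)).Coprime N).card : ℝ) ≤
          N * (T / 2 ^ k) := by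
        refine le_trans ?_ (card_filter_not_coprime_le (k := k) hN hT0.le)
        exact_mod_cast Finset.card_le_card (Finset.filter_subset_filter _ (Finset.filter_subset _ _))
      rw [div_le_iff₀ (by positivity)] at hk
      calc _ ≤ (N * (T / 2 ^ k)) * (9 * T / δ) := by gcongr
        _ = (9 * N / δ) * (T ^ 2 / 2 ^ k) := by ring
        _ ≤ (2 ^ k * (ε / 3)) * (T ^ 2 / 2 ^ k) := by gcongr
        _ = _ := by field_simp
  nlinarith

/-! ### Reduction modulo `N` -/

theorem cnt_preimage_equiv (e : SL2Z ≃ SL2Z) (he : ∀ γ, frobNorm (e γ) = frobNorm γ)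
    (S : Set SL2Z) (T : ℝ) : cnt (e ⁻¹' S) T = cnt S T := by
  classical
  unfold cnt
  refine Finset.card_bij' (fun γ _ => e γ) (fun γ _ => e.symm γ) ?_ ?_ ?_ ?_
  · intro γ hγ
    simp only [Finset.mem_filter, mem_ballF, he] at hγ ⊢
    exact hγ
  · intro γ hγ
    have h := he (e.symm γ)
    simp only [Finset.mem_filter, mem_ballF, Set.mem_preimage, Equiv.apply_symm_apply] at hγ h ⊢
    rwa [← h]
  · simp
  · simp

/-- Reduction modulo `N`. -/
abbrev red (N : ℕ) : SL2Z →* Matrix.SpecialLinearGroup (Fin 2) (ZMod N) :=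
  Matrix.SpecialLinearGroup.map (Int.castRingHom (ZMod N))

theorem red_apply (N : ℕ) (γ : SL2Z) (i j : Fin 2) : red N γ i j = (γ i j : ZMod N) := rfl

theorem red_eq_red_iff {N : ℕ} {γ γ₁ : SL2Z} :
    red N γ = red N γ₁ ↔ γ ∈ matClass N (γ₁ 0 0) (γ₁ 0 1) (γ₁ 1 0) (γ₁ 1 1) := by
  simp only [matClass, Set.mem_ofPred_eq, ← ZMod.intCast_eq_intCast_iff]
  constructor
  · intro h
    simp only [← red_apply, h, and_self]
  · rintro ⟨h1, h2, h3, h4⟩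
    ext i j
    fin_cases i <;> fin_cases j <;> assumption

theorem red_surjective (N : ℕ) [NeZero N] : Function.Surjective (red N) := by
  intro g
  have hdet : g 0 0 * g 1 1 - g 0 1 * g 1 0 = 1 := by
    have := g.det_coe
    rwa [Matrix.det_fin_two] at this
  have hN : 0 < N := Nat.pos_of_ne_zero (NeZero.ne N)
  set a₀ := (g 0 0).val with ha₀
  set c := (g 1 0).val + N with hc
  obtain ⟨b₁, eb⟩ : ∃ b₁ : ℤ, (b₁ : ZMod N) = g 0 1 := ZMod.intCast_surjective _
  obtain ⟨d₁, ed⟩ : ∃ d₁ : ℤ, (d₁ : ZMod N) = g 1 1 := ZMod.intCast_surjective _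
  have ea : ((a₀ : ℕ) : ZMod N) = g 0 0 := ZMod.natCast_zmod_val _
  have ec : ((c : ℕ) : ZMod N) = g 1 0 := by
    rw [hc]; push_cast; rw [ZMod.natCast_zmod_val]; simp
  have hdvd : (N : ℤ) ∣ a₀ * d₁ - b₁ * c - 1 := by
    rw [← ZMod.intCast_zmod_eq_zero_iff_dvd]
    push_cast
    rw [ea, eb, ec, ed, hdet, sub_self]
  set k := ∏ p ∈ c.primeFactors.filter fun p => ¬ p ∣ a₀, p with hk
  set a := a₀ + k * N with ha
  have hcop : a.Coprime c := by
    refine Nat.coprime_of_dvd fun p hp hpa hpc => ?_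
    by_cases hpa₀ : p ∣ a₀
    · have h1 : p ∣ k * N := (Nat.dvd_add_right hpa₀).1 hpa
      rcases hp.dvd_mul.1 h1 with h2 | h2
      · obtain ⟨q, hq, hpq⟩ := (hp.prime.dvd_finsetProd_iff _).1 h2
        obtain ⟨hq1, hq2⟩ := Finset.mem_filter.1 hq
        rw [(Nat.prime_dvd_prime_iff_eq hp (Nat.prime_of_mem_primeFactors hq1)).1 hpq] at hpa₀
        exact hq2 hpa₀
      · have h3 : (p : ℤ) ∣ a₀ * d₁ - b₁ * c - 1 := (Int.natCast_dvd_natCast.2 h2).trans hdvd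
        have h4 : (p : ℤ) ∣ a₀ * d₁ - b₁ * c :=
          dvd_sub (Dvd.dvd.mul_right (Int.natCast_dvd_natCast.2 hpa₀) _)
            (Dvd.dvd.mul_left (Int.natCast_dvd_natCast.2 hpc) _)
        have h5 : (p : ℤ) ∣ 1 := by
          have := dvd_sub h4 h3
          simpa using this
        exact hp.one_lt.ne' (Nat.dvd_one.1 (by exact_mod_cast h5))
    · have h1 : p ∣ k := Finset.dvd_prod_of_mem (fun p => p)
        (Finset.mem_filter.2 ⟨Nat.mem_primeFactors.2 ⟨hp, hpc, by omega⟩, hpa₀⟩)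
      exact hpa₀ ((Nat.dvd_add_left (h1.mul_right N)).1 hpa)
  obtain ⟨u, v, huv⟩ := Nat.isCoprime_iff_coprime.2 hcop
  have hdvd' : (N : ℤ) ∣ a * d₁ - b₁ * c - 1 := by
    have : (a * d₁ - b₁ * c - 1 : ℤ) = a₀ * d₁ - b₁ * c - 1 + N * (k * d₁) := by
      rw [ha]; push_cast; ring
    rw [this]
    exact dvd_add hdvd (dvd_mul_right _ _)
  obtain ⟨e, he⟩ := hdvd'
  let M : Matrix (Fin 2) (Fin 2) ℤ := !![(a : ℤ), b₁ + N * e * v; (c : ℤ), d₁ - N * e * u]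
  have hM : M.det = 1 := by
    rw [Matrix.det_fin_two]
    simp only [M, Matrix.of_apply, Matrix.cons_val', Matrix.cons_val_zero, Matrix.cons_val_one,
      Matrix.cons_val_fin_one]
    linear_combination he - N * e * huv
  refine ⟨⟨M, hM⟩, ?_⟩
  ext i j
  fin_cases i <;> fin_cases j
  · change (((a : ℕ) : ℤ) : ZMod N) = g 0 0
    rw [ha]; push_cast; rw [ea]; simp
  · change ((b₁ + N * e * v : ℤ) : ZMod N) = g 0 1
    push_cast [eb]; simp
  · change (((c : ℕ) : ℤ) : ZMod N) = g 1 0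
    push_cast; exact ec
  · change ((d₁ - N * e * u : ℤ) : ZMod N) = g 1 1
    push_cast [ed]; simp

/-- The number of coprime pairs in a square box. -/
theorem le_card_coprime_pairs (M : ℕ) (hM : 2 ≤ M) : (M : ℝ) ^ 2 / 4 ≤
    (((Finset.Ioc 0 M ×ˢ Finset.Ioc 0 M).filter fun p : ℕ × ℕ => p.1.Coprime p.2).card : ℝ) := by
  set B := Finset.Ioc 0 M ×ˢ Finset.Ioc 0 M with hB
  have h0 := Finset.card_filter_add_card_filter_not (s := B) fun p : ℕ × ℕ => p.1.Coprime p.2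
  have hBc : B.card = M ^ 2 := by simp [hB, sq]
  have h1 : (B.filter fun p : ℕ × ℕ => ¬ p.1.Coprime p.2).card ≤
      ∑ d ∈ Finset.Ioc 1 M, (M / d) * (M / d) := by
    have : ∀ d, (((Finset.Ioc 0 M).filter fun x => d ∣ x) ×ˢ
        ((Finset.Ioc 0 M).filter fun x => d ∣ x)).card = (M / d) * (M / d) := by
      intro d
      rw [Finset.card_product, Nat.Ioc_filter_dvd_card_eq_div]
    simp only [← this]
    refine (Finset.card_le_card fun p hp => ?_).trans Finset.card_biUnion_le
    obtain ⟨hpB, hp⟩ := Finset.mem_filter.1 hp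
    obtain ⟨hp1, hp2⟩ := Finset.mem_product.1 hpB
    have hpos := (Finset.mem_Ioc.1 hp1).1
    have hg := Nat.gcd_pos_of_pos_left p.2 hpos
    refine Finset.mem_biUnion.2 ⟨p.1.gcd p.2, Finset.mem_Ioc.2 ⟨?_, ?_⟩, ?_⟩
    · have : p.1.gcd p.2 ≠ 1 := hp
      omega
    · exact (Nat.gcd_le_left _ hpos).trans (Finset.mem_Ioc.1 hp1).2
    · exact Finset.mem_product.2 ⟨Finset.mem_filter.2 ⟨hp1, Nat.gcd_dvd_left _ _⟩,
        Finset.mem_filter.2 ⟨hp2, Nat.gcd_dvd_right _ _⟩⟩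
  have h2 : ∑ d ∈ Finset.Ioc 1 M, ((M / d : ℕ) : ℝ) * (M / d : ℕ) ≤ (M : ℝ) ^ 2 * (3 / 4) := by
    calc ∑ d ∈ Finset.Ioc 1 M, ((M / d : ℕ) : ℝ) * (M / d : ℕ)
        ≤ ∑ d ∈ Finset.Ioc 1 M, (M : ℝ) ^ 2 * ((d : ℝ) ^ 2)⁻¹ := by
          refine Finset.sum_le_sum fun d _ => ?_
          have : ((M / d : ℕ) : ℝ) ≤ M / d := Nat.cast_div_le
          calc ((M / d : ℕ) : ℝ) * (M / d : ℕ) ≤ (M / d : ℝ) * (M / d : ℝ) := by gcongr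
            _ = _ := by rw [div_mul_div_comm, div_eq_mul_inv]; ring
      _ = (M : ℝ) ^ 2 * ∑ d ∈ Finset.Ioc 1 M, ((d : ℝ) ^ 2)⁻¹ := by rw [Finset.mul_sum]
      _ ≤ _ := by
        gcongr
        have e : Finset.Ioc 1 M = insert 2 (Finset.Ioc 2 M) := by
          ext x; simp only [Finset.mem_Ioc, Finset.mem_insert]; omega
        rw [e, Finset.sum_insert (by simp)]
        have := sum_Ioc_inv_sq_le_sub (α := ℝ) (k := 2) (n := M) (by norm_num) hM
        have h3 : (0 : ℝ) ≤ (M : ℝ)⁻¹ := by positivity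
        norm_num at this ⊢
        linarith
  have h3 : ((B.filter fun p : ℕ × ℕ => ¬ p.1.Coprime p.2).card : ℝ) ≤ (M : ℝ) ^ 2 * (3 / 4) :=
    le_trans (by exact_mod_cast h1) h2
  have h4 : ((B.filter fun p : ℕ × ℕ => p.1.Coprime p.2).card : ℝ) +
      (B.filter fun p : ℕ × ℕ => ¬ p.1.Coprime p.2).card = (M : ℝ) ^ 2 := by
    rw [← Nat.cast_add, h0, hBc]; push_cast; rfl
  linarith

theorem exists_small_completion {a c : ℕ} (ha : 0 < a) (hc : 0 < c) (h : a.Coprime c) :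
    ∃ γ : SL2Z, γ 0 0 = a ∧ γ 1 0 = c ∧ |γ 0 1| ≤ a ∧ |γ 1 1| ≤ c := by
  obtain ⟨u, v, huv⟩ := Nat.isCoprime_iff_coprime.2 h
  set d : ℤ := u % c with hd
  have hc' : (0 : ℤ) < c := by exact_mod_cast hc
  have ha' : (0 : ℤ) < a := by exact_mod_cast ha
  have hd0 : 0 ≤ d := Int.emod_nonneg _ hc'.ne'
  have hdc : d < c := Int.emod_lt_of_pos _ hc'
  have hu : d + c * (u / c) = u := Int.emod_add_mul_ediv u c
  set b : ℤ := -(v + a * (u / c)) with hb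
  have hdet : (a : ℤ) * d - b * c = 1 := by
    rw [hb]; linear_combination huv + a * hu
  let M : Matrix (Fin 2) (Fin 2) ℤ := !![(a : ℤ), b; (c : ℤ), d]
  have hM : M.det = 1 := by
    rw [Matrix.det_fin_two]
    simpa [M] using hdet
  refine ⟨⟨M, hM⟩, rfl, rfl, ?_, ?_⟩
  · change |b| ≤ a
    have h1 : b * c ≤ a * c := by nlinarith
    have h2 : (-1) * (c : ℤ) ≤ b * c := by nlinarith
    have h3 := le_of_mul_le_mul_right h1 hc'
    have h4 := le_of_mul_le_mul_right h2 hc'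
    rw [abs_le]; constructor <;> linarith
  · change |d| ≤ c
    rw [abs_of_nonneg hd0]; exact hdc.le

theorem le_cnt_univ {T : ℝ} (hT : 4 ≤ T) : T ^ 2 / 64 ≤ cnt Set.univ T := by
  classical
  set M := ⌊T / 2⌋₊ with hM
  have hM1 : (M : ℝ) ≤ T / 2 := Nat.floor_le (by linarith)
  have hM2 : T / 4 ≤ M := by
    have := Nat.lt_floor_add_one (T / 2)
    rw [← hM] at this; linarith
  have hM3 : 2 ≤ M := Nat.le_floor (by push_cast; linarith)
  set P := (Finset.Ioc 0 M ×ˢ Finset.Ioc 0 M).filter fun p : ℕ × ℕ => p.1.Coprime p.2 with hP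
  have hex : ∀ p : ℕ × ℕ, ∃ γ : SL2Z, p ∈ P →
      γ 0 0 = p.1 ∧ γ 1 0 = p.2 ∧ |γ 0 1| ≤ p.1 ∧ |γ 1 1| ≤ p.2 := by
    intro p
    by_cases hp : p ∈ P
    · simp only [hP, Finset.mem_filter, Finset.mem_product, Finset.mem_Ioc] at hp
      obtain ⟨γ, hγ⟩ := exists_small_completion hp.1.1.1 hp.1.2.1 hp.2
      exact ⟨γ, fun _ => hγ⟩
    · exact ⟨1, fun h => absurd h hp⟩
  choose f hf using hex
  have hle : P.card ≤ cnt Set.univ T := by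
    refine Finset.card_le_card_of_injOn f ?_ ?_
    · intro p hp
      obtain ⟨h1, h2, h3, h4⟩ := hf p hp
      simp only [hP, Finset.coe_filter, Set.mem_ofPred_eq, Finset.mem_product, Finset.mem_Ioc] at hp
      simp only [Finset.coe_filter, Set.mem_ofPred_eq, mem_ballF, Set.mem_univ, and_true]
      have b1 : (p.1 : ℝ) ≤ T / 2 := le_trans (by exact_mod_cast hp.1.1.2) hM1
      have b2 : (p.2 : ℝ) ≤ T / 2 := le_trans (by exact_mod_cast hp.1.2.2) hM1
      have e1 : (f p 0 0 : ℝ) = p.1 := by exact_mod_cast h1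
      have e2 : (f p 1 0 : ℝ) = p.2 := by exact_mod_cast h2
      have e3 : |(f p 0 1 : ℝ)| ≤ p.1 := by exact_mod_cast h3
      have e4 : |(f p 1 1 : ℝ)| ≤ p.2 := by exact_mod_cast h4
      rw [frobNorm_le_iff (by linarith), e1, e2, ← sq_abs (f p 0 1 : ℝ), ← sq_abs (f p 1 1 : ℝ)]
      have s1 : (p.1 : ℝ) ^ 2 ≤ (T / 2) ^ 2 := by gcongr
      have s2 : (p.2 : ℝ) ^ 2 ≤ (T / 2) ^ 2 := by gcongr
      have s3 : |(f p 0 1 : ℝ)| ^ 2 ≤ (T / 2) ^ 2 := by gcongr; linarith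
      have s4 : |(f p 1 1 : ℝ)| ^ 2 ≤ (T / 2) ^ 2 := by gcongr; linarith
      linarith
    · intro p hp p' hp' h
      obtain ⟨h1, h2, -⟩ := hf p hp
      obtain ⟨h3, h4, -⟩ := hf p' hp'
      rw [h] at h1 h2
      exact Prod.ext (by exact_mod_cast h1.symm.trans h3) (by exact_mod_cast h2.symm.trans h4)
  have hcop := le_card_coprime_pairs M hM3
  have : (T / 4) ^ 2 ≤ (M : ℝ) ^ 2 := by gcongr
  calc T ^ 2 / 64 = (T / 4) ^ 2 / 4 := by ring
    _ ≤ (M : ℝ) ^ 2 / 4 := by gcongr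
    _ ≤ P.card := hcop
    _ ≤ _ := by exact_mod_cast hle

/-! ### Equidistribution in congruence classes -/

open Asymptotics

theorem cnt_eq_sum_fiber {β : Type*} (f : SL2Z → β) (Q : Finset β) (T : ℝ) :
    cnt {γ | f γ ∈ Q} T = ∑ b ∈ Q, cnt {γ | f γ = b} T := by
  classical
  have h := Finset.card_eq_sum_card_fiberwise (f := f) (t := Q)
    (s := (ballF T).filter (· ∈ {γ | f γ ∈ Q}))
    fun γ hγ => by simpa using (Finset.mem_filter.1 hγ).2
  unfold cnt
  refine Eq.trans ?_ (h.trans (Finset.sum_congr rfl fun b hb => ?_))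
  · congr
  · refine congrArg Finset.card (Finset.ext fun γ => ?_)
    simp only [Finset.mem_filter, Set.mem_ofPred_eq]
    constructor
    · rintro ⟨⟨h1, -⟩, h2⟩; exact ⟨h1, h2⟩
    · rintro ⟨h1, h2⟩; exact ⟨⟨h1, h2 ▸ hb⟩, h2⟩

theorem cnt_inter_add (S S' : Set SL2Z) (T : ℝ) :
    cnt (S ∩ S') T + cnt (S \ S') T = cnt S T := by
  classical
  unfold cnt
  rw [← Finset.card_filter_add_card_filter_not (s := (ballF T).filter (· ∈ S)) (· ∈ S'),
    Finset.filter_filter, Finset.filter_filter]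
  congr 2 <;> ext γ <;> simp only [Finset.mem_filter, Set.mem_inter_iff, Set.mem_sdiff]

/-- The matrices with a given reduction modulo `N`. -/
def resClass {N : ℕ} (g : Matrix.SpecialLinearGroup (Fin 2) (ZMod N)) : Set SL2Z :=
  {γ | red N γ = g}

theorem frobNorm_congr {γ γ' : SL2Z}
    (h : (γ 0 0 : ℝ) ^ 2 + (γ 0 1 : ℝ) ^ 2 + (γ 1 0 : ℝ) ^ 2 + (γ 1 1 : ℝ) ^ 2 =
      (γ' 0 0 : ℝ) ^ 2 + (γ' 0 1 : ℝ) ^ 2 + (γ' 1 0 : ℝ) ^ 2 + (γ' 1 1 : ℝ) ^ 2) :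
    frobNorm γ = frobNorm γ' := by
  refine eq_of_forall_ge_iff fun T => ?_
  constructor <;> intro h'
  · rwa [frobNorm_le_iff (nonneg_of_frobNorm_le h'), ← h,
      ← frobNorm_le_iff (nonneg_of_frobNorm_le h')]
  · rwa [frobNorm_le_iff (nonneg_of_frobNorm_le h'), h,
      ← frobNorm_le_iff (nonneg_of_frobNorm_le h')]

theorem frobNorm_neg (γ : SL2Z) : frobNorm (-γ) = frobNorm γ := by
  refine frobNorm_congr ?_
  have h : ∀ i j, (-γ) i j = -γ i j := fun i j => rfl
  simp only [h, Int.cast_neg, neg_sq]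

theorem mul_S_entries (γ : SL2Z) : (γ * ModularGroup.S) 0 0 = γ 0 1 ∧
    (γ * ModularGroup.S) 0 1 = -γ 0 0 ∧ (γ * ModularGroup.S) 1 0 = γ 1 1 ∧
    (γ * ModularGroup.S) 1 1 = -γ 1 0 := by
  simp [Matrix.SpecialLinearGroup.coe_mul, Matrix.mul_apply, Fin.sum_univ_two, ModularGroup.coe_S]

theorem mul_T_entries (γ : SL2Z) : (γ * ModularGroup.T) 0 0 = γ 0 0 ∧
    (γ * ModularGroup.T) 0 1 = γ 0 0 + γ 0 1 ∧ (γ * ModularGroup.T) 1 0 = γ 1 0 ∧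
    (γ * ModularGroup.T) 1 1 = γ 1 0 + γ 1 1 := by
  simp [Matrix.SpecialLinearGroup.coe_mul, Matrix.mul_apply, Fin.sum_univ_two, ModularGroup.coe_T]

theorem frobNorm_mul_S (γ : SL2Z) : frobNorm (γ * ModularGroup.S) = frobNorm γ := by
  refine frobNorm_congr ?_
  obtain ⟨h1, h2, h3, h4⟩ := mul_S_entries γ
  rw [h1, h2, h3, h4]
  push_cast
  ring

theorem red_neg (N : ℕ) (γ : SL2Z) : red N (-γ) = -red N γ := by
  ext i j
  change ((-(γ i j) : ℤ) : ZMod N) = -((γ i j : ℤ) : ZMod N)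
  push_cast; rfl

theorem eventually_abs_cnt_resClass_pos_sub_le {N : ℕ} [NeZero N]
    (g : Matrix.SpecialLinearGroup (Fin 2) (ZMod N)) {δ ε : ℝ} (hδ : 0 < δ)
    (hδ1 : δ ≤ 1) (hε : 0 < ε) :
    ∀ᶠ T : ℝ in atTop,
      |(cnt (resClass g ∩ {γ | δ * T < γ 1 0}) T : ℝ) -
        cnt (resClass (g * red N ModularGroup.T) ∩ {γ | δ * T < γ 1 0}) T| ≤ ε * T ^ 2 := by
  obtain ⟨γ₁, rfl⟩ := red_surjective N g
  have h1 : resClass (red N γ₁) = matClass N (γ₁ 0 0) (γ₁ 0 1) (γ₁ 1 0) (γ₁ 1 1) := by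
    ext γ; exact red_eq_red_iff
  have h2 : resClass (red N γ₁ * red N ModularGroup.T) =
      matClass N (γ₁ 0 0) (γ₁ 0 0 + γ₁ 0 1) (γ₁ 1 0) (γ₁ 1 1 + γ₁ 1 0) := by
    obtain ⟨e1, e2, e3, e4⟩ := mul_T_entries γ₁
    ext γ
    have := red_eq_red_iff (N := N) (γ := γ) (γ₁ := γ₁ * ModularGroup.T)
    rw [e1, e2, e3, e4, add_comm (γ₁ 1 0)] at this
    rwa [← map_mul]
  rw [h1, h2]
  exact eventually_abs_cnt_sub_le (Nat.pos_of_ne_zero (NeZero.ne N)) _ _ _ _ hδ hδ1 hε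

theorem cnt_resClass_neg {N : ℕ} (g : Matrix.SpecialLinearGroup (Fin 2) (ZMod N)) (δ T : ℝ) :
    cnt (resClass g ∩ {γ | (γ 1 0 : ℝ) < -(δ * T)}) T =
      cnt (resClass (-g) ∩ {γ | δ * T < γ 1 0}) T := by
  rw [← cnt_preimage_equiv (Equiv.neg SL2Z) frobNorm_neg]
  congr 1
  ext γ
  have h : (-γ) 1 0 = -γ 1 0 := rfl
  simp only [resClass, Equiv.neg_apply, Set.mem_preimage, Set.mem_inter_iff, Set.mem_ofPred_eq,
    red_neg, h, Int.cast_neg, neg_eq_iff_eq_neg, neg_lt_neg_iff]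

theorem cnt_sub_pos_sub_neg {S : Set SL2Z} {δ T : ℝ} (hδ : 0 ≤ δ) (hT : 0 ≤ T) :
    0 ≤ (cnt S T : ℝ) - cnt (S ∩ {γ | δ * T < γ 1 0}) T -
      cnt (S ∩ {γ | (γ 1 0 : ℝ) < -(δ * T)}) T ∧
    (cnt S T : ℝ) - cnt (S ∩ {γ | δ * T < γ 1 0}) T -
      cnt (S ∩ {γ | (γ 1 0 : ℝ) < -(δ * T)}) T ≤ cnt {γ | |(γ 1 0 : ℝ)| ≤ δ * T} T := by
  have hp : 0 ≤ δ * T := mul_nonneg hδ hT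
  have h1 := cnt_inter_add S {γ | δ * T < γ 1 0} T
  have h2 := cnt_inter_add (S \ {γ | δ * T < γ 1 0}) {γ | (γ 1 0 : ℝ) < -(δ * T)} T
  have h3 : (S \ {γ | δ * T < γ 1 0}) ∩ {γ | (γ 1 0 : ℝ) < -(δ * T)} =
      S ∩ {γ | (γ 1 0 : ℝ) < -(δ * T)} := by
    ext γ
    simp only [Set.mem_inter_iff, Set.mem_sdiff, Set.mem_ofPred_eq]
    constructor
    · rintro ⟨⟨a, -⟩, b⟩; exact ⟨a, b⟩
    · rintro ⟨a, b⟩; exact ⟨⟨a, by linarith⟩, b⟩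
  have h4 : cnt ((S \ {γ | δ * T < γ 1 0}) \ {γ | (γ 1 0 : ℝ) < -(δ * T)}) T ≤
      cnt {γ | |(γ 1 0 : ℝ)| ≤ δ * T} T := by
    refine cnt_mono fun γ hγ _ => ?_
    simp only [Set.mem_sdiff, Set.mem_ofPred_eq, not_lt] at hγ ⊢
    exact abs_le.2 ⟨hγ.2, hγ.1.2⟩
  rw [h3] at h2
  have h1' : (cnt (S ∩ {γ | δ * T < γ 1 0}) T : ℝ) + cnt (S \ {γ | δ * T < γ 1 0}) T =
    cnt S T := by exact_mod_cast h1
  have h2' : (cnt (S ∩ {γ | (γ 1 0 : ℝ) < -(δ * T)}) T : ℝ) +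
      cnt ((S \ {γ | δ * T < γ 1 0}) \ {γ | (γ 1 0 : ℝ) < -(δ * T)}) T =
    cnt (S \ {γ | δ * T < γ 1 0}) T := by exact_mod_cast h2
  have h4' : (cnt ((S \ {γ | δ * T < γ 1 0}) \ {γ | (γ 1 0 : ℝ) < -(δ * T)}) T : ℝ) ≤
      cnt {γ | |(γ 1 0 : ℝ)| ≤ δ * T} T := by exact_mod_cast h4
  have h5 : (0 : ℝ) ≤ cnt ((S \ {γ | δ * T < γ 1 0}) \ {γ | (γ 1 0 : ℝ) < -(δ * T)}) T := by
    positivity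
  constructor <;> linarith

theorem isLittleO_cnt_resClass_mul_T {N : ℕ} [NeZero N]
    (g : Matrix.SpecialLinearGroup (Fin 2) (ZMod N)) :
    (fun T => (cnt (resClass g) T : ℝ) - cnt (resClass (g * red N ModularGroup.T)) T)
      =o[atTop] fun T : ℝ => T ^ 2 := by
  rw [isLittleO_iff]
  intro ε hε
  set σ : ℝ := min 1 (ε / 900) with hσ
  have hσ0 : 0 < σ := lt_min one_pos (by positivity)
  have hσ1 : σ ≤ 1 := min_le_left _ _
  have hσ2 : 300 * σ ≤ ε / 3 := by
    have : σ ≤ ε / 900 := min_le_right _ _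
    linarith
  have hδ0 : 0 < σ ^ 2 := by positivity
  have hδ1 : σ ^ 2 ≤ 1 := pow_le_one₀ hσ0.le hσ1
  have hε3 : 0 < ε / 3 := by positivity
  filter_upwards [eventually_abs_cnt_resClass_pos_sub_le g hδ0 hδ1 hε3,
    eventually_abs_cnt_resClass_pos_sub_le (-g) hδ0 hδ1 hε3, eventually_ge_atTop (1 / σ),
    eventually_ge_atTop 0] with T h1 h2 h3 h4
  obtain ⟨a1, a2⟩ := cnt_sub_pos_sub_neg (S := resClass g) hδ0.le h4
  obtain ⟨b1, b2⟩ := cnt_sub_pos_sub_neg (S := resClass (g * red N ModularGroup.T)) hδ0.le h4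
  have hs := cnt_abs_le_le hσ0 hσ1 h3
  have hs' : 300 * σ * T ^ 2 ≤ ε / 3 * T ^ 2 := by gcongr
  rw [neg_mul, ← cnt_resClass_neg, ← cnt_resClass_neg] at h2
  rw [Real.norm_eq_abs, Real.norm_eq_abs, abs_of_nonneg (sq_nonneg T), abs_le]
  rw [abs_le] at h1 h2
  constructor <;> linarith [h1.1, h1.2, h2.1, h2.2]

theorem cnt_resClass_mul_S {N : ℕ} (g : Matrix.SpecialLinearGroup (Fin 2) (ZMod N)) (T : ℝ) :
    cnt (resClass (g * red N ModularGroup.S)) T = cnt (resClass g) T := by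
  rw [← cnt_preimage_equiv (Equiv.mulRight (ModularGroup.S : SL2Z)) frobNorm_mul_S]
  congr 1
  ext γ
  simp [resClass, map_mul]

theorem isLittleO_cnt_resClass_sub {N : ℕ} [NeZero N] (h : SL2Z)
    (g : Matrix.SpecialLinearGroup (Fin 2) (ZMod N)) :
    (fun T => (cnt (resClass g) T : ℝ) - cnt (resClass (g * red N h)) T)
      =o[atTop] fun T : ℝ => T ^ 2 := by
  have hh : h ∈ Subgroup.closure ({ModularGroup.S, ModularGroup.T} : Set SL2Z) := by
    rw [SpecialLinearGroup.SL2Z_generators]; trivial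
  induction hh using Subgroup.closure_induction generalizing g with
  | mem x hx =>
    rcases hx with rfl | rfl
    · simp only [cnt_resClass_mul_S, sub_self]
      exact isLittleO_zero _ _
    · exact isLittleO_cnt_resClass_mul_T g
  | one => simp
  | mul x y _ _ hx hy =>
    refine ((hx g).add (hy (g * red N x))).congr_left fun T => ?_
    rw [map_mul, mul_assoc]; ring
  | inv x _ hx =>
    refine (hx (g * red N x⁻¹)).neg_left.congr_left fun T => ?_
    rw [mul_assoc, ← map_mul, inv_mul_cancel, map_one, mul_one]; ring

theorem isLittleO_cnt_univ {f : ℝ → ℝ} (hf : f =o[atTop] fun T : ℝ => T ^ 2) :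
    f =o[atTop] fun T : ℝ => (cnt Set.univ T : ℝ) := by
  refine hf.trans_isBigO (IsBigO.of_bound 64 ?_)
  filter_upwards [eventually_ge_atTop 4] with T hT
  have := le_cnt_univ hT
  rw [Real.norm_of_nonneg (by positivity), Real.norm_of_nonneg (by positivity)]
  linarith

theorem eventually_cnt_univ_pos : ∀ᶠ T : ℝ in atTop, (0 : ℝ) < cnt Set.univ T := by
  filter_upwards [eventually_ge_atTop 4] with T hT
  have := le_cnt_univ hT
  have : (0 : ℝ) < T ^ 2 / 64 := by positivity
  linarith

/-- `S` has asymptotic density `δ` in norm balls of `SL(2, ℤ)`. -/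
def HasDens (S : Set SL2Z) (δ : ℝ) : Prop :=
  Tendsto (fun T : ℝ => (cnt S T : ℝ) / cnt Set.univ T) atTop (𝓝 δ)

instance (N : ℕ) [NeZero N] : Finite (Matrix.SpecialLinearGroup (Fin 2) (ZMod N)) :=
  Finite.of_injective (fun g => (g : Matrix (Fin 2) (Fin 2) (ZMod N))) Subtype.coe_injective

theorem hasDens_resClass {N : ℕ} [NeZero N]
    (g : Matrix.SpecialLinearGroup (Fin 2) (ZMod N)) :
    HasDens (resClass g) (Nat.card (Matrix.SpecialLinearGroup (Fin 2) (ZMod N)) : ℝ)⁻¹ := by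
  classical
  have := Fintype.ofFinite (Matrix.SpecialLinearGroup (Fin 2) (ZMod N))
  let G := Matrix.SpecialLinearGroup (Fin 2) (ZMod N)
  set n : ℝ := (Nat.card G : ℝ) with hn
  have hn0 : 0 < n := by
    rw [hn]; exact_mod_cast Nat.card_pos
  have h1 : (fun T => ∑ g' : G, ((cnt (resClass g) T : ℝ) - cnt (resClass g') T))
      =o[atTop] fun T : ℝ => (cnt Set.univ T : ℝ) := by
    refine isLittleO_cnt_univ (.fun_sum fun g' _ => ?_)
    obtain ⟨h, hh⟩ := red_surjective N (g⁻¹ * g')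
    simpa [hh] using isLittleO_cnt_resClass_sub h g
  have h2 : ∀ T, ∑ g' : G, ((cnt (resClass g) T : ℝ) - cnt (resClass g') T) =
      n * cnt (resClass g) T - cnt Set.univ T := by
    intro T
    have h3 := cnt_eq_sum_fiber (red N) Finset.univ T
    have h4 : {γ : SL2Z | red N γ ∈ (Finset.univ : Finset G)} = Set.univ := by ext; simp
    rw [h4] at h3
    rw [Finset.sum_sub_distrib, Finset.sum_const, h3, hn, Nat.card_eq_fintype_card,
      Finset.card_univ, nsmul_eq_mul]
    push_cast
    rfl
  have h5 := h1.tendsto_div_nhds_zero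
  have h6 : Tendsto (fun T : ℝ => n⁻¹ * ((∑ g' : G, ((cnt (resClass g) T : ℝ) -
      cnt (resClass g') T)) / (cnt Set.univ T : ℝ)) + n⁻¹) atTop (𝓝 (n⁻¹ * 0 + n⁻¹)) :=
    (h5.const_mul _).add_const _
  rw [mul_zero, zero_add] at h6
  refine h6.congr' ?_
  filter_upwards [eventually_cnt_univ_pos] with T hT
  rw [h2]
  field_simp
  ring

/-- Periodic sets have the expected density. -/
theorem hasDens_red_preimage {N : ℕ} [NeZero N]
    (Q : Set (Matrix.SpecialLinearGroup (Fin 2) (ZMod N))) :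
    HasDens (red N ⁻¹' Q)
      (Q.ncard / Nat.card (Matrix.SpecialLinearGroup (Fin 2) (ZMod N)) : ℝ) := by
  classical
  have := Fintype.ofFinite (Matrix.SpecialLinearGroup (Fin 2) (ZMod N))
  have h1 : ∀ T, (cnt (red N ⁻¹' Q) T : ℝ) / cnt Set.univ T =
      ∑ g ∈ Q.toFinset, (cnt (resClass g) T : ℝ) / cnt Set.univ T := by
    intro T
    have h3 := cnt_eq_sum_fiber (red N) Q.toFinset T
    have h4 : {γ : SL2Z | red N γ ∈ Q.toFinset} = red N ⁻¹' Q := by ext; simp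
    rw [h4] at h3
    rw [h3, ← Finset.sum_div]
    push_cast
    rfl
  have h2 : Tendsto (fun T => ∑ g ∈ Q.toFinset, (cnt (resClass g) T : ℝ) / cnt Set.univ T) atTop
      (𝓝 (∑ g ∈ Q.toFinset,
        (Nat.card (Matrix.SpecialLinearGroup (Fin 2) (ZMod N)) : ℝ)⁻¹)) :=
    tendsto_finsetSum _ fun g _ => hasDens_resClass g
  rw [Finset.sum_const, nsmul_eq_mul, ← Set.ncard_eq_toFinset_card', ← div_eq_mul_inv] at h2
  exact h2.congr fun T => (h1 T).symm

/-! ### Matrices of bounded trace -/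

theorem card_int_dvd_le (n : ℤ) (hn : n ≠ 0) (s : Finset ℤ) (hs : ∀ x ∈ s, x ∣ n) :
    s.card ≤ 2 * n.natAbs.divisors.card := by
  classical
  have hsub : s ⊆ n.natAbs.divisors.image (fun k : ℕ => (k : ℤ)) ∪
      n.natAbs.divisors.image (fun k : ℕ => -(k : ℤ)) := by
    intro x hx
    have h1 : x.natAbs ∈ n.natAbs.divisors :=
      Nat.mem_divisors.2 ⟨Int.natAbs_dvd_natAbs.2 (hs x hx), Int.natAbs_ne_zero.2 hn⟩
    rcases Int.natAbs_eq x with h | h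
    · exact Finset.mem_union_left _ (Finset.mem_image.2 ⟨_, h1, h.symm⟩)
    · exact Finset.mem_union_right _ (Finset.mem_image.2 ⟨_, h1, h.symm⟩)
  refine (Finset.card_le_card hsub).trans ((Finset.card_union_le _ _).trans ?_)
  rw [two_mul]
  exact add_le_add Finset.card_image_le Finset.card_image_le

theorem cnt_trace_le {ε : ℝ} (hε : 0 < ε) : ∃ C : ℝ, 1 ≤ C ∧ ∀ (t : ℤ) (T : ℝ), 1 ≤ T →
    (cnt {γ | trZ γ = t} T : ℝ) ≤ C * T ^ (1 + ε) := by
  classical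
  obtain ⟨C, hC, hdiv⟩ := exists_card_divisors_le_rpow (half_pos hε)
  refine ⟨6 * C + 12, by linarith, fun t T hT => ?_⟩
  have hT0 : 0 ≤ T := by linarith
  set s := (ballF T).filter (· ∈ {γ : SL2Z | trZ γ = t}) with hs
  have hsT : ∀ γ ∈ s, ∀ i j, |(γ i j : ℝ)| ≤ T := fun γ hγ =>
    abs_entry_le (mem_ballF.1 (Finset.mem_filter.1 hγ).1)
  have hst : ∀ γ ∈ s, γ 1 1 = t - γ 0 0 := fun γ hγ => by
    have : γ 0 0 + γ 1 1 = t := (Finset.mem_filter.1 hγ).2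
    linarith
  have hdet : ∀ γ ∈ s, γ 0 1 * γ 1 0 = γ 0 0 * (t - γ 0 0) - 1 := fun γ hγ => by
    have := det_entries γ
    rw [hst γ hγ] at this
    linarith
  set A := s.image fun γ => γ 0 0 with hA
  have hAc : (A.card : ℝ) ≤ 3 * T := by
    have : (A.card : ℝ) ≤ 2 * T + 1 := card_le_of_abs_le hT0 fun x hx => by
      obtain ⟨γ, hγ, rfl⟩ := Finset.mem_image.1 hx
      exact hsT γ hγ 0 0
    linarith
  have hTε : T ≤ T ^ (1 + ε) := by
    conv_lhs => rw [← Real.rpow_one T]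
    exact Real.rpow_le_rpow_of_exponent_le hT (by linarith)
  have hfib : ∀ a ∈ A, ((s.filter fun γ => γ 0 0 = a).card : ℝ) ≤
      2 * C * T ^ ε + if a ∈ ({1, -1} : Finset ℤ) then 6 * T else 0 := by
    intro a ha
    set F := s.filter fun γ => γ 0 0 = a with hF
    have hFs : ∀ γ ∈ F, γ ∈ s ∧ γ 0 0 = a := fun γ hγ => Finset.mem_filter.1 hγ
    set n := a * (t - a) - 1 with hn
    have hbc : ∀ γ ∈ F, γ 0 1 * γ 1 0 = n := fun γ hγ => by
      rw [hdet γ (hFs γ hγ).1, (hFs γ hγ).2]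
    have hinj : ∀ γ ∈ F, ∀ γ' ∈ F, γ 0 1 = γ' 0 1 → γ 1 0 = γ' 1 0 → γ = γ' := by
      intro γ hγ γ' hγ' h1 h2
      refine SL2Z_ext ?_ h1 h2 ?_
      · rw [(hFs γ hγ).2, (hFs γ' hγ').2]
      · rw [hst γ (hFs γ hγ).1, hst γ' (hFs γ' hγ').1, (hFs γ hγ).2, (hFs γ' hγ').2]
    have hpos : 0 ≤ 2 * C * T ^ ε := by positivity
    by_cases hn0 : n = 0
    · have ha1 : a ∈ ({1, -1} : Finset ℤ) := by
        have h1 : a * (t - a) = 1 := by linarith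
        rcases Int.isUnit_iff.1 (IsUnit.of_mul_eq_one _ h1) with h | h <;> simp [h]
      rw [if_pos ha1]
      have h01 : ((F.filter fun γ => γ 0 1 = 0).card : ℝ) ≤ 2 * T + 1 := by
        rw [← Finset.card_image_of_injOn (f := fun γ : SL2Z => γ 1 0)]
        · refine card_le_of_abs_le hT0 fun x hx => ?_
          obtain ⟨γ, hγ, rfl⟩ := Finset.mem_image.1 hx
          exact hsT γ (hFs γ (Finset.mem_filter.1 hγ).1).1 1 0
        · intro γ hγ γ' hγ' h
          have h1 := Finset.mem_filter.1 hγ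
          have h2 := Finset.mem_filter.1 hγ'
          exact hinj γ h1.1 γ' h2.1 (h1.2.trans h2.2.symm) h
      have h10 : ((F.filter fun γ => ¬ γ 0 1 = 0).card : ℝ) ≤ 2 * T + 1 := by
        rw [← Finset.card_image_of_injOn (f := fun γ : SL2Z => γ 0 1)]
        · refine card_le_of_abs_le hT0 fun x hx => ?_
          obtain ⟨γ, hγ, rfl⟩ := Finset.mem_image.1 hx
          exact hsT γ (hFs γ (Finset.mem_filter.1 hγ).1).1 0 1
        · intro γ hγ γ' hγ' h
          have h1 := Finset.mem_filter.1 hγ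
          have h2 := Finset.mem_filter.1 hγ'
          have e1 := (mul_eq_zero.1 ((hbc γ h1.1).trans hn0)).resolve_left h1.2
          have e2 := (mul_eq_zero.1 ((hbc γ' h2.1).trans hn0)).resolve_left h2.2
          exact hinj γ h1.1 γ' h2.1 h (e1.trans e2.symm)
      have := Finset.card_filter_add_card_filter_not (s := F) fun γ : SL2Z => γ 0 1 = 0
      have h' : (F.card : ℝ) = (F.filter fun γ => γ 0 1 = 0).card +
        (F.filter fun γ => ¬ γ 0 1 = 0).card := by exact_mod_cast this.symm
      linarith
    · have h1 : F.card ≤ 2 * n.natAbs.divisors.card := by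
        rw [← Finset.card_image_of_injOn (f := fun γ : SL2Z => γ 0 1)]
        · refine card_int_dvd_le n hn0 _ fun x hx => ?_
          obtain ⟨γ, hγ, rfl⟩ := Finset.mem_image.1 hx
          exact ⟨_, (hbc γ hγ).symm⟩
        · intro γ hγ γ' hγ' h
          have e1 := hbc γ hγ
          have e2 := hbc γ' hγ'
          have h' : γ 0 1 = γ' 0 1 := h
          have hne : γ' 0 1 ≠ 0 := fun h0 => hn0 (by rw [← e2, h0, zero_mul])
          refine hinj γ hγ γ' hγ' h ?_
          rw [h', ← e2] at e1
          exact mul_left_cancel₀ hne e1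
      have h2 : (n.natAbs : ℝ) ≤ T ^ (2 : ℝ) := by
        obtain ⟨γ, hγ, hγa⟩ := Finset.mem_image.1 ha
        have hγF : γ ∈ F := Finset.mem_filter.2 ⟨hγ, hγa⟩
        rw [Nat.cast_natAbs, ← hbc γ hγF]
        push_cast
        rw [abs_mul, Real.rpow_two, sq]
        exact mul_le_mul (hsT γ hγ 0 1) (hsT γ hγ 1 0) (abs_nonneg _) hT0
      have h3 : (n.natAbs.divisors.card : ℝ) ≤ C * T ^ ε := by
        refine (hdiv _ (Int.natAbs_ne_zero.2 hn0)).trans ?_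
        gcongr
        calc (n.natAbs : ℝ) ^ (ε / 2) ≤ (T ^ (2 : ℝ)) ^ (ε / 2) :=
              Real.rpow_le_rpow (by positivity) h2 (by positivity)
          _ = T ^ ε := by rw [← Real.rpow_mul hT0]; congr 1; ring
      have h4 : (F.card : ℝ) ≤ 2 * n.natAbs.divisors.card := by exact_mod_cast h1
      have h5 : (0 : ℝ) ≤ if a ∈ ({1, -1} : Finset ℤ) then 6 * T else 0 := by
        split_ifs <;> linarith
      linarith
  have hcard : (s.card : ℝ) = ∑ a ∈ A, ((s.filter fun γ => γ 0 0 = a).card : ℝ) := by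
    rw [Finset.card_eq_sum_card_image (fun γ : SL2Z => γ 0 0) s]; push_cast; rfl
  rw [show cnt {γ | trZ γ = t} T = s.card by unfold cnt; congr, hcard]
  refine (Finset.sum_le_sum hfib).trans ?_
  rw [Finset.sum_add_distrib, Finset.sum_const, nsmul_eq_mul, Finset.sum_ite_mem,
    Finset.sum_const, nsmul_eq_mul]
  have h6 : ((A ∩ {1, -1}).card : ℝ) ≤ 2 := by
    exact_mod_cast (Finset.card_le_card Finset.inter_subset_right).trans (Finset.card_le_two)
  have h7 : T ^ (1 + ε) = T * T ^ ε := by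
    rw [Real.rpow_add (by linarith), Real.rpow_one]
  calc (A.card : ℝ) * (2 * C * T ^ ε) + ((A ∩ {1, -1}).card : ℝ) * (6 * T)
      ≤ 3 * T * (2 * C * T ^ ε) + 2 * (6 * T) := by gcongr
    _ = 6 * C * T ^ (1 + ε) + 12 * T := by rw [h7]; ring
    _ ≤ _ := by linarith

theorem cnt_le_of_trace_mem {S : Set SL2Z} {T K : ℝ} (Q : Finset ℤ)
    (hK : ∀ t, (cnt {γ | trZ γ = t} T : ℝ) ≤ K)
    (hQ : ∀ γ ∈ S, frobNorm γ ≤ T → trZ γ ∈ Q) : (cnt S T : ℝ) ≤ Q.card * K := by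
  have h1 : cnt S T ≤ ∑ t ∈ Q, cnt {γ | trZ γ = t} T := by
    rw [← cnt_eq_sum_fiber]; exact cnt_mono hQ
  calc (cnt S T : ℝ) ≤ ∑ t ∈ Q, (cnt {γ | trZ γ = t} T : ℝ) := by exact_mod_cast h1
    _ ≤ ∑ _t ∈ Q, K := Finset.sum_le_sum fun t _ => hK t
    _ = _ := by rw [Finset.sum_const, nsmul_eq_mul]

theorem abs_trZ_le {γ : SL2Z} {T : ℝ} (h : frobNorm γ ≤ T) : |(trZ γ : ℝ)| ≤ 2 * T := by
  have h1 := abs_entry_le h 0 0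
  have h2 := abs_entry_le h 1 1
  have : (trZ γ : ℝ) = γ 0 0 + γ 1 1 := by unfold trZ; push_cast; rfl
  rw [this]
  exact (abs_add_le _ _).trans (by linarith)

theorem eventually_cnt_abs_trZ_le {ε : ℝ} (hε : 0 < ε) :
    ∀ᶠ T : ℝ in atTop,
    (cnt {γ | |trZ γ| ≤ 2} T : ℝ) ≤ ε * T ^ 2 := by
  obtain ⟨C, hC, h⟩ := cnt_trace_le (ε := 1 / 2) (by norm_num)
  filter_upwards [eventually_mul_rpow_le (5 * C) hε (r := 1 + 1 / 2) (s := 2) (by norm_num),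
    eventually_ge_atTop 1] with T h1 h2
  have h3 := cnt_le_of_trace_mem (S := {γ | |trZ γ| ≤ 2}) (Finset.Icc (-2) 2)
    (fun t => h t T h2) fun γ hγ _ => Finset.mem_Icc.2 (abs_le.1 hγ)
  have h4 : ((Finset.Icc (-2 : ℤ) 2).card : ℝ) = 5 := by simp
  rw [h4] at h3
  rw [Real.rpow_two] at h1
  linarith

/-- Traces congruent to `s` modulo the square of a large integer are rare. -/
theorem eventually_cnt_large_le {s : ℤ} (hs : |s| ≤ 2) {θ ε : ℝ} (hθ : 0 < θ) (hε : 0 < ε) :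
    ∀ᶠ T : ℝ in atTop,
    (cnt {γ | trZ γ ≠ s ∧ ∃ p : ℕ, T ^ θ < p ∧ (p : ℤ) ^ 2 ∣ trZ γ - s} T : ℝ) ≤ ε * T ^ 2 := by
  classical
  obtain ⟨C, hC, h⟩ := cnt_trace_le (half_pos hθ)
  filter_upwards [eventually_mul_rpow_le (16 * C) hε (r := 2 - θ / 2) (s := 2) (by linarith),
    eventually_ge_atTop 1] with T h1 hT
  rw [Real.rpow_two] at h1
  refine le_trans ?_ h1
  have hT0 : 0 < T := by linarith
  have hTθ : 1 ≤ T ^ θ := Real.one_le_rpow hT hθ.le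
  set R := ⌊2 * T + 2⌋₊ with hR
  set M := ⌊T ^ θ⌋₊ with hM
  have hM1 : 1 ≤ M := Nat.le_floor (by simpa using hTθ)
  have hM2 : T ^ θ / 2 ≤ M := by
    have := Nat.lt_floor_add_one (T ^ θ)
    rw [← hM] at this
    have : (1 : ℝ) ≤ M := by exact_mod_cast hM1
    linarith
  have hR4 : (R : ℝ) ≤ 4 * T := (Nat.floor_le (by linarith)).trans (by linarith)
  set Qp : ℕ → Finset ℤ := fun p =>
    ((Finset.Ioc 0 R).filter fun n => p ^ 2 ∣ n).image (fun n : ℕ => s + n) ∪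
    ((Finset.Ioc 0 R).filter fun n => p ^ 2 ∣ n).image (fun n : ℕ => s - n) with hQp
  have hQpc : ∀ p, ((Qp p).card : ℝ) ≤ 2 * R * ((p : ℝ) ^ 2)⁻¹ := by
    intro p
    have : (Qp p).card ≤ R / p ^ 2 + R / p ^ 2 := by
      rw [← Nat.Ioc_filter_dvd_card_eq_div]
      exact (Finset.card_union_le _ _).trans (add_le_add Finset.card_image_le Finset.card_image_le)
    have h2 : ((R / p ^ 2 : ℕ) : ℝ) ≤ R / (p : ℝ) ^ 2 := by
      exact_mod_cast (Nat.cast_div_le (α := ℝ) (m := R) (n := p ^ 2))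
    calc ((Qp p).card : ℝ) ≤ (R / p ^ 2 : ℕ) + (R / p ^ 2 : ℕ) := by exact_mod_cast this
      _ ≤ R / (p : ℝ) ^ 2 + R / (p : ℝ) ^ 2 := add_le_add h2 h2
      _ = _ := by rw [div_eq_mul_inv]; ring
  have hQ := cnt_le_of_trace_mem
    (S := {γ | trZ γ ≠ s ∧ ∃ p : ℕ, T ^ θ < p ∧ (p : ℤ) ^ 2 ∣ trZ γ - s})
    ((Finset.Ioc M R).biUnion Qp) (fun t => h t T hT) (by
      rintro γ ⟨hne, p, hp, hdvd⟩ hγ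
      have habs := abs_trZ_le hγ
      have hMp : M < p := by
        have := Nat.floor_le (zero_le_one.trans hTθ)
        rw [← hM] at this
        exact_mod_cast this.trans_lt hp
      have hnR : (trZ γ - s).natAbs ≤ R := by
        refine Nat.le_floor ?_
        rw [Nat.cast_natAbs]
        push_cast
        have h2 : |(s : ℝ)| ≤ 2 := by exact_mod_cast hs
        exact (abs_sub _ _).trans (by linarith)
      have hn0 : 0 < (trZ γ - s).natAbs := Int.natAbs_pos.2 (sub_ne_zero.2 hne)
      have hdvd' : p ^ 2 ∣ (trZ γ - s).natAbs := by
        rw [← Int.natCast_dvd]; push_cast; exact hdvd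
      have hpR : p ≤ R := by
        have := Nat.le_of_dvd hn0 hdvd'
        nlinarith
      have hmem : (trZ γ - s).natAbs ∈ (Finset.Ioc 0 R).filter fun n => p ^ 2 ∣ n :=
        Finset.mem_filter.2 ⟨Finset.mem_Ioc.2 ⟨hn0, hnR⟩, hdvd'⟩
      refine Finset.mem_biUnion.2 ⟨p, Finset.mem_Ioc.2 ⟨hMp, hpR⟩, ?_⟩
      rcases Int.natAbs_eq (trZ γ - s) with h' | h'
      · exact Finset.mem_union_left _ (Finset.mem_image.2 ⟨_, hmem, by linarith⟩)
      · exact Finset.mem_union_right _ (Finset.mem_image.2 ⟨_, hmem, by linarith⟩))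
  have hsum : ∑ p ∈ Finset.Ioc M R, ((p : ℝ) ^ 2)⁻¹ ≤ 2 / T ^ θ := by
    have h2 : (M : ℝ)⁻¹ ≤ 2 / T ^ θ := by
      rw [← inv_div]; exact inv_anti₀ (by positivity) hM2
    by_cases hMR : M ≤ R
    · have h3 := sum_Ioc_inv_sq_le_sub (α := ℝ) (k := M) (n := R) (by omega) hMR
      have h4 : (0 : ℝ) ≤ (R : ℝ)⁻¹ := by positivity
      linarith
    · rw [Finset.Ioc_eq_empty (by omega), Finset.sum_empty]; positivity
  have hcard : (((Finset.Ioc M R).biUnion Qp).card : ℝ) ≤ 16 * T ^ (1 - θ) := by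
    calc (((Finset.Ioc M R).biUnion Qp).card : ℝ) ≤ ∑ p ∈ Finset.Ioc M R, ((Qp p).card : ℝ) := by
          exact_mod_cast Finset.card_biUnion_le
      _ ≤ ∑ p ∈ Finset.Ioc M R, 2 * R * ((p : ℝ) ^ 2)⁻¹ := Finset.sum_le_sum fun p _ => hQpc p
      _ = 2 * R * ∑ p ∈ Finset.Ioc M R, ((p : ℝ) ^ 2)⁻¹ := by rw [Finset.mul_sum]
      _ ≤ 2 * (4 * T) * (2 / T ^ θ) := by gcongr
      _ = 16 * T ^ (1 - θ) := by rw [Real.rpow_sub hT0, Real.rpow_one]; ring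
  calc _ ≤ _ := hQ
    _ ≤ 16 * T ^ (1 - θ) * (C * T ^ (1 + θ / 2)) := by gcongr
    _ = 16 * C * (T ^ (1 - θ) * T ^ (1 + θ / 2)) := by ring
    _ = _ := by rw [← Real.rpow_add hT0]; congr 2; ring

theorem card_le_of_progression {s : Finset ℤ} {T : ℝ} {m : ℕ} (hT : 0 ≤ T) (hm : 0 < m) {e : ℤ}
    (hs : ∀ x ∈ s, |(x : ℝ)| ≤ T) (h : ∀ x ∈ s, x ≡ e [ZMOD m]) :
    (s.card : ℝ) ≤ 2 * T / m + 1 :=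
  card_le_of_modEq hT hm hs fun x hx y hy => (h x hx).trans (h y hy).symm

theorem card_pairs_le_of_dvd {p c : ℕ} (hp : p.Prime) (hc : 0 < c) (hpc : p ∣ c) {T δ : ℝ}
    (hδ : 0 < δ) (hδ1 : δ ≤ 1) (hcT : c ≤ T) (hδc : δ * T ≤ c) {e : ℤ} (he : e ^ 2 = 1)
    (X : Finset (ℤ × ℤ)) (hX : ∀ x ∈ X, |(x.1 : ℝ)| ≤ T ∧ |(x.2 : ℝ)| ≤ T ∧
      x.1 * x.2 ≡ 1 [ZMOD c] ∧ x.1 + x.2 ≡ 2 * e [ZMOD p]) :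
    (X.card : ℝ) ≤ 9 * T / (δ * p) := by
  have hc' : (0 : ℝ) < c := by exact_mod_cast hc
  have hT : 0 < T := hc'.trans_le hcT
  have hp0 : (0 : ℝ) < p := by exact_mod_cast hp.pos
  have hpT : (p : ℝ) ≤ T := le_trans (by exact_mod_cast Nat.le_of_dvd hc hpc) hcT
  have h1 : X.card = ∑ a ∈ X.image Prod.fst, (X.filter fun x => x.1 = a).card :=
    Finset.card_eq_sum_card_image _ _
  have h2 : ∀ a ∈ X.image Prod.fst,
      ((X.filter fun x => x.1 = a).card : ℝ) ≤ 2 * T / c + 1 := by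
    intro a _
    have hinj : Set.InjOn Prod.snd (X.filter fun x => x.1 = a : Set (ℤ × ℤ)) := by
      intro x hx y hy hxy
      simp only [Finset.coe_filter, Set.mem_ofPred_eq] at hx hy
      exact Prod.ext (hx.2.trans hy.2.symm) hxy
    rw [← Finset.card_image_of_injOn hinj]
    refine card_le_of_modEq hT.le hc ?_ ?_
    · intro y hy
      obtain ⟨x, hx, rfl⟩ := Finset.mem_image.1 hy
      exact (hX x (Finset.mem_filter.1 hx).1).2.1
    · intro y hy z hz
      obtain ⟨x, hx, rfl⟩ := Finset.mem_image.1 hy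
      obtain ⟨w, hw, rfl⟩ := Finset.mem_image.1 hz
      obtain ⟨hx1, rfl⟩ := Finset.mem_filter.1 hx
      obtain ⟨hw1, hw2⟩ := Finset.mem_filter.1 hw
      have e1 := (hX x hx1).2.2.1
      have e2 := (hX w hw1).2.2.1
      rw [hw2] at e2
      calc x.2 = 1 * x.2 := (one_mul _).symm
        _ ≡ (x.1 * w.2) * x.2 [ZMOD c] := (e2.symm.mul_right _)
        _ = (x.1 * x.2) * w.2 := by ring
        _ ≡ 1 * w.2 [ZMOD c] := e1.mul_right _
        _ = w.2 := one_mul _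
  have h3 : ((X.image Prod.fst).card : ℝ) ≤ 2 * T / p + 1 := by
    refine card_le_of_progression (e := e) hT.le hp.pos ?_ ?_
    · intro y hy
      obtain ⟨x, hx, rfl⟩ := Finset.mem_image.1 hy
      exact (hX x hx).1
    · intro y hy
      obtain ⟨x, hx, rfl⟩ := Finset.mem_image.1 hy
      obtain ⟨-, -, e1, e2⟩ := hX x hx
      have e1' : (p : ℤ) ∣ 1 - x.1 * x.2 :=
        (Int.natCast_dvd_natCast.2 hpc).trans e1.dvd
      have e2' : (p : ℤ) ∣ 2 * e - (x.1 + x.2) := e2.dvd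
      have e3 : (p : ℤ) ∣ (e - x.1) ^ 2 := by
        have : (e - x.1) ^ 2 = (1 - x.1 * x.2) - x.1 * (2 * e - (x.1 + x.2)) := by
          linear_combination he
        rw [this]
        exact dvd_sub e1' (e2'.mul_left _)
      exact Int.modEq_iff_dvd.2 ((Nat.prime_iff_prime_int.1 hp).dvd_of_dvd_pow e3)
  have h4 : (X.card : ℝ) ≤ (2 * T / p + 1) * (2 * T / c + 1) := by
    calc (X.card : ℝ) = ∑ a ∈ X.image Prod.fst, ((X.filter fun x => x.1 = a).card : ℝ) := by
          exact_mod_cast h1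
      _ ≤ ∑ a ∈ X.image Prod.fst, (2 * T / c + 1) := Finset.sum_le_sum h2
      _ = (X.image Prod.fst).card * (2 * T / c + 1) := by rw [Finset.sum_const, nsmul_eq_mul]
      _ ≤ _ := by gcongr
  have h5 : T / c ≤ 1 / δ := by
    rw [div_le_div_iff₀ hc' hδ]; linarith
  have h6 : 1 ≤ 1 / δ := by rw [le_div_iff₀ hδ]; linarith
  have h7 : 1 ≤ T / p := by rw [le_div_iff₀ hp0]; linarith
  calc (X.card : ℝ) ≤ (2 * T / p + 1) * (2 * T / c + 1) := h4
    _ = (2 * (T / p) + 1) * (2 * (T / c) + 1) := by ring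
    _ ≤ (3 * (T / p)) * (3 * (1 / δ)) := by gcongr <;> linarith
    _ = _ := by field_simp; ring

theorem exists_card_pairs_le_of_coprime : ∃ C : ℝ, 1 ≤ C ∧ ∀ (m c : ℕ) (T δ : ℝ) (s : ℤ),
    0 < m → 0 < c → m.Coprime c → 0 < δ → δ ≤ 1 → c ≤ T → δ * T ≤ c → ∀ X : Finset (ℤ × ℤ),
    (∀ x ∈ X, |(x.1 : ℝ)| ≤ T ∧ |(x.2 : ℝ)| ≤ T ∧
      x.1 * x.2 ≡ 1 [ZMOD c] ∧ x.1 + x.2 ≡ s [ZMOD m]) →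
    (X.card : ℝ) ≤ 9 * T / (δ * m) + 7 * C / δ * m * T ^ (7 / 8 : ℝ) := by
  classical
  obtain ⟨C, hC, h⟩ := exists_abs_apCount_sub_le
  refine ⟨C, hC, fun m c T δ s hm hc hmc hδ hδ1 hcT hδc X hX => ?_⟩
  have hc' : (0 : ℝ) < c := by exact_mod_cast hc
  have hm' : (0 : ℝ) < m := by exact_mod_cast hm
  have hc1 : (1 : ℝ) ≤ c := by exact_mod_cast hc
  have hT : 0 < T := hc'.trans_le hcT
  have hT1 : 1 ≤ T := hc1.trans hcT
  set k := ⌊T⌋₊ with hk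
  have hkT : (k : ℝ) ≤ T := Nat.floor_le hT.le
  set L := 2 * k + 1 with hL
  have hLT : (L : ℝ) ≤ 3 * T := by rw [hL]; push_cast; linarith
  have hbox : ∀ x : ℤ, |(x : ℝ)| ≤ T → x ∈ Finset.Ico (-(k : ℤ)) (-(k : ℤ) + L) := by
    intro x hx
    have : x.natAbs ≤ k := Nat.le_floor (by rw [Nat.cast_natAbs]; push_cast; exact hx)
    rw [Finset.mem_Ico, hL]
    push_cast
    omega
  have hsub : X.card ≤ ∑ a₀ ∈ Finset.range m, apCount c m a₀ (s - a₀) (-k) (-k) L L := by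
    refine (Finset.card_le_card fun x hx => ?_).trans Finset.card_biUnion_le
    obtain ⟨h1, h2, h3, h4⟩ := hX x hx
    have hm0 : (0 : ℤ) < m := by exact_mod_cast hm
    have hmod : ((x.1 % m).toNat : ℤ) = x.1 % m := Int.toNat_of_nonneg (Int.emod_nonneg _ hm0.ne')
    have hx1 : x.1 ≡ ((x.1 % m).toNat : ℤ) [ZMOD m] := by
      rw [hmod]; exact (Int.mod_modEq _ _).symm
    refine Finset.mem_biUnion.2 ⟨(x.1 % m).toNat, ?_, ?_⟩
    · rw [Finset.mem_range]
      have := Int.emod_lt_of_pos x.1 hm0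
      omega
    · refine Finset.mem_filter.2 ⟨Finset.mem_product.2 ⟨hbox _ h1, hbox _ h2⟩, hx1, ?_, h3⟩
      have := h4.sub hx1
      rwa [add_sub_cancel_left] at this
  have hap : ∀ a₀ : ℤ, (apCount c m a₀ (s - a₀) (-k) (-k) L L : ℝ) ≤
      9 * T / (δ * (m : ℝ) ^ 2) + 7 * C / δ * T ^ (7 / 8 : ℝ) := by
    intro a₀
    have h1 := (abs_le.1 (h c m hc hm hmc a₀ (s - a₀) (-k) (-k) L L)).2
    have h2 : (c.totient : ℝ) / ((c : ℝ) ^ 2 * (m : ℝ) ^ 2) * (L * L) ≤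
        9 * T / (δ * (m : ℝ) ^ 2) := by
      have : (c.totient : ℝ) ≤ c := by exact_mod_cast Nat.totient_le c
      calc (c.totient : ℝ) / ((c : ℝ) ^ 2 * (m : ℝ) ^ 2) * (L * L)
          ≤ c / ((c : ℝ) ^ 2 * (m : ℝ) ^ 2) * ((3 * T) * (3 * T)) := by gcongr
        _ = 9 * T * T / (c * (m : ℝ) ^ 2) := by field_simp; ring
        _ ≤ 9 * T * (c / δ) / (c * (m : ℝ) ^ 2) := by
          gcongr
          rw [le_div_iff₀ hδ]; linarith
        _ = _ := by field_simp
    have h3 : C * (c : ℝ) ^ (7 / 8 : ℝ) * (1 + (L + L) / c) ≤ 7 * C / δ * T ^ (7 / 8 : ℝ) := by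
      have h4 : (1 : ℝ) + (L + L) / c ≤ 7 / δ := by
        have h5 : (L + L : ℝ) / c ≤ 6 / δ := by
          rw [div_le_div_iff₀ hc' hδ]
          nlinarith
        have h6 : 1 ≤ 1 / δ := by rw [le_div_iff₀ hδ]; linarith
        have : 7 / δ = 1 / δ + 6 / δ := by ring
        linarith
      calc C * (c : ℝ) ^ (7 / 8 : ℝ) * (1 + (L + L) / c) ≤
          C * T ^ (7 / 8 : ℝ) * (7 / δ) := by gcongr
        _ = _ := by ring
    linarith
  calc (X.card : ℝ) ≤ ∑ a₀ ∈ Finset.range m, (apCount c m a₀ (s - a₀) (-k) (-k) L L : ℝ) := by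
        exact_mod_cast hsub
    _ ≤ ∑ _a₀ ∈ Finset.range m,
        (9 * T / (δ * (m : ℝ) ^ 2) + 7 * C / δ * T ^ (7 / 8 : ℝ)) :=
      Finset.sum_le_sum fun a₀ _ => hap a₀
    _ = _ := by
      rw [Finset.sum_const, Finset.card_range, nsmul_eq_mul]
      field_simp

theorem cnt_le_sum_of_pos {S : Set SL2Z} {T : ℝ} (hS : ∀ γ ∈ S, 0 < γ 1 0)
    (K : ℕ → ℝ) (hK : ∀ c ∈ Finset.Ioc 0 ⌊T⌋₊, ∀ X : Finset (ℤ × ℤ),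
      (∀ x ∈ X, ∃ γ ∈ S, frobNorm γ ≤ T ∧ γ 1 0 = c ∧ γ 0 0 = x.1 ∧ γ 1 1 = x.2) →
      (X.card : ℝ) ≤ K c) :
    (cnt S T : ℝ) ≤ ∑ c ∈ Finset.Ioc 0 ⌊T⌋₊, K c := by
  classical
  set F := (ballF T).filter (· ∈ S) with hF
  have hFS : ∀ γ ∈ F, γ ∈ S ∧ frobNorm γ ≤ T := fun γ hγ =>
    ⟨(Finset.mem_filter.1 hγ).2, mem_ballF.1 (Finset.mem_filter.1 hγ).1⟩
  have hcnt : cnt S T = F.card := by unfold cnt; congr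
  have h1 := Finset.card_eq_sum_card_fiberwise (f := fun γ : SL2Z => (γ 1 0).natAbs) (s := F)
    (t := Finset.Ioc 0 ⌊T⌋₊) fun γ hγ => by
      have hγ' := hFS γ hγ
      simp only [Finset.coe_Ioc, Set.mem_Ioc]
      refine ⟨Int.natAbs_pos.2 (hS γ hγ'.1).ne', Nat.le_floor ?_⟩
      rw [Nat.cast_natAbs]; push_cast
      exact abs_entry_le hγ'.2 1 0
  rw [hcnt, h1]
  push_cast
  refine Finset.sum_le_sum fun c hc => ?_
  have hcF : ∀ γ ∈ F.filter (fun γ : SL2Z => (γ 1 0).natAbs = c), γ ∈ F ∧ γ 1 0 = c := by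
    intro γ hγ
    obtain ⟨h2, h3⟩ := Finset.mem_filter.1 hγ
    have := hS γ (hFS γ h2).1
    exact ⟨h2, by omega⟩
  have hinj : Set.InjOn (fun γ : SL2Z => (γ 0 0, γ 1 1))
      (F.filter fun γ : SL2Z => (γ 1 0).natAbs = c : Finset SL2Z) := by
    intro γ hγ γ' hγ' h
    obtain ⟨h2, h3⟩ := hcF γ hγ
    obtain ⟨h4, h5⟩ := hcF γ' hγ'
    simp only [Prod.mk.injEq] at h
    refine SL2Z_ext h.1 ?_ (h3.trans h5.symm) h.2
    have d1 := det_entries γ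
    have d2 := det_entries γ'
    have hc0 : γ' 1 0 ≠ 0 := (hS γ' (hFS γ' h4).1).ne'
    rw [h.1, h.2, h3.trans h5.symm] at d1
    exact mul_right_cancel₀ hc0 (by linarith)
  rw [← Finset.card_image_of_injOn hinj]
  refine hK c hc _ fun x hx => ?_
  obtain ⟨γ, hγ, rfl⟩ := Finset.mem_image.1 hx
  obtain ⟨h2, h3⟩ := hcF γ hγ
  exact ⟨γ, (hFS γ h2).1, (hFS γ h2).2, h3, rfl, rfl⟩

theorem exists_cnt_sq_dvd_le : ∃ C : ℝ, 1 ≤ C ∧ ∀ (p : ℕ) (T δ : ℝ) (e : ℤ), p.Prime → 1 ≤ T →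
    0 < δ → δ ≤ 1 → e ^ 2 = 1 →
    (cnt {γ | δ * T < γ 1 0 ∧ (p : ℤ) ^ 2 ∣ trZ γ - 2 * e} T : ℝ) ≤
      18 / δ * T ^ 2 * ((p : ℝ) ^ 2)⁻¹ + 7 * C / δ * (p : ℝ) ^ 2 * T ^ (15 / 8 : ℝ) := by
  obtain ⟨C, hC, h⟩ := exists_card_pairs_le_of_coprime
  refine ⟨C, hC, fun p T δ e hp hT hδ hδ1 he => ?_⟩
  have hT0 : 0 < T := by linarith
  have hp0 : (0 : ℝ) < p := by exact_mod_cast hp.pos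
  set K₁ : ℝ := 9 * T / (δ * p) with hK₁
  set K₂ : ℝ := 9 * T / (δ * (p ^ 2 : ℕ)) + 7 * C / δ * (p ^ 2 : ℕ) * T ^ (7 / 8 : ℝ) with hK₂
  have hK₁0 : 0 ≤ K₁ := by positivity
  have hK₂0 : 0 ≤ K₂ := by positivity
  have h1 := cnt_le_sum_of_pos (S := {γ | δ * T < γ 1 0 ∧ (p : ℤ) ^ 2 ∣ trZ γ - 2 * e})
    (fun γ hγ => by
      have : (0 : ℝ) < γ 1 0 := (mul_pos hδ hT0).trans hγ.1
      exact_mod_cast this)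
    (fun c => (if p ∣ c then K₁ else 0) + K₂) (by
      intro c hc X hX
      obtain ⟨hc0, hcT⟩ := Finset.mem_Ioc.1 hc
      have hcT' : (c : ℝ) ≤ T := (Nat.le_floor_iff hT0.le).1 hcT
      rcases X.eq_empty_or_nonempty with rfl | ⟨x₀, hx₀⟩
      · simp only [Finset.card_empty, Nat.cast_zero]
        split_ifs <;> linarith
      have hδc : δ * T ≤ c := by
        obtain ⟨γ, hγS, -, hγc, -⟩ := hX x₀ hx₀
        have := hγS.1
        rw [hγc] at this
        exact_mod_cast this.le
      have hX' : ∀ x ∈ X, |(x.1 : ℝ)| ≤ T ∧ |(x.2 : ℝ)| ≤ T ∧ x.1 * x.2 ≡ 1 [ZMOD c] ∧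
          x.1 + x.2 ≡ 2 * e [ZMOD (p ^ 2 : ℕ)] := by
        intro x hx
        obtain ⟨γ, hγS, hγT, hγc, e1, e2⟩ := hX x hx
        rw [← e1, ← e2]
        refine ⟨abs_entry_le hγT 0 0, abs_entry_le hγT 1 1, ?_, ?_⟩
        · have := det_entries γ
          rw [hγc] at this
          rw [Int.modEq_iff_dvd]
          exact ⟨-γ 0 1, by linear_combination -this⟩
        · refine (Int.modEq_iff_dvd.2 ?_).symm
          push_cast
          exact hγS.2
      by_cases hpc : p ∣ c
      · rw [if_pos hpc]
        have := card_pairs_le_of_dvd hp hc0 hpc hδ hδ1 hcT' hδc he X fun x hx => by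
          obtain ⟨e1, e2, e3, e4⟩ := hX' x hx
          refine ⟨e1, e2, e3, e4.of_dvd ?_⟩
          exact_mod_cast dvd_pow_self p two_ne_zero
        linarith
      · rw [if_neg hpc, zero_add]
        exact h _ c T δ (2 * e) (pow_pos hp.pos 2) hc0
          (Nat.Coprime.pow_left 2 ((Nat.Prime.coprime_iff_not_dvd hp).2 hpc)) hδ hδ1 hcT' hδc X hX')
  refine h1.trans ?_
  rw [Finset.sum_add_distrib, ← Finset.sum_filter, Finset.sum_const, Finset.sum_const, nsmul_eq_mul,
    nsmul_eq_mul, Nat.card_Ioc, Nat.sub_zero]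
  have h2 := card_filter_dvd_le (m := p) hT0.le
  have h3 : (⌊T⌋₊ : ℝ) ≤ T := Nat.floor_le hT0.le
  have h4 : T * T ^ (7 / 8 : ℝ) = T ^ (15 / 8 : ℝ) := by
    nth_rewrite 1 [← Real.rpow_one T]
    rw [← Real.rpow_add hT0]; norm_num
  calc _ ≤ T / p * K₁ + T * K₂ := by gcongr
    _ = 18 / δ * T ^ 2 * ((p : ℝ) ^ 2)⁻¹ + 7 * C / δ * (p : ℝ) ^ 2 * (T * T ^ (7 / 8 : ℝ)) := by
      rw [hK₁, hK₂]; push_cast; field_simp; ring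
    _ = _ := by rw [h4]

theorem cnt_biUnion_le {ι : Type*} (I : Finset ι) (S : ι → Set SL2Z) (T : ℝ) :
    cnt {γ | ∃ i ∈ I, γ ∈ S i} T ≤ ∑ i ∈ I, cnt (S i) T := by
  classical
  induction I using Finset.induction_on with
  | empty => simp [cnt]
  | insert a I ha ih =>
    rw [Finset.sum_insert ha]
    have : {γ | ∃ i ∈ insert a I, γ ∈ S i} = S a ∪ {γ | ∃ i ∈ I, γ ∈ S i} := by
      ext γ; simp
    rw [this]
    exact (cnt_union_le _ _ _).trans (by gcongr)

theorem trZ_neg (γ : SL2Z) : trZ (-γ) = -trZ γ := by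
  have h : ∀ i j, (-γ) i j = -γ i j := fun i j => rfl
  simp only [trZ, h]; ring

/-- Traces congruent to `2e` modulo the square of a prime of moderate size are rare. -/
theorem exists_eventually_cnt_medium_le {δ ε : ℝ} (hδ : 0 < δ) (hδ1 : δ ≤ 1) (hε : 0 < ε) :
    ∃ P : ℕ, ∀ e : ℤ, e ^ 2 = 1 → ∀ᶠ T : ℝ in atTop,
      (cnt {γ | δ * T < γ 1 0 ∧ ∃ p : ℕ, p.Prime ∧ P < p ∧ (p : ℝ) ≤ T ^ (1 / 32 : ℝ) ∧
        (p : ℤ) ^ 2 ∣ trZ γ - 2 * e} T : ℝ) ≤ ε * T ^ 2 := by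
  classical
  obtain ⟨C, hC, h⟩ := exists_cnt_sq_dvd_le
  set P := ⌈36 / (δ * ε)⌉₊ with hP
  have hP1 : 36 / (δ * ε) ≤ P := Nat.le_ceil _
  have hP0 : (0 : ℝ) < P := (by positivity : (0 : ℝ) < 36 / (δ * ε)).trans_le hP1
  refine ⟨P, fun e he => ?_⟩
  filter_upwards [eventually_mul_rpow_le (7 * C / δ) (half_pos hε) (r := 63 / 32) (s := 2)
    (by norm_num), eventually_ge_atTop 1] with T h1 hT
  rw [Real.rpow_two] at h1
  have hT0 : 0 < T := by linarith
  set Θ := T ^ (1 / 32 : ℝ) with hΘ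
  have hΘ0 : 0 < Θ := Real.rpow_pos_of_pos hT0 _
  set R := ⌊Θ⌋₊ with hR
  have hRΘ : (R : ℝ) ≤ Θ := Nat.floor_le hΘ0.le
  set I := (Finset.Ioc P R).filter Nat.Prime with hI
  have hsub : cnt {γ | δ * T < γ 1 0 ∧ ∃ p : ℕ, p.Prime ∧ P < p ∧ (p : ℝ) ≤ Θ ∧
        (p : ℤ) ^ 2 ∣ trZ γ - 2 * e} T ≤
      ∑ p ∈ I, cnt {γ | δ * T < γ 1 0 ∧ (p : ℤ) ^ 2 ∣ trZ γ - 2 * e} T := by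
    refine le_trans (cnt_mono ?_) (cnt_biUnion_le I _ T)
    rintro γ ⟨h2, p, h3, h4, h5, h6⟩ -
    exact ⟨p, Finset.mem_filter.2 ⟨Finset.mem_Ioc.2 ⟨h4, Nat.le_floor h5⟩, h3⟩, h2, h6⟩
  have hsum : ∑ p ∈ I, ((p : ℝ) ^ 2)⁻¹ ≤ (P : ℝ)⁻¹ := by
    refine (Finset.sum_le_sum_of_subset_of_nonneg (Finset.filter_subset _ _)
      fun _ _ _ => by positivity).trans ?_
    by_cases hPR : P ≤ R
    · have h3 := sum_Ioc_inv_sq_le_sub (α := ℝ) (k := P) (n := R)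
        (by exact_mod_cast hP0.ne') hPR
      have h4 : (0 : ℝ) ≤ (R : ℝ)⁻¹ := by positivity
      linarith
    · rw [Finset.Ioc_eq_empty (by omega), Finset.sum_empty]; positivity
  have hIc : (I.card : ℝ) ≤ Θ := by
    refine le_trans ?_ hRΘ
    have : I.card ≤ R := (Finset.card_filter_le _ _).trans (by simp)
    exact_mod_cast this
  have hPinv : 18 / δ * (P : ℝ)⁻¹ ≤ ε / 2 := by
    rw [← div_eq_mul_inv, div_le_iff₀ hP0]
    calc 18 / δ = ε / 2 * (36 / (δ * ε)) := by field_simp; norm_num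
      _ ≤ _ := by gcongr
  have hΘ3 : Θ * Θ ^ 2 * T ^ (15 / 8 : ℝ) = T ^ (63 / 32 : ℝ) := by
    have h3 : Θ * Θ ^ 2 = Θ ^ (3 : ℝ) := by
      rw [show (3 : ℝ) = (3 : ℕ) by norm_num, Real.rpow_natCast]; ring
    rw [h3, hΘ, ← Real.rpow_mul hT0.le, ← Real.rpow_add hT0]
    norm_num
  calc _ ≤ ∑ p ∈ I, (cnt {γ | δ * T < γ 1 0 ∧ (p : ℤ) ^ 2 ∣ trZ γ - 2 * e} T : ℝ) := by
        exact_mod_cast hsub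
    _ ≤ ∑ p ∈ I, (18 / δ * T ^ 2 * ((p : ℝ) ^ 2)⁻¹ + 7 * C / δ * Θ ^ 2 * T ^ (15 / 8 : ℝ)) := by
        refine Finset.sum_le_sum fun p hp => ?_
        obtain ⟨hp1, hp2⟩ := Finset.mem_filter.1 hp
        refine (h p T δ e hp2 hT hδ hδ1 he).trans ?_
        have : (p : ℝ) ≤ Θ := le_trans (by exact_mod_cast (Finset.mem_Ioc.1 hp1).2) hRΘ
        gcongr
    _ = 18 / δ * T ^ 2 * ∑ p ∈ I, ((p : ℝ) ^ 2)⁻¹ +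
        I.card * (7 * C / δ * Θ ^ 2 * T ^ (15 / 8 : ℝ)) := by
        rw [Finset.sum_add_distrib, Finset.mul_sum, Finset.sum_const, nsmul_eq_mul]
    _ ≤ 18 / δ * T ^ 2 * (P : ℝ)⁻¹ + Θ * (7 * C / δ * Θ ^ 2 * T ^ (15 / 8 : ℝ)) := by gcongr
    _ = 18 / δ * (P : ℝ)⁻¹ * T ^ 2 + 7 * C / δ * (Θ * Θ ^ 2 * T ^ (15 / 8 : ℝ)) := by ring
    _ ≤ ε / 2 * T ^ 2 + ε / 2 * T ^ 2 := by rw [hΘ3]; gcongr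
    _ = _ := by ring

theorem sq_dvd_sub_or_add {p : ℕ} (hp : p.Prime) (hp2 : 2 < p) {t : ℤ}
    (h : (p : ℤ) ^ 2 ∣ t ^ 2 - 4) : (p : ℤ) ^ 2 ∣ t - 2 * 1 ∨ (p : ℤ) ^ 2 ∣ t - 2 * -1 := by
  have hp' := Nat.prime_iff_prime_int.1 hp
  rw [show t ^ 2 - 4 = (t - 2 * 1) * (t - 2 * -1) by ring] at h
  by_cases h1 : (p : ℤ) ∣ t - 2 * 1
  · have h2 : ¬ (p : ℤ) ∣ t - 2 * -1 := by
      intro h2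
      have h3 : (p : ℤ) ∣ 4 := by
        have := dvd_sub h2 h1
        ring_nf at this; exact this
      have h4 : p ∣ 2 ^ 2 := by exact_mod_cast h3
      have := Nat.le_of_dvd two_pos (hp.dvd_of_dvd_pow h4)
      omega
    exact Or.inl ((IsCoprime.pow_left ((Prime.coprime_iff_not_dvd hp').2 h2)).dvd_of_dvd_mul_right h)
  · exact Or.inr ((IsCoprime.pow_left ((Prime.coprime_iff_not_dvd hp').2 h1)).dvd_of_dvd_mul_left h)

/-- Few matrices have trace `t` with `t² - 4` divisible by the square of a large prime. -/
theorem exists_eventually_cnt_tail_le {ε : ℝ} (hε : 0 < ε) : ∃ P : ℕ, ∀ᶠ T : ℝ in atTop,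
    (cnt {γ | 2 < |trZ γ| ∧ ∃ p : ℕ, p.Prime ∧ P < p ∧ (p : ℤ) ^ 2 ∣ trZ γ ^ 2 - 4} T : ℝ) ≤
      ε * T ^ 2 := by
  set σ : ℝ := min 1 (ε / 7 / 300) with hσ
  have hσ0 : 0 < σ := lt_min one_pos (by positivity)
  have hσ1 : σ ≤ 1 := min_le_left _ _
  have hσ2 : 300 * σ ≤ ε / 7 := by
    have : σ ≤ ε / 7 / 300 := min_le_right _ _
    linarith
  have hδ0 : 0 < σ ^ 2 := by positivity
  have hδ1 : σ ^ 2 ≤ 1 := pow_le_one₀ hσ0.le hσ1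
  have hε7 : 0 < ε / 7 := by positivity
  obtain ⟨P, hP⟩ := exists_eventually_cnt_medium_le hδ0 hδ1 hε7
  refine ⟨max P 2, ?_⟩
  have hlarge : ∀ e : ℤ, e ^ 2 = 1 → ∀ᶠ T : ℝ in atTop,
      (cnt {γ | trZ γ ≠ 2 * e ∧ ∃ p : ℕ, T ^ (1 / 32 : ℝ) < p ∧ (p : ℤ) ^ 2 ∣ trZ γ - 2 * e} T : ℝ)
        ≤ ε / 7 * T ^ 2 := fun e he => by
    refine eventually_cnt_large_le ?_ (by norm_num) hε7
    rcases sq_eq_one_iff.1 he with rfl | rfl <;> norm_num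
  filter_upwards [hP 1 (by norm_num), hP (-1) (by norm_num), hlarge 1 (by norm_num),
    hlarge (-1) (by norm_num), eventually_ge_atTop (1 / σ), eventually_ge_atTop 1]
    with T h1 h2 h3 h4 h5 h6
  have h7 := cnt_abs_le_le hσ0 hσ1 h5
  have h8 : 300 * σ * T ^ 2 ≤ ε / 7 * T ^ 2 := by gcongr
  set M : ℤ → Set SL2Z := fun e => {γ | σ ^ 2 * T < γ 1 0 ∧ ∃ p : ℕ, p.Prime ∧ P < p ∧
    (p : ℝ) ≤ T ^ (1 / 32 : ℝ) ∧ (p : ℤ) ^ 2 ∣ trZ γ - 2 * e} with hM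
  set L : ℤ → Set SL2Z := fun e => {γ | trZ γ ≠ 2 * e ∧ ∃ p : ℕ, T ^ (1 / 32 : ℝ) < p ∧
    (p : ℤ) ^ 2 ∣ trZ γ - 2 * e} with hL
  have hneg : ∀ e, cnt ((Equiv.neg SL2Z) ⁻¹' M e) T = cnt (M e) T :=
    fun e => cnt_preimage_equiv (Equiv.neg SL2Z) frobNorm_neg _ _
  set Z : Set SL2Z := {γ | |(γ 1 0 : ℝ)| ≤ σ ^ 2 * T} with hZ
  have hcase : ∀ (e : ℤ) (γ : SL2Z) (p : ℕ), p.Prime → P < p → 2 < |trZ γ| → e ^ 2 = 1 →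
      (p : ℤ) ^ 2 ∣ trZ γ - 2 * e → γ ∈ Z ∨ γ ∈ M e ∨ γ ∈ (Equiv.neg SL2Z) ⁻¹' M (-e) ∨ γ ∈ L e := by
    intro e γ p hp hPp ht he hdvd
    by_cases hz : γ ∈ Z
    · exact Or.inl hz
    by_cases hpT : (p : ℝ) ≤ T ^ (1 / 32 : ℝ)
    · simp only [hZ, Set.mem_ofPred_eq, not_le, lt_abs] at hz
      rcases hz with hz | hz
      · exact Or.inr (Or.inl ⟨hz, p, hp, hPp, hpT, hdvd⟩)
      · refine Or.inr (Or.inr (Or.inl ⟨?_, p, hp, hPp, hpT, ?_⟩))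
        · change _ < (((-γ 1 0 : ℤ)) : ℝ)
          push_cast; exact hz
        · rw [Equiv.neg_apply, trZ_neg, show -trZ γ - 2 * -e = -(trZ γ - 2 * e) by ring, dvd_neg]
          exact hdvd
    · refine Or.inr (Or.inr (Or.inr ⟨?_, p, not_le.1 hpT, hdvd⟩))
      intro h
      rw [h] at ht
      rcases sq_eq_one_iff.1 he with rfl | rfl <;> norm_num at ht
  have hsub : cnt {γ | 2 < |trZ γ| ∧ ∃ p : ℕ, p.Prime ∧ max P 2 < p ∧
      (p : ℤ) ^ 2 ∣ trZ γ ^ 2 - 4} T ≤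
      cnt (Z ∪ ((M 1 ∪ ((Equiv.neg SL2Z) ⁻¹' M (-1) ∪ L 1)) ∪
        (M (-1) ∪ ((Equiv.neg SL2Z) ⁻¹' M 1 ∪ L (-1))))) T := by
    refine cnt_mono ?_
    rintro γ ⟨ht, p, hp, hPp, hdvd⟩ -
    simp only [Set.mem_union]
    have hP1 : P < p := (le_max_left _ _).trans_lt hPp
    rcases sq_dvd_sub_or_add hp ((le_max_right _ _).trans_lt hPp) hdvd with h | h
    · have := hcase 1 γ p hp hP1 ht (by norm_num) h
      tauto
    · have := hcase (-1) γ p hp hP1 ht (by norm_num) h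
      rw [neg_neg] at this
      tauto
  have hunion := hsub.trans ((cnt_union_le _ _ T).trans (Nat.add_le_add_left
    ((cnt_union_le _ _ T).trans (Nat.add_le_add
      ((cnt_union_le _ _ T).trans (Nat.add_le_add_left (cnt_union_le _ _ T) _))
      ((cnt_union_le _ _ T).trans (Nat.add_le_add_left (cnt_union_le _ _ T) _)))) _))
  rw [hneg, hneg] at hunion
  have hunion' : (cnt {γ | 2 < |trZ γ| ∧ ∃ p : ℕ, p.Prime ∧ max P 2 < p ∧
      (p : ℤ) ^ 2 ∣ trZ γ ^ 2 - 4} T : ℝ) ≤ cnt Z T + ((cnt (M 1) T + (cnt (M (-1)) T +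
        cnt (L 1) T)) + (cnt (M (-1)) T + (cnt (M 1) T + cnt (L (-1)) T))) := by
    exact_mod_cast hunion
  refine hunion'.trans ?_
  change (cnt (M 1) T : ℝ) ≤ _ at h1
  change (cnt (M (-1)) T : ℝ) ≤ _ at h2
  change (cnt (L 1) T : ℝ) ≤ _ at h3
  change (cnt (L (-1)) T : ℝ) ≤ _ at h4
  linarith

/-! ### Maximality of the multiplier order at a prime -/

theorem natCast_dvd_uGamma_iff {k : ℤ} {γ : SL2Z} :
    k ∣ (uGamma γ : ℤ) ↔ k ∣ γ 1 0 ∧ k ∣ γ 1 1 - γ 0 0 ∧ k ∣ γ 0 1 := by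
  unfold uGamma
  rw [Int.dvd_coe_gcd_iff, Int.dvd_coe_gcd_iff]

theorem trZ_sq_sub_four (γ : SL2Z) :
    trZ γ ^ 2 - 4 = (γ 1 1 - γ 0 0) ^ 2 + 4 * (γ 0 1 * γ 1 0) := by
  have := det_entries γ
  unfold trZ
  linear_combination 4 * this

theorem int_sq_emod_four (x : ℤ) : x ^ 2 % 4 = 0 ∨ x ^ 2 % 4 = 1 := by
  rcases Int.even_or_odd' x with ⟨k, rfl | rfl⟩
  · left; ring_nf; omega
  · right; ring_nf; omega

theorem exists_disc_eq (γ : SL2Z) :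
    ∃ n : ℤ, (n % 4 = 0 ∨ n % 4 = 1) ∧ trZ γ ^ 2 - 4 = (uGamma γ : ℤ) ^ 2 * n := by
  obtain ⟨⟨x, hx⟩, ⟨y, hy⟩, ⟨z, hz⟩⟩ := natCast_dvd_uGamma_iff.1 (dvd_refl (uGamma γ : ℤ))
  refine ⟨y ^ 2 + 4 * (z * x), ?_, ?_⟩
  · have := int_sq_emod_four y
    omega
  · rw [trZ_sq_sub_four, hy, hz, hx]; ring

theorem disc_pos {γ : SL2Z} (h : 2 < |trZ γ|) : 0 < trZ γ ^ 2 - 4 := by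
  have : 2 ^ 2 < trZ γ ^ 2 := by rw [← sq_abs (trZ γ)]; gcongr
  linarith

theorem uGamma_pos {γ : SL2Z} (h : 2 < |trZ γ|) : 0 < uGamma γ := by
  obtain ⟨n, -, hn⟩ := exists_disc_eq γ
  have := disc_pos h
  refine Nat.pos_of_ne_zero fun h0 => ?_
  rw [hn, h0] at this
  simp at this

/-- The order of discriminant `(t² - 4) / u²` is not maximal at `p`. -/
def NotMaximalAt (p : ℕ) (γ : SL2Z) : Prop :=
  ∃ n : ℤ, (n % 4 = 0 ∨ n % 4 = 1) ∧ trZ γ ^ 2 - 4 = (p * uGamma γ : ℤ) ^ 2 * n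

theorem not_isSquare_disc {γ : SL2Z} (h : 2 < |trZ γ|) (k : ℤ) : trZ γ ^ 2 - 4 ≠ k ^ 2 := by
  intro hk
  rw [← sq_abs (trZ γ), ← sq_abs k] at hk
  have h0 := abs_nonneg k
  have h1 : |k| < |trZ γ| := by nlinarith
  have h2 : |k| ≤ |trZ γ| - 1 := by linarith
  nlinarith

theorem conductorOne_iff {γ : SL2Z} (h : 2 < |trZ γ|) :
    ConductorOne γ ↔ ∀ p : ℕ, p.Prime → ¬ NotMaximalAt p γ := by
  have hu := uGamma_pos h
  have hu' : (0 : ℤ) < uGamma γ := by exact_mod_cast hu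
  have hu2 : (uGamma γ : ℤ) ^ 2 ≠ 0 := by positivity
  constructor
  · rintro ⟨mm, D, hmm, hD, hsq, heq, hif⟩ p hp ⟨n, hn, hbad⟩
    have hp' := Nat.prime_iff_prime_int.1 hp
    have hno : ¬ (p : ℤ) ^ 2 ∣ D := by
      intro hd
      have := hsq p (by rwa [← sq])
      exact hp'.not_isUnit this
    by_cases hD4 : D % 4 = 1
    · rw [if_pos hD4] at hif
      refine hno ⟨n, mul_left_cancel₀ hu2 ?_⟩
      rw [hif] at heq
      linear_combination hbad - heq
    · rw [if_neg hD4] at hif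
      have h4 : 4 * D = (p : ℤ) ^ 2 * n := by
        refine mul_left_cancel₀ hu2 ?_
        rw [hif] at heq
        linear_combination hbad - heq
      by_cases hp2 : p = 2
      · subst hp2
        have hDn : D = n := by push_cast at h4; linarith
        rcases hn with hn | hn
        · refine hno ?_
          rw [hDn]; push_cast
          exact Int.dvd_of_emod_eq_zero hn
        · exact hD4 (hDn ▸ hn)
      · refine hno (IsCoprime.dvd_of_dvd_mul_left (y := 4) ?_ ⟨n, h4⟩)
        have : Nat.Coprime (p ^ 2) (2 ^ 2) :=
          Nat.Coprime.pow 2 2 ((Nat.coprime_primes hp Nat.prime_two).2 hp2)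
        exact_mod_cast Nat.isCoprime_iff_coprime.2 this
  · intro hall
    obtain ⟨Δ, hΔ4, hΔ⟩ := exists_disc_eq γ
    have hΔpos : 0 < Δ := by
      have := disc_pos h
      rw [hΔ] at this
      exact pos_of_mul_pos_right this (by positivity)
    obtain ⟨D, k, hD, hk, hDk, hsq⟩ :=
      Nat.sq_mul_squarefree_of_pos (Int.natAbs_pos.2 hΔpos.ne')
    have hΔk : Δ = (k : ℤ) ^ 2 * D := by
      have : (Δ.natAbs : ℤ) = Δ := Int.natAbs_of_nonneg hΔpos.le
      rw [← this, ← hDk]; push_cast; ring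
    have hD1 : D ≠ 1 := by
      rintro rfl
      refine not_isSquare_disc h (uGamma γ * k) ?_
      rw [hΔ, hΔk]; push_cast; ring
    have hbad : ∀ p : ℕ, p.Prime → ∀ k' : ℤ, (k : ℤ) = p * k' →
        ¬ ((k' ^ 2 * D) % 4 = 0 ∨ (k' ^ 2 * D) % 4 = 1) := by
      intro p hp k' hk' h4
      refine hall p hp ⟨k' ^ 2 * D, h4, ?_⟩
      rw [hΔ, hΔk, hk']; ring
    have hsqZ : Squarefree (D : ℤ) := Int.squarefree_natCast.2 hsq
    have hD0 : (1 : ℤ) < D := by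
      have : 1 < D := by omega
      exact_mod_cast this
    by_cases hD4 : (D : ℤ) % 4 = 1
    · have hk1 : k = 1 := by
        by_contra hk1
        obtain ⟨p, hp, k', rfl⟩ := Nat.exists_prime_and_dvd hk1
        refine hbad p hp k' (by push_cast; ring) ?_
        rcases int_sq_emod_four (k' : ℤ) with h' | h' <;> rw [Int.mul_emod, h', hD4] <;> simp
      refine ⟨uGamma γ, D, hu', hD0, hsqZ, ?_, by rw [if_pos hD4]⟩
      rw [hΔ, hΔk, hk1]; push_cast; ring
    · have hD40 : ¬ (D : ℤ) % 4 = 0 := by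
        intro h0
        have := hsqZ 2 (by norm_num; exact Int.dvd_of_emod_eq_zero h0)
        exact absurd (Int.isUnit_iff.1 this) (by norm_num)
      obtain ⟨k', rfl⟩ : 2 ∣ k := by
        by_contra hodd
        have h1 : (k : ℤ) ^ 2 % 4 = 1 := by
          have h2 : k % 2 = 1 := by omega
          obtain ⟨l, rfl⟩ : ∃ l, k = 2 * l + 1 := ⟨k / 2, by omega⟩
          push_cast; ring_nf; omega
        have h2 : Δ % 4 = D % 4 := by rw [hΔk, Int.mul_emod, h1]; simp
        omega
      have hk1 : k' = 1 := by
        by_contra hk1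
        obtain ⟨p, hp, k'', rfl⟩ := Nat.exists_prime_and_dvd hk1
        refine hbad p hp (2 * k'') (by push_cast; ring) (Or.inl ?_)
        have : (2 * (k'' : ℤ)) ^ 2 * D = 4 * (k'' ^ 2 * D) := by ring
        rw [this]; omega
      subst hk1
      refine ⟨2 * uGamma γ, D, by linarith, hD0, hsqZ, ?_, by rw [if_neg hD4]⟩
      rw [hΔ, hΔk]; push_cast; ring

/-- The matrices that are scalar modulo `p ^ j`. -/
def scalarMod (p j : ℕ) : Set SL2Z := {γ | (p : ℤ) ^ j ∣ uGamma γ}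

/-- The matrices that are scalar modulo `p ^ j` with `(t² - 4) / p ^ (2 * j + 2)` a discriminant. -/
def scalarDisc (p j : ℕ) : Set SL2Z :=
  {γ | (p : ℤ) ^ j ∣ uGamma γ ∧
    ∃ n : ℤ, (n % 4 = 0 ∨ n % 4 = 1) ∧ trZ γ ^ 2 - 4 = (p : ℤ) ^ (2 * j + 2) * n}

theorem mul_sq_emod_four {n : ℤ} (hn : n % 4 = 0 ∨ n % 4 = 1) (w : ℤ) :
    w ^ 2 * n % 4 = 0 ∨ w ^ 2 * n % 4 = 1 := by
  rcases int_sq_emod_four w with h' | h' <;> rcases hn with hn | hn <;>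
    rw [Int.mul_emod, h', hn] <;> simp

theorem scalarMod_succ_subset (p j : ℕ) : scalarMod p (j + 1) ⊆ scalarDisc p j := by
  rintro γ ⟨w, hw⟩
  obtain ⟨n, hn, h⟩ := exists_disc_eq γ
  refine ⟨⟨p * w, by rw [hw]; ring⟩, w ^ 2 * n, mul_sq_emod_four hn w, ?_⟩
  rw [h, hw]; ring

theorem scalarDisc_subset (p j : ℕ) : scalarDisc p j ⊆ scalarMod p j := fun _ h => h.1

theorem scalarMod_antitone (p : ℕ) : Antitone (scalarMod p) := fun _ _ hij _ h =>
  (pow_dvd_pow _ hij).trans h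

theorem notMaximalAt_iff {p : ℕ} (hp : p.Prime) {γ : SL2Z} (h : 2 < |trZ γ|) :
    NotMaximalAt p γ ↔ ∃ j, γ ∈ scalarDisc p j \ scalarMod p (j + 1) := by
  have hu := uGamma_pos h
  have hp' := Nat.prime_iff_prime_int.1 hp
  have hp0 : (p : ℤ) ≠ 0 := hp'.ne_zero
  constructor
  · rintro ⟨n, hn, hbad⟩
    obtain ⟨j, w, hw, huw⟩ := Nat.exists_eq_pow_mul_and_not_dvd hu.ne' p hp.ne_one
    refine ⟨j, ⟨⟨w, by rw [huw]; push_cast; ring⟩, (w : ℤ) ^ 2 * n, mul_sq_emod_four hn w, ?_⟩, ?_⟩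
    · rw [hbad, huw]; push_cast; ring
    · rintro ⟨v, hv⟩
      refine hw ?_
      have : (w : ℤ) = p * v := by
        refine mul_left_cancel₀ (pow_ne_zero j hp0) ?_
        rw [huw] at hv
        push_cast at hv
        linear_combination hv
      exact Int.natCast_dvd_natCast.1 ⟨v, this⟩
  · rintro ⟨j, ⟨⟨w, hw⟩, n', hn', hdisc⟩, hnot⟩
    have hpw : ¬ (p : ℤ) ∣ w := by
      rintro ⟨v, rfl⟩
      exact hnot ⟨v, by rw [hw]; ring⟩
    obtain ⟨Δ, hΔ4, hΔ⟩ := exists_disc_eq γ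
    have h1 : (p : ℤ) ^ 2 * n' = w ^ 2 * Δ := by
      refine mul_left_cancel₀ (pow_ne_zero (2 * j) hp0) ?_
      rw [hw] at hΔ
      have : (p : ℤ) ^ (2 * j) = (p ^ j) ^ 2 := by ring
      have h2 : (p : ℤ) ^ (2 * j + 2) = (p ^ j) ^ 2 * p ^ 2 := by ring
      rw [h2] at hdisc
      rw [this]
      linear_combination hΔ - hdisc
    have hcop : IsCoprime ((p : ℤ) ^ 2) (w ^ 2) :=
      IsCoprime.pow ((Prime.coprime_iff_not_dvd hp').2 hpw)
    obtain ⟨n, hn⟩ : (p : ℤ) ^ 2 ∣ Δ := hcop.dvd_of_dvd_mul_left ⟨n', h1.symm⟩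
    refine ⟨n, ?_, by rw [hΔ, hn]; ring⟩
    by_cases hp2 : p = 2
    · subst hp2
      have hw0 : w ^ 2 * n = n' := by
        rw [hn] at h1
        push_cast at h1
        linarith
      have hw1 : w ^ 2 % 4 = 1 := by
        obtain ⟨l, rfl⟩ : ∃ l, w = 2 * l + 1 := ⟨w / 2, by push_cast at hpw; omega⟩
        ring_nf; omega
      rw [← hw0, Int.mul_emod, hw1] at hn'
      simpa using hn'
    · have hp1 : (p : ℤ) ^ 2 % 4 = 1 := by
        obtain ⟨l, hl⟩ := hp.odd_of_ne_two hp2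
        rw [hl]; push_cast; ring_nf; omega
      rw [hn, Int.mul_emod, hp1] at hΔ4
      simpa using hΔ4

/-! ### Periodic sets of matrices and their densities -/

/-- Membership in `S` depends only on the reduction modulo `N`. -/
def PeriodicMod (N : ℕ) (S : Set SL2Z) : Prop :=
  ∀ ⦃γ γ' : SL2Z⦄, red N γ = red N γ' → (γ ∈ S ↔ γ' ∈ S)

namespace PeriodicMod

variable {N N' : ℕ} {S S' : Set SL2Z}

theorem preimage_image (h : PeriodicMod N S) : red N ⁻¹' (red N '' S) = S := by
  refine Set.Subset.antisymm ?_ (Set.subset_preimage_image _ _)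
  rintro γ ⟨γ', hγ', he⟩
  exact (h he).1 hγ'

theorem mono (h : PeriodicMod N S) (hN : N ∣ N') : PeriodicMod N' S := by
  refine fun γ γ' he => h ?_
  obtain ⟨h1, h2, h3, h4⟩ := red_eq_red_iff.1 he
  have hN' : (N : ℤ) ∣ N' := Int.natCast_dvd_natCast.2 hN
  exact red_eq_red_iff.2 ⟨h1.of_dvd hN', h2.of_dvd hN', h3.of_dvd hN', h4.of_dvd hN'⟩

theorem empty : PeriodicMod N ∅ := fun _ _ _ => Iff.rfl

theorem univ : PeriodicMod N Set.univ := fun _ _ _ => Iff.rfl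

theorem inter (h : PeriodicMod N S) (h' : PeriodicMod N S') : PeriodicMod N (S ∩ S') :=
  fun _ _ he => and_congr (h he) (h' he)

theorem union (h : PeriodicMod N S) (h' : PeriodicMod N S') : PeriodicMod N (S ∪ S') :=
  fun _ _ he => or_congr (h he) (h' he)

theorem sdiff (h : PeriodicMod N S) (h' : PeriodicMod N S') : PeriodicMod N (S \ S') :=
  fun _ _ he => and_congr (h he) (not_congr (h' he))

end PeriodicMod

namespace HasDens

variable {S S' : Set SL2Z} {δ δ' : ℝ}

theorem unique (h : HasDens S δ) (h' : HasDens S δ') : δ = δ' := tendsto_nhds_unique h h'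

theorem empty : HasDens ∅ 0 := by
  have h : ∀ T, cnt (∅ : Set SL2Z) T = 0 := fun T => by
    classical
    simp [cnt]
  simp [HasDens, h]

theorem univ : HasDens Set.univ 1 := by
  refine tendsto_const_nhds.congr' ?_
  filter_upwards [eventually_cnt_univ_pos] with T hT
  rw [div_self hT.ne']

theorem sdiff (h : HasDens S δ) (h' : HasDens S' δ') (hS : S' ⊆ S) :
    HasDens (S \ S') (δ - δ') := by
  refine (Tendsto.sub h h').congr fun T => ?_
  have h1 := cnt_inter_add S S' T
  rw [Set.inter_eq_self_of_subset_right hS] at h1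
  rw [← h1, ← sub_div]
  push_cast
  ring

theorem disjUnion (h : HasDens S δ) (h' : HasDens S' δ') (hS : Disjoint S S') :
    HasDens (S ∪ S') (δ + δ') := by
  refine (Tendsto.add h h').congr fun T => ?_
  have h1 := cnt_inter_add (S ∪ S') S T
  rw [Set.inter_eq_self_of_subset_right Set.subset_union_left, Set.union_sdiff_left,
    hS.sdiff_eq_right] at h1
  rw [← h1, ← add_div]
  push_cast
  ring

end HasDens

theorem map_castHom_red {N M : ℕ} (h : N ∣ M) (γ : SL2Z) :
    Matrix.SpecialLinearGroup.map (ZMod.castHom h (ZMod N)) (red M γ) = red N γ := by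
  ext i j
  change ZMod.castHom h (ZMod N) ((γ i j : ℤ) : ZMod M) = ((γ i j : ℤ) : ZMod N)
  rw [map_intCast]

/-- Simultaneous reduction modulo `N` and `N'`. -/
def redProd (N N' : ℕ) (g : Matrix.SpecialLinearGroup (Fin 2) (ZMod (N * N'))) :
    Matrix.SpecialLinearGroup (Fin 2) (ZMod N) × Matrix.SpecialLinearGroup (Fin 2) (ZMod N') :=
  (Matrix.SpecialLinearGroup.map (ZMod.castHom (dvd_mul_right N N') (ZMod N)) g,
    Matrix.SpecialLinearGroup.map (ZMod.castHom (dvd_mul_left N' N) (ZMod N')) g)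

theorem redProd_red (N N' : ℕ) (γ : SL2Z) :
    redProd N N' (red (N * N') γ) = (red N γ, red N' γ) := by
  rw [redProd, map_castHom_red, map_castHom_red]

theorem redProd_bijective {N N' : ℕ} [NeZero N] [NeZero N'] (h : N.Coprime N') :
    Function.Bijective (redProd N N') := by
  have : NeZero (N * N') := ⟨mul_ne_zero (NeZero.ne N) (NeZero.ne N')⟩
  constructor
  · intro g g' hg
    obtain ⟨γ, rfl⟩ := red_surjective _ g
    obtain ⟨γ', rfl⟩ := red_surjective _ g'
    rw [redProd_red, redProd_red, Prod.mk.injEq] at hg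
    obtain ⟨a1, a2, a3, a4⟩ := red_eq_red_iff.1 hg.1
    obtain ⟨b1, b2, b3, b4⟩ := red_eq_red_iff.1 hg.2
    have key : ∀ {a b : ℤ}, a ≡ b [ZMOD N] → a ≡ b [ZMOD N'] → a ≡ b [ZMOD (N * N' : ℕ)] := by
      intro a b h1 h2
      push_cast
      exact (Int.modEq_and_modEq_iff_modEq_mul (by simpa using h)).1 ⟨h1, h2⟩
    exact red_eq_red_iff.2 ⟨key a1 b1, key a2 b2, key a3 b3, key a4 b4⟩
  · rintro ⟨g, g'⟩
    obtain ⟨γ, rfl⟩ := red_surjective _ g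
    obtain ⟨γ', rfl⟩ := red_surjective _ g'
    obtain ⟨u, v, huv⟩ := Nat.isCoprime_iff_coprime.2 h
    let k : Fin 2 → Fin 2 → ℤ := fun i j => γ' i j * (u * N) + γ i j * (v * N')
    have hkN : ∀ i j, ((k i j : ℤ) : ZMod N) = γ i j := by
      intro i j
      rw [ZMod.intCast_eq_intCast_iff, Int.modEq_comm, Int.modEq_iff_dvd]
      exact ⟨u * (γ' i j - γ i j), by simp only [k]; linear_combination (γ i j : ℤ) * huv⟩
    have hkN' : ∀ i j, ((k i j : ℤ) : ZMod N') = γ' i j := by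
      intro i j
      rw [ZMod.intCast_eq_intCast_iff, Int.modEq_comm, Int.modEq_iff_dvd]
      exact ⟨v * (γ i j - γ' i j), by simp only [k]; linear_combination (γ' i j : ℤ) * huv⟩
    have hdet : k 0 0 * k 1 1 - k 0 1 * k 1 0 ≡ 1 [ZMOD (N * N' : ℕ)] := by
      push_cast
      refine (Int.modEq_and_modEq_iff_modEq_mul (by simpa using h)).1 ⟨?_, ?_⟩
      · rw [← ZMod.intCast_eq_intCast_iff]
        push_cast
        rw [hkN, hkN, hkN, hkN]
        exact_mod_cast congrArg (Int.cast : ℤ → ZMod N) (det_entries γ)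
      · rw [← ZMod.intCast_eq_intCast_iff]
        push_cast
        rw [hkN', hkN', hkN', hkN']
        exact_mod_cast congrArg (Int.cast : ℤ → ZMod N') (det_entries γ')
    rw [← ZMod.intCast_eq_intCast_iff] at hdet
    refine ⟨⟨Matrix.of fun i j => ((k i j : ℤ) : ZMod (N * N')), ?_⟩, ?_⟩
    · rw [Matrix.det_fin_two]
      simp only [Matrix.of_apply]
      exact_mod_cast hdet
    · refine Prod.ext ?_ ?_
      · ext i j
        change ZMod.castHom (dvd_mul_right N N') (ZMod N) ((k i j : ℤ) : ZMod (N * N')) = ((γ i j : ℤ) : ZMod N)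
        rw [map_intCast, hkN]
      · ext i j
        change ZMod.castHom (dvd_mul_left N' N) (ZMod N') ((k i j : ℤ) : ZMod (N * N')) = ((γ' i j : ℤ) : ZMod N')
        rw [map_intCast, hkN']

/-- Periodic sets to coprime moduli are independent. -/
theorem HasDens.inter_of_coprime {N N' : ℕ} [NeZero N] [NeZero N'] (h : N.Coprime N')
    {S S' : Set SL2Z} {δ δ' : ℝ} (hS : PeriodicMod N S) (hS' : PeriodicMod N' S')
    (hδ : HasDens S δ) (hδ' : HasDens S' δ') : HasDens (S ∩ S') (δ * δ') := by
  have : NeZero (N * N') := ⟨mul_ne_zero (NeZero.ne N) (NeZero.ne N')⟩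
  have hb := redProd_bijective h
  have h1 : S ∩ S' = red (N * N') ⁻¹' (redProd N N' ⁻¹' ((red N '' S) ×ˢ (red N' '' S'))) := by
    ext γ
    rw [Set.mem_preimage, Set.mem_preimage, redProd_red, Set.mem_prod, Set.mem_inter_iff]
    exact and_congr (Set.ext_iff.1 hS.preimage_image γ).symm
      (Set.ext_iff.1 hS'.preimage_image γ).symm
  have h2 := hasDens_red_preimage (red N '' S)
  have h3 := hasDens_red_preimage (red N' '' S')
  rw [hS.preimage_image] at h2
  rw [hS'.preimage_image] at h3
  have h4 := hasDens_red_preimage (redProd N N' ⁻¹' ((red N '' S) ×ˢ (red N' '' S')))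
  rw [← h1, Set.ncard_preimage_of_injective_subset_range hb.1
    (by rw [hb.2.range_eq]; exact Set.subset_univ _), Set.ncard_prod,
    Nat.card_congr (Equiv.ofBijective _ hb), Nat.card_prod] at h4
  rw [hδ.unique h2, hδ'.unique h3, div_mul_div_comm]
  exact_mod_cast h4

/-- `S` is periodic to a power of `p` and has density `δ`. -/
def LocalDens (p : ℕ) (S : Set SL2Z) (δ : ℝ) : Prop :=
  (∃ k, PeriodicMod (p ^ k) S) ∧ HasDens S δ

namespace LocalDens

variable {p : ℕ} {S S' : Set SL2Z} {δ δ' : ℝ}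

theorem sdiff (h : LocalDens p S δ) (h' : LocalDens p S' δ') (hS : S' ⊆ S) :
    LocalDens p (S \ S') (δ - δ') := by
  obtain ⟨⟨k, hk⟩, hd⟩ := h
  obtain ⟨⟨l, hl⟩, hd'⟩ := h'
  exact ⟨⟨max k l, (hk.mono (pow_dvd_pow p (le_max_left k l))).sdiff
    (hl.mono (pow_dvd_pow p (le_max_right k l)))⟩, hd.sdiff hd' hS⟩

theorem disjUnion (h : LocalDens p S δ) (h' : LocalDens p S' δ') (hS : Disjoint S S') :
    LocalDens p (S ∪ S') (δ + δ') := by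
  obtain ⟨⟨k, hk⟩, hd⟩ := h
  obtain ⟨⟨l, hl⟩, hd'⟩ := h'
  exact ⟨⟨max k l, (hk.mono (pow_dvd_pow p (le_max_left k l))).union
    (hl.mono (pow_dvd_pow p (le_max_right k l)))⟩, hd.disjUnion hd' hS⟩

theorem compl (h : LocalDens p S δ) : LocalDens p Sᶜ (1 - δ) := by
  have h1 : LocalDens p Set.univ 1 := ⟨⟨0, .univ⟩, .univ⟩
  simpa [Set.compl_eq_univ_sdiff] using h1.sdiff h (Set.subset_univ S)

/-- Local conditions at distinct primes are independent. -/
theorem hasDens_biInter {I : Finset ℕ} (hI : ∀ p ∈ I, p.Prime) {S : ℕ → Set SL2Z} {δ : ℕ → ℝ}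
    (h : ∀ p ∈ I, LocalDens p (S p) (δ p)) :
    HasDens {γ | ∀ p ∈ I, γ ∈ S p} (∏ p ∈ I, δ p) := by
  classical
  suffices h2 : ∃ N : ℕ, (∀ q : ℕ, q.Prime → q ∣ N → q ∈ I) ∧ N ≠ 0 ∧
      PeriodicMod N {γ | ∀ p ∈ I, γ ∈ S p} ∧
      HasDens {γ | ∀ p ∈ I, γ ∈ S p} (∏ p ∈ I, δ p) by
    obtain ⟨-, -, -, -, h⟩ := h2; exact h
  induction I using Finset.induction_on with
  | empty =>
    refine ⟨1, fun q hq h1 => absurd (Nat.dvd_one.1 h1) hq.ne_one, one_ne_zero, ?_, ?_⟩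
    · simpa using PeriodicMod.univ
    · simpa using HasDens.univ
  | insert p I hp ih =>
    obtain ⟨N, hN, hN0, hper, hdens⟩ := ih (fun q hq => hI q (Finset.mem_insert_of_mem hq))
      fun q hq => h q (Finset.mem_insert_of_mem hq)
    have hpp := hI p (Finset.mem_insert_self p I)
    obtain ⟨⟨k, hk⟩, hd⟩ := h p (Finset.mem_insert_self p I)
    have hcop : (p ^ k).Coprime N :=
      Nat.Coprime.pow_left k ((Nat.Prime.coprime_iff_not_dvd hpp).2 fun hd => hp (hN p hpp hd))
    have : NeZero N := ⟨hN0⟩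
    have : NeZero (p ^ k) := ⟨pow_ne_zero k hpp.ne_zero⟩
    have heq : {γ | ∀ q ∈ insert p I, γ ∈ S q} = S p ∩ {γ | ∀ q ∈ I, γ ∈ S q} := by
      ext γ; simp
    rw [heq, Finset.prod_insert hp]
    refine ⟨p ^ k * N, ?_, mul_ne_zero (NeZero.ne _) hN0,
      (hk.mono (dvd_mul_right _ _)).inter (hper.mono (dvd_mul_left _ _)),
      hd.inter_of_coprime hcop hk hper hdens⟩
    intro q hq hqd
    rcases (Nat.Prime.dvd_mul hq).1 hqd with h' | h'
    · rw [(Nat.prime_dvd_prime_iff_eq hq hpp).1 (hq.dvd_of_dvd_pow h')]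
      exact Finset.mem_insert_self p I
    · exact Finset.mem_insert_of_mem (hN q hq h')

end LocalDens

/-! ### Densities of sets given by coordinates -/

/-- The order of `SL(2, ℤ/N)`. -/
def slCard (N : ℕ) : ℕ := Nat.card (Matrix.SpecialLinearGroup (Fin 2) (ZMod N))

theorem slCard_pos (N : ℕ) [NeZero N] : 0 < slCard N := Nat.card_pos

theorem sl_det {R : Type*} [CommRing R] (g : Matrix.SpecialLinearGroup (Fin 2) R) :
    g 0 0 * g 1 1 - g 0 1 * g 1 0 = 1 := by
  have := g.det_coe
  rwa [Matrix.det_fin_two] at this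

theorem sl_ext {R : Type*} [CommRing R] {g g' : Matrix.SpecialLinearGroup (Fin 2) R}
    (h₀₀ : g 0 0 = g' 0 0) (h₀₁ : g 0 1 = g' 0 1) (h₁₀ : g 1 0 = g' 1 0) (h₁₁ : g 1 1 = g' 1 1) :
    g = g' := by
  ext i j
  fin_cases i <;> fin_cases j <;> assumption

theorem periodic_red_preimage {N : ℕ} (Q : Set (Matrix.SpecialLinearGroup (Fin 2) (ZMod N))) :
    PeriodicMod N (red N ⁻¹' Q) := fun γ γ' h => by
  rw [Set.mem_preimage, Set.mem_preimage, h]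

theorem hasDens_entries {N : ℕ} [NeZero N] (R : Finset (ZMod N × ZMod N × ZMod N))
    (hR : ∀ r ∈ R, IsUnit r.1) :
    PeriodicMod N {γ | ((γ 0 0 : ZMod N), (γ 0 1 : ZMod N), (γ 1 0 : ZMod N)) ∈ R} ∧
    HasDens {γ | ((γ 0 0 : ZMod N), (γ 0 1 : ZMod N), (γ 1 0 : ZMod N)) ∈ R}
      (R.card / slCard N : ℝ) := by
  let f : Matrix.SpecialLinearGroup (Fin 2) (ZMod N) → ZMod N × ZMod N × ZMod N :=
    fun g => (g 0 0, g 0 1, g 1 0)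
  have hS : {γ : SL2Z | ((γ 0 0 : ZMod N), (γ 0 1 : ZMod N), (γ 1 0 : ZMod N)) ∈ R} =
      red N ⁻¹' (f ⁻¹' R) := rfl
  have himg : f '' (f ⁻¹' R) = R := by
    refine Set.image_preimage_eq_of_subset fun r hr => ?_
    obtain ⟨u, hu⟩ := hR r hr
    refine ⟨⟨!![r.1, r.2.1; r.2.2, ↑u⁻¹ * (1 + r.2.1 * r.2.2)], ?_⟩, rfl⟩
    rw [Matrix.det_fin_two_of, ← hu, Units.mul_inv_cancel_left]
    ring
  have hinj : Set.InjOn f (f ⁻¹' R) := by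
    intro g hg g' hg' h
    obtain ⟨h1, h2, h3⟩ : g 0 0 = g' 0 0 ∧ g 0 1 = g' 0 1 ∧ g 1 0 = g' 1 0 := by
      simpa [f] using h
    refine sl_ext h1 h2 h3 ((hR _ hg).mul_left_cancel ?_)
    change g 0 0 * g 1 1 = g 0 0 * g' 1 1
    have e1 := sl_det g
    have e2 := sl_det g'
    rw [← h1, ← h2, ← h3] at e2
    linear_combination e1 - e2
  rw [hS]
  refine ⟨periodic_red_preimage _, ?_⟩
  have := hasDens_red_preimage (f ⁻¹' R)
  rwa [← hinj.ncard_image, himg, Set.ncard_coe_finset] at this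

/-- The matrices with given trace `2 * e`, where `e ^ 2 = 1`. -/
theorem hasDens_trace {N : ℕ} [NeZero N] {e : ℤ} (he : (e : ZMod N) ^ 2 = 1) :
    PeriodicMod N {γ | (trZ γ : ZMod N) = 2 * e} ∧
    HasDens {γ | (trZ γ : ZMod N) = 2 * e}
      ((Finset.univ.filter fun r : ZMod N × ZMod N × ZMod N => r.1 ^ 2 + r.2.1 * r.2.2 = 0).card /
        slCard N : ℝ) := by
  let R := Finset.univ.filter fun r : ZMod N × ZMod N × ZMod N => r.1 ^ 2 + r.2.1 * r.2.2 = 0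
  let Q : Set (Matrix.SpecialLinearGroup (Fin 2) (ZMod N)) := {g | g 0 0 + g 1 1 = 2 * (e : ZMod N)}
  let f : Matrix.SpecialLinearGroup (Fin 2) (ZMod N) → ZMod N × ZMod N × ZMod N :=
    fun g => (g 0 0 - e, g 0 1, g 1 0)
  have hS : {γ : SL2Z | (trZ γ : ZMod N) = 2 * e} = red N ⁻¹' Q := by
    ext γ
    change ((trZ γ : ℤ) : ZMod N) = 2 * e ↔ (γ 0 0 : ZMod N) + (γ 1 1 : ZMod N) = 2 * e
    rw [trZ, Int.cast_add]
  have himg : f '' Q = R := by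
    ext r
    simp only [Set.mem_image, R, Finset.coe_filter, Finset.mem_univ, true_and, Set.mem_ofPred_eq]
    constructor
    · rintro ⟨g, hg, rfl⟩
      have hg' : g 0 0 + g 1 1 = 2 * (e : ZMod N) := hg
      have := sl_det g
      simp only [f]
      linear_combination g 0 0 * hg' - this + he
    · intro hr
      refine ⟨⟨!![e + r.1, r.2.1; r.2.2, e - r.1], ?_⟩, ?_, ?_⟩
      · rw [Matrix.det_fin_two_of]
        linear_combination he - hr
      · change (e : ZMod N) + r.1 + (e - r.1) = 2 * e
        ring
      · change ((e : ZMod N) + r.1 - e, r.2.1, r.2.2) = r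
        rw [add_sub_cancel_left]
  have hinj : Set.InjOn f Q := by
    intro g hg g' hg' h
    obtain ⟨h1, h2, h3⟩ : g 0 0 = g' 0 0 ∧ g 0 1 = g' 0 1 ∧ g 1 0 = g' 1 0 := by
      simpa [f] using h
    have e1 : g 0 0 + g 1 1 = 2 * (e : ZMod N) := hg
    have e2 : g' 0 0 + g' 1 1 = 2 * (e : ZMod N) := hg'
    exact sl_ext h1 h2 h3 (by linear_combination e1 - e2 - h1)
  rw [hS]
  refine ⟨periodic_red_preimage _, ?_⟩
  have := hasDens_red_preimage Q
  rwa [← hinj.ncard_image, himg, Set.ncard_coe_finset] at this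

/-- The matrices `ε + M * (x, y; z, *)` with `(x, y, z)` modulo `K` in `Q`. -/
def coordSet (ε : ℤ) (M K : ℕ) (Q : Finset (ZMod K × ZMod K × ZMod K)) : Set SL2Z :=
  {γ | ∃ x y z : ℤ, γ 0 0 = ε + M * x ∧ γ 0 1 = M * y ∧ γ 1 0 = M * z ∧
    ((x : ZMod K), (y : ZMod K), (z : ZMod K)) ∈ Q}

theorem mul_add_cast_eq_iff {M K : ℕ} (hM : M ≠ 0) (ε x y : ℤ) :
    ((ε + M * x : ℤ) : ZMod (M * K)) = (ε + M * y : ℤ) ↔ (x : ZMod K) = y := by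
  have hM' : (M : ℤ) ≠ 0 := by exact_mod_cast hM
  rw [ZMod.intCast_eq_intCast_iff_dvd_sub, ZMod.intCast_eq_intCast_iff_dvd_sub,
    add_sub_add_left_eq_sub, ← mul_sub, Nat.cast_mul, mul_dvd_mul_iff_left hM']

theorem eq_add_mul_of_cast_eq {M K : ℕ} {a ε x : ℤ}
    (h : (a : ZMod (M * K)) = (ε + M * x : ℤ)) : ∃ y : ℤ, a = ε + M * y := by
  rw [ZMod.intCast_eq_intCast_iff_dvd_sub] at h
  obtain ⟨w, hw⟩ := h
  exact ⟨x - K * w, by push_cast at hw; linear_combination -hw⟩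

theorem hasDens_coordSet {ε : ℤ} {M K : ℕ} (hM : M ≠ 0) [NeZero K]
    (hu : ∀ x : ℤ, IsCoprime (ε + M * x) (M * K : ℤ)) (Q : Finset (ZMod K × ZMod K × ZMod K)) :
    PeriodicMod (M * K) (coordSet ε M K Q) ∧
      HasDens (coordSet ε M K Q) (Q.card / slCard (M * K) : ℝ) := by
  classical
  have : NeZero (M * K) := ⟨mul_ne_zero hM (NeZero.ne K)⟩
  let c : ZMod K → ℤ := fun x => x.val
  have hc : ∀ x, ((c x : ℤ) : ZMod K) = x := fun x => by simp [c]
  let φ : ZMod K × ZMod K × ZMod K → ZMod (M * K) × ZMod (M * K) × ZMod (M * K) := fun q =>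
    (((ε + M * c q.1 : ℤ) : ZMod (M * K)), ((0 + M * c q.2.1 : ℤ) : ZMod (M * K)),
      ((0 + M * c q.2.2 : ℤ) : ZMod (M * K)))
  have hφ : Function.Injective φ := by
    rintro ⟨x, y, z⟩ ⟨x', y', z'⟩ h
    simp only [φ, Prod.mk.injEq, mul_add_cast_eq_iff hM, hc] at h
    obtain ⟨rfl, rfl, rfl⟩ := h
    rfl
  have hS : coordSet ε M K Q = {γ | ((γ 0 0 : ZMod (M * K)), (γ 0 1 : ZMod (M * K)),
      (γ 1 0 : ZMod (M * K))) ∈ Q.image φ} := by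
    ext γ
    simp only [coordSet, Set.mem_ofPred_eq, Finset.mem_image]
    constructor
    · rintro ⟨x, y, z, h1, h2, h3, h⟩
      refine ⟨_, h, ?_⟩
      simp only [φ, Prod.mk.injEq]
      rw [h1, h2, h3, ← zero_add ((M : ℤ) * y), ← zero_add ((M : ℤ) * z),
        mul_add_cast_eq_iff hM, mul_add_cast_eq_iff hM, mul_add_cast_eq_iff hM]
      exact ⟨hc _, hc _, hc _⟩
    · rintro ⟨⟨x, y, z⟩, h, h'⟩
      simp only [φ, Prod.mk.injEq] at h'
      obtain ⟨h1, h2, h3⟩ := h'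
      obtain ⟨x', hx⟩ := eq_add_mul_of_cast_eq h1.symm
      obtain ⟨y', hy⟩ := eq_add_mul_of_cast_eq h2.symm
      obtain ⟨z', hz⟩ := eq_add_mul_of_cast_eq h3.symm
      rw [hx, mul_add_cast_eq_iff hM, hc] at h1
      rw [hy, mul_add_cast_eq_iff hM, hc] at h2
      rw [hz, mul_add_cast_eq_iff hM, hc] at h3
      refine ⟨x', y', z', hx, by rw [hy, zero_add], by rw [hz, zero_add], ?_⟩
      rw [← h1, ← h2, ← h3]
      exact h
  rw [hS, ← Finset.card_image_of_injective Q hφ]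
  refine hasDens_entries _ fun r hr => ?_
  obtain ⟨q, -, rfl⟩ := Finset.mem_image.1 hr
  have := hu (c q.1)
  rw [← Nat.cast_mul] at this
  exact (ZMod.coe_int_isUnit_iff_isCoprime _ _).2 this.symm

theorem card_GL_eq_mul_card_SL (K : Type*) [Field K] [Finite K] :
    Nat.card (GL (Fin 2) K) =
      Nat.card Kˣ * Nat.card (Matrix.SpecialLinearGroup (Fin 2) K) := by
  have hsurj : Function.Surjective (Matrix.GeneralLinearGroup.det : GL (Fin 2) K →* Kˣ) := by
    intro u
    refine ⟨Matrix.GeneralLinearGroup.mkOfDetNeZero !![(u : K), 0; 0, 1] (by simp), ?_⟩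
    ext
    simp [Matrix.GeneralLinearGroup.mkOfDetNeZero]
  have hker : Nat.card (Matrix.GeneralLinearGroup.det : GL (Fin 2) K →* Kˣ).ker =
      Nat.card (Matrix.SpecialLinearGroup (Fin 2) K) := by
    symm
    refine Nat.card_congr (Equiv.ofBijective
      (fun g => ⟨Matrix.SpecialLinearGroup.toGL g, ?_⟩) ⟨?_, ?_⟩)
    · rw [MonoidHom.mem_ker]
      ext
      simp
    · intro g g' h
      exact Matrix.SpecialLinearGroup.toGL_injective (Subtype.ext_iff.1 h)
    · rintro ⟨g, hg⟩
      refine ⟨⟨g, by simpa using congrArg Units.val (MonoidHom.mem_ker.1 hg)⟩, ?_⟩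
      ext i j
      rfl
  rw [Subgroup.card_eq_card_quotient_mul_card_subgroup
    (Matrix.GeneralLinearGroup.det : GL (Fin 2) K →* Kˣ).ker, hker,
    Nat.card_congr (QuotientGroup.quotientKerEquivOfSurjective _ hsurj).toEquiv]

theorem slCard_prime {p : ℕ} (hp : p.Prime) : (slCard p : ℝ) = p * ((p : ℝ) ^ 2 - 1) := by
  have := Fact.mk hp
  have h := card_GL_eq_mul_card_SL (ZMod p)
  rw [Matrix.card_GL_field, Fin.prod_univ_two, ZMod.card, Nat.card_eq_fintype_card,
    ZMod.card_units] at h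
  simp only [Fin.val_zero, Fin.val_one, pow_zero, pow_one] at h
  have h1 := hp.one_lt
  have h2 : (((p ^ 2 - 1) * (p ^ 2 - p) : ℕ) : ℝ) = ((p - 1) * slCard p : ℕ) :=
    congrArg Nat.cast h
  have h3 : (1 : ℝ) < p := by exact_mod_cast h1
  rw [Nat.cast_mul, Nat.cast_mul, Nat.cast_sub (Nat.one_le_pow _ _ (by omega)),
    Nat.cast_sub (by nlinarith), Nat.cast_sub h1.le] at h2
  push_cast at h2
  refine mul_left_cancel₀ (sub_ne_zero.2 h3.ne') ?_
  rw [← h2]; ring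

theorem isCoprime_add_mul_pow {p : ℕ} {ε : ℤ} (hε : ε = 1 ∨ ε = -1) {j : ℕ} (hj : 1 ≤ j)
    (m : ℕ) (x : ℤ) : IsCoprime (ε + (p ^ j : ℕ) * x) ((p ^ j : ℕ) * (p ^ m : ℕ) : ℤ) := by
  rw [← Nat.cast_mul, ← pow_add]
  obtain ⟨i, rfl⟩ := Nat.exists_eq_add_of_le hj
  push_cast
  refine IsCoprime.pow_right ?_
  have : IsCoprime ε (p : ℤ) := by
    rcases hε with rfl | rfl
    · exact isCoprime_one_left
    · exact isCoprime_one_left.neg_left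
  rw [pow_add, pow_one, mul_assoc]
  exact (IsCoprime.add_mul_left_left_iff).2 this

theorem slCard_prime_pow {p : ℕ} (hp : p.Prime) (k : ℕ) :
    (slCard (p ^ (k + 1)) : ℝ) = (p : ℝ) ^ (3 * k) * slCard p := by
  have := Fact.mk hp
  have : NeZero p := ⟨hp.ne_zero⟩
  have h0 := hasDens_coordSet (ε := 1) (M := p ^ 1) (K := p ^ 0) (by simpa using hp.ne_zero)
    (isCoprime_add_mul_pow (.inl rfl) le_rfl 0) Finset.univ
  have h1 := hasDens_coordSet (ε := 1) (M := p ^ 1) (K := p ^ k) (by simpa using hp.ne_zero)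
    (isCoprime_add_mul_pow (.inl rfl) le_rfl k) Finset.univ
  have h2 : coordSet 1 (p ^ 1) (p ^ 0) Finset.univ = coordSet 1 (p ^ 1) (p ^ k) Finset.univ := by
    have e1 : ∀ q : ZMod (p ^ 0) × ZMod (p ^ 0) × ZMod (p ^ 0), q ∈ Finset.univ :=
      Finset.mem_univ
    have e2 : ∀ q : ZMod (p ^ k) × ZMod (p ^ k) × ZMod (p ^ k), q ∈ Finset.univ :=
      Finset.mem_univ
    simp only [coordSet, e1, e2]
  rw [h2] at h0
  have h3 := h0.2.unique h1.2
  have e1 : p ^ 1 * p ^ k = p ^ (k + 1) := by ring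
  have e2 : p ^ 1 * p ^ 0 = p := by ring
  rw [e1, e2] at h3
  simp only [Finset.card_univ, Fintype.card_prod, ZMod.card] at h3
  have p1 : (0 : ℝ) < slCard p := by exact_mod_cast slCard_pos p
  have p2 : (0 : ℝ) < slCard (p ^ (k + 1)) := by exact_mod_cast slCard_pos (p ^ (k + 1))
  rw [div_eq_div_iff p1.ne' p2.ne'] at h3
  push_cast at h3
  rw [show (p : ℝ) ^ (3 * k) = p ^ k * (p ^ k * p ^ k) by ring, ← h3]
  ring

/-- Solutions of `x ^ 2 + y * z = 0` in a finite ring whose nonunits multiply to zero. -/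
theorem card_quadric {R : Type*} [CommRing R] [Nontrivial R] [Fintype R] [DecidableEq R]
    [DecidablePred (IsUnit : R → Prop)] (h0 : ∀ x y : R, ¬ IsUnit x → ¬ IsUnit y → x * y = 0) :
    (Finset.univ.filter fun r : R × R × R => r.1 ^ 2 + r.2.1 * r.2.2 = 0).card =
      Fintype.card R * (Finset.univ.filter fun x : R => IsUnit x).card +
      ((Finset.univ.filter fun x : R => ¬ IsUnit x).card * Fintype.card R +
      (Finset.univ.filter fun x : R => ¬ IsUnit x).card *
        (((Finset.univ.filter fun x : R => ¬ IsUnit x).card - 1) *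
          (Finset.univ.filter fun x : R => ¬ IsUnit x).card)) := by
  set U : Finset R := Finset.univ.filter fun x => IsUnit x with hU
  set V : Finset R := Finset.univ.filter fun x => ¬ IsUnit x with hV
  have hmU : ∀ {x}, x ∈ U ↔ IsUnit x := by simp [hU]
  have hmV : ∀ {x}, x ∈ V ↔ ¬ IsUnit x := by simp [hV]
  have h0V : (0 : R) ∈ V := hmV.2 not_isUnit_zero
  let f : R × R → R × R × R := fun q => (q.1, q.2, -q.1 ^ 2 * Ring.inverse q.2)
  have hf : Function.Injective f := fun q q' h => by
    simp only [f, Prod.mk.injEq] at h; exact Prod.ext h.1 h.2.1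
  let A₁ : Finset (R × R × R) := (Finset.univ ×ˢ U).image f
  let A₂ : Finset (R × R × R) := V ×ˢ ({0} : Finset R) ×ˢ (Finset.univ : Finset R)
  let A₃ : Finset (R × R × R) := V ×ˢ V.erase 0 ×ˢ V
  have hA₁ : ∀ {x y z}, (x, y, z) ∈ A₁ ↔ IsUnit y ∧ -x ^ 2 * Ring.inverse y = z := by
    intro x y z
    simp only [A₁, Finset.mem_image, Finset.mem_product, Finset.mem_univ, true_and, hmU, f,
      Prod.mk.injEq, Prod.exists]
    constructor
    · rintro ⟨a, b, hb, rfl, rfl, h⟩; exact ⟨hb, h⟩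
    · rintro ⟨hb, h⟩; exact ⟨x, y, hb, rfl, rfl, h⟩
  have hA₂ : ∀ {x y z}, (x, y, z) ∈ A₂ ↔ ¬ IsUnit x ∧ y = 0 := by
    intro x y z
    simp only [A₂, Finset.mem_product, Finset.mem_singleton, Finset.mem_univ, and_true, hmV]
  have hA₃ : ∀ {x y z}, (x, y, z) ∈ A₃ ↔ ¬ IsUnit x ∧ (y ≠ 0 ∧ ¬ IsUnit y) ∧ ¬ IsUnit z := by
    intro x y z
    simp only [A₃, Finset.mem_product, Finset.mem_erase, hmV]
  have hd1 : Disjoint A₁ (A₂ ∪ A₃) := by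
    rw [Finset.disjoint_left]
    rintro ⟨x, y, z⟩ h1 h2
    rcases Finset.mem_union.1 h2 with h2 | h2
    · exact hmV.1 h0V ((hA₂.1 h2).2 ▸ (hA₁.1 h1).1)
    · exact (hA₃.1 h2).2.1.2 (hA₁.1 h1).1
  have hd2 : Disjoint A₂ A₃ := by
    rw [Finset.disjoint_left]
    rintro ⟨x, y, z⟩ h1 h2
    exact (hA₃.1 h2).2.1.1 (hA₂.1 h1).2
  have heq : (Finset.univ.filter fun r : R × R × R => r.1 ^ 2 + r.2.1 * r.2.2 = 0) =
      A₁ ∪ (A₂ ∪ A₃) := by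
    ext ⟨x, y, z⟩
    simp only [Finset.mem_filter, Finset.mem_univ, true_and, Finset.mem_union, hA₁, hA₂, hA₃]
    constructor
    · intro h
      by_cases hy : IsUnit y
      · refine .inl ⟨hy, ?_⟩
        have : -x ^ 2 = z * y := by linear_combination -h
        rw [this, mul_assoc, Ring.mul_inverse_cancel _ hy, mul_one]
      · have hx : ¬ IsUnit x := fun hx => hy (isUnit_of_mul_isUnit_left (y := -z) (by
          have : y * -z = x ^ 2 := by linear_combination -h
          rw [this]; exact hx.pow 2))
        by_cases hy0 : y = 0
        · exact .inr (.inl ⟨hx, hy0⟩)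
        · refine .inr (.inr ⟨hx, ⟨hy0, hy⟩, fun hz => hy0 ?_⟩)
          refine (hz.mul_left_eq_zero).1 ?_
          linear_combination h - h0 x x hx hx
    · rintro (⟨hy, rfl⟩ | ⟨hx, rfl⟩ | ⟨hx, ⟨-, hy⟩, hz⟩)
      · rw [mul_left_comm, Ring.mul_inverse_cancel _ hy]; ring
      · linear_combination h0 x x hx hx
      · linear_combination h0 x x hx hx + h0 y z hy hz
  rw [heq, Finset.card_union_of_disjoint hd1, Finset.card_union_of_disjoint hd2,
    Finset.card_image_of_injective _ hf]
  simp only [A₂, A₃, Finset.card_product, Finset.card_singleton, Finset.card_univ,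
    Finset.card_erase_of_mem h0V, one_mul]

theorem card_filter_isUnit {p : ℕ} [NeZero p] (hp : p.Prime)
    [DecidablePred (IsUnit : ZMod (p ^ 2) → Prop)] :
    (Finset.univ.filter fun x : ZMod (p ^ 2) => IsUnit x).card = p ^ 2 - p := by
  have h : (Finset.univ.filter fun x : ZMod (p ^ 2) => IsUnit x) =
      Finset.univ.map ⟨Units.val, Units.val_injective⟩ := by
    ext x
    simp only [Finset.mem_filter, Finset.mem_univ, true_and, Finset.mem_map,
      Function.Embedding.coeFn_mk]
    rfl
  rw [h, Finset.card_map, Finset.card_univ, ZMod.card_units_eq_totient,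
    Nat.totient_prime_pow hp two_pos, Nat.mul_sub]
  ring_nf

theorem not_isUnit_iff {p : ℕ} (hp : p.Prime) (x : ZMod (p ^ 2)) :
    ¬ IsUnit x ↔ ∃ y, x = p * y := by
  have : NeZero p := ⟨hp.ne_zero⟩
  obtain ⟨n, rfl⟩ := ZMod.intCast_surjective x
  rw [ZMod.coe_int_isUnit_iff_isCoprime]
  push_cast
  rw [IsCoprime.pow_left_iff two_pos, (Nat.prime_iff_prime_int.1 hp).coprime_iff_not_dvd, not_not]
  constructor
  · rintro ⟨w, rfl⟩
    exact ⟨w, by push_cast; rfl⟩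
  · rintro ⟨y, hy⟩
    obtain ⟨m, rfl⟩ := ZMod.intCast_surjective y
    have : ((n : ℤ) : ZMod (p ^ 2)) = (p * m : ℤ) := by rw [hy]; push_cast; rfl
    rw [ZMod.intCast_eq_intCast_iff_dvd_sub] at this
    push_cast at this
    have h2 : (p : ℤ) ∣ p * m - n := (Dvd.intro_left (p : ℤ) (by ring)).trans this
    exact (dvd_sub_right (dvd_mul_right _ _)).1 h2

theorem card_quadric_zmod_sq {p : ℕ} [NeZero p] (hp : p.Prime) :
    ((Finset.univ.filter fun r : ZMod (p ^ 2) × ZMod (p ^ 2) × ZMod (p ^ 2) =>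
      r.1 ^ 2 + r.2.1 * r.2.2 = 0).card : ℝ) = (p : ℝ) ^ 4 + p ^ 3 - p ^ 2 := by
  have : DecidablePred (IsUnit : ZMod (p ^ 2) → Prop) := Classical.decPred _
  have hpp : (p : ZMod (p ^ 2)) * p = 0 := by
    rw [← sq]; exact_mod_cast ZMod.natCast_self (p ^ 2)
  have : Fact (1 < p ^ 2) := ⟨Nat.one_lt_pow two_ne_zero hp.one_lt⟩
  have h1 := card_filter_isUnit hp
  have h2 := Finset.card_filter_add_card_filter_not (s := Finset.univ)
    (fun x : ZMod (p ^ 2) => IsUnit x)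
  have h3 : p ≤ p ^ 2 := by nlinarith [hp.one_lt]
  have h4 : (Finset.univ.filter fun x : ZMod (p ^ 2) => ¬ IsUnit x).card = p := by
    rw [h1, Finset.card_univ, ZMod.card] at h2
    omega
  rw [card_quadric, h1, h4, ZMod.card]
  · push_cast [Nat.cast_sub h3, Nat.cast_sub hp.one_le]
    ring
  · intro x y hx hy
    obtain ⟨x', rfl⟩ := (not_isUnit_iff hp x).1 hx
    obtain ⟨y', rfl⟩ := (not_isUnit_iff hp y).1 hy
    linear_combination (x' * y') * hpp

/-! ### Local densities at odd primes -/

theorem mem_scalarMod_iff {p j : ℕ} {γ : SL2Z} : γ ∈ scalarMod p j ↔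
    (p : ℤ) ^ j ∣ γ 1 0 ∧ (p : ℤ) ^ j ∣ γ 1 1 - γ 0 0 ∧ (p : ℤ) ^ j ∣ γ 0 1 :=
  natCast_dvd_uGamma_iff

theorem disjoint_coordSet_neg {M K : ℕ} (hM : ¬ (M : ℤ) ∣ 2)
    (Q Q' : Finset (ZMod K × ZMod K × ZMod K)) :
    Disjoint (coordSet 1 M K Q) (coordSet (-1) M K Q') := by
  rw [Set.disjoint_left]
  rintro γ ⟨x, -, -, hx, -⟩ ⟨x', -, -, hx', -⟩
  exact hM ⟨x' - x, by linear_combination hx' - hx⟩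

theorem localDens_coordSet_union_neg {p : ℕ} (hp : p.Prime) {j : ℕ} (hj : 1 ≤ j)
    (h2 : ¬ ((p ^ j : ℕ) : ℤ) ∣ 2) (m : ℕ)
    (Q : Finset (ZMod (p ^ m) × ZMod (p ^ m) × ZMod (p ^ m))) :
    LocalDens p (coordSet 1 (p ^ j) (p ^ m) Q ∪ coordSet (-1) (p ^ j) (p ^ m) Q)
      (2 * Q.card / slCard (p ^ (j + m))) := by
  have : NeZero p := ⟨hp.ne_zero⟩
  have hM : p ^ j ≠ 0 := pow_ne_zero _ hp.ne_zero
  have h : ∀ ε : ℤ, ε = 1 ∨ ε = -1 →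
      LocalDens p (coordSet ε (p ^ j) (p ^ m) Q) (Q.card / slCard (p ^ (j + m))) := by
    intro ε hε
    have := hasDens_coordSet hM (isCoprime_add_mul_pow hε hj m) Q
    rw [← pow_add] at this
    exact ⟨⟨_, this.1⟩, this.2⟩
  have := (h 1 (.inl rfl)).disjUnion (h (-1) (.inr rfl)) (disjoint_coordSet_neg h2 Q Q)
  rwa [← two_mul, ← mul_div_assoc] at this

theorem pow_dvd_or_of_dvd_mul {p : ℕ} (hp : p.Prime) {u v : ℤ} (h : ¬ (p : ℤ) ∣ u - v) {k : ℕ}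
    (hd : (p : ℤ) ^ k ∣ u * v) : (p : ℤ) ^ k ∣ u ∨ (p : ℤ) ^ k ∣ v := by
  have hp' := Nat.prime_iff_prime_int.1 hp
  by_cases hu : (p : ℤ) ∣ u
  · have hv : ¬ (p : ℤ) ∣ v := fun hv => h (dvd_sub hu hv)
    exact .inl ((IsCoprime.pow_left ((hp'.coprime_iff_not_dvd).2 hv)).dvd_of_dvd_mul_right hd)
  · exact .inr ((IsCoprime.pow_left ((hp'.coprime_iff_not_dvd).2 hu)).dvd_of_dvd_mul_left hd)

theorem entry_mul_trZ_sub (γ : SL2Z) {e : ℤ} (he : e ^ 2 = 1) :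
    γ 0 0 * (trZ γ - 2 * e) = (γ 0 0 - e) ^ 2 + γ 0 1 * γ 1 0 := by
  have := det_entries γ
  unfold trZ
  linear_combination this - he

theorem not_dvd_two_pow {p : ℕ} (hp : p.Prime) (h2 : p ≠ 2) (k : ℕ) : ¬ (p : ℤ) ∣ 2 ^ k := by
  intro h
  have : (p : ℤ) ∣ (2 : ℕ) := by
    exact_mod_cast (Nat.prime_iff_prime_int.1 hp).dvd_of_dvd_pow h
  exact h2 ((Nat.prime_dvd_prime_iff_eq hp Nat.prime_two).1 (Int.natCast_dvd_natCast.1 this))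

section Odd

variable {p : ℕ}

theorem scalarMod_eq_of_odd (hp : p.Prime) (h2 : p ≠ 2) (j : ℕ) :
    scalarMod p j =
      coordSet 1 (p ^ j) (p ^ 0) Finset.univ ∪ coordSet (-1) (p ^ j) (p ^ 0) Finset.univ := by
  ext γ
  have hdet := det_entries γ
  rw [mem_scalarMod_iff]
  simp only [Set.mem_union, coordSet, Set.mem_ofPred_eq, Nat.cast_pow]
  constructor
  · rintro ⟨⟨z, hz⟩, ⟨w, hw⟩, ⟨y, hy⟩⟩
    have hd : (p : ℤ) ^ j ∣ (γ 0 0 - 1) * (γ 0 0 + 1) := by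
      refine ⟨p ^ j * y * z - γ 0 0 * w, ?_⟩
      rw [hz, hy] at hdet
      linear_combination hdet - γ 0 0 * hw
    rcases pow_dvd_or_of_dvd_mul hp
      (fun h => not_dvd_two_pow hp h2 1 (by rw [← dvd_neg]; ring_nf at h ⊢; exact h)) hd with h | h
    · obtain ⟨x, hx⟩ := h
      exact .inl ⟨x, y, z, by linear_combination hx, hy, hz, Finset.mem_univ _⟩
    · obtain ⟨x, hx⟩ := h
      exact .inr ⟨x, y, z, by linear_combination hx, hy, hz, Finset.mem_univ _⟩
  · have key : ∀ e : ℤ, e ^ 2 = 1 → ∀ x y z : ℤ, γ 0 0 = e + p ^ j * x → γ 0 1 = p ^ j * y →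
        γ 1 0 = p ^ j * z → (p : ℤ) ^ j ∣ γ 1 1 - γ 0 0 := by
      intro e he x y z hx hy hz
      have h1 : γ 1 1 - γ 0 0 = p ^ j * (e * p ^ j * y * z - e * x * γ 1 1 - x) := by
        rw [hy, hz] at hdet
        linear_combination (-γ 1 1) * he + e * hdet - e * γ 1 1 * hx - hx
      exact ⟨_, h1⟩
    rintro (⟨x, y, z, hx, hy, hz, -⟩ | ⟨x, y, z, hx, hy, hz, -⟩)
    · exact ⟨⟨z, hz⟩, key 1 (by norm_num) x y z hx hy hz, ⟨y, hy⟩⟩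
    · exact ⟨⟨z, hz⟩, key (-1) (by norm_num) x y z hx hy hz, ⟨y, hy⟩⟩

theorem mul_emod_four_of_odd_sq {q n m : ℤ} (hq : q % 2 = 1) (h : m = q ^ 2 * n)
    (hm : m % 4 = 0 ∨ m % 4 = 1) : n % 4 = 0 ∨ n % 4 = 1 := by
  have h1 : q ^ 2 % 4 = 1 := by
    obtain ⟨l, rfl⟩ : ∃ l, q = 2 * l + 1 := ⟨q / 2, by omega⟩
    ring_nf; omega
  rw [h, Int.mul_emod, h1] at hm
  omega

theorem mem_scalarDisc_iff_of_odd (hp : p.Prime) (h2 : p ≠ 2) {j : ℕ} {γ : SL2Z} :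
    γ ∈ scalarDisc p j ↔
      γ ∈ scalarMod p j ∧ (p : ℤ) ^ (2 * j + 2) ∣ (trZ γ - 2) * (trZ γ + 2) := by
  have hodd : ((p : ℤ) ^ (j + 1)) % 2 = 1 := by
    have : Odd (p : ℤ) := by exact_mod_cast hp.odd_of_ne_two h2
    exact Int.odd_iff.1 this.pow
  refine and_congr_right fun _ => ?_
  constructor
  · rintro ⟨n, -, hn⟩
    exact ⟨n, by rw [← hn]; ring⟩
  · rintro ⟨n, hn⟩
    have h1 : trZ γ ^ 2 - 4 = (p : ℤ) ^ (2 * j + 2) * n := by rw [← hn]; ring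
    refine ⟨n, mul_emod_four_of_odd_sq (m := trZ γ ^ 2 - 4) hodd (by rw [h1]; ring) ?_, h1⟩
    have := int_sq_emod_four (trZ γ)
    omega

/-- Solutions of `x ^ 2 + y * z = 0` modulo `p ^ 2`. -/
def quadric (p : ℕ) [NeZero p] : Finset (ZMod (p ^ 2) × ZMod (p ^ 2) × ZMod (p ^ 2)) :=
  Finset.univ.filter fun r => r.1 ^ 2 + r.2.1 * r.2.2 = 0

theorem mem_quadric_iff [NeZero p] {x y z : ℤ} :
    ((x : ZMod (p ^ 2)), (y : ZMod (p ^ 2)), (z : ZMod (p ^ 2))) ∈ quadric p ↔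
      (p : ℤ) ^ 2 ∣ x ^ 2 + y * z := by
  have := ZMod.intCast_zmod_eq_zero_iff_dvd (x ^ 2 + y * z) (p ^ 2)
  push_cast at this
  rw [← this]
  simp [quadric]

theorem mem_scalarDisc_iff_of_coord [NeZero p] (hp : p.Prime) (h2 : p ≠ 2) {j : ℕ} (hj : 1 ≤ j)
    {γ : SL2Z} {e : ℤ} (he : e = 1 ∨ e = -1) {x y z : ℤ} (hx : γ 0 0 = e + p ^ j * x)
    (hy : γ 0 1 = p ^ j * y) (hz : γ 1 0 = p ^ j * z) (hγ : γ ∈ scalarMod p j) :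
    γ ∈ scalarDisc p j ↔ (p : ℤ) ^ 2 ∣ x ^ 2 + y * z := by
  have hp' := Nat.prime_iff_prime_int.1 hp
  have he2 : e ^ 2 = 1 := by rcases he with rfl | rfl <;> norm_num
  have hpj : (p : ℤ) ∣ p ^ j := dvd_pow_self _ (by omega)
  have hkey := entry_mul_trZ_sub γ he2
  have hw : γ 0 0 * (trZ γ - 2 * e) = p ^ (2 * j) * (x ^ 2 + y * z) := by
    rw [hkey, hx, hy, hz]; ring
  have hpe : ¬ (p : ℤ) ∣ e := by
    intro h
    refine hp'.not_isUnit (isUnit_of_dvd_one ?_)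
    rw [← he2]; exact h.trans (dvd_pow_self e two_ne_zero)
  have ha : ¬ (p : ℤ) ∣ γ 0 0 := by
    rw [hx]; exact fun h => hpe ((dvd_add_left (hpj.mul_right x)).1 h)
  have htm : (p : ℤ) ∣ trZ γ - 2 * e := by
    have h1 : trZ γ - 2 * e = (γ 1 1 - γ 0 0) + p ^ j * (2 * x) := by
      unfold trZ; linear_combination 2 * hx
    rw [h1]
    exact dvd_add (hpj.trans (mem_scalarMod_iff.1 hγ).2.1) (hpj.mul_right _)
  have htp : ¬ (p : ℤ) ∣ trZ γ + 2 * e := by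
    intro h
    have h1 : (p : ℤ) ∣ 2 ^ 2 * e := by
      have := dvd_sub h htm
      ring_nf at this ⊢; exact this
    exact (hp'.dvd_or_dvd h1).elim (not_dvd_two_pow hp h2 2) hpe
  rw [mem_scalarDisc_iff_of_odd hp h2, and_iff_right hγ]
  have hprod : (trZ γ - 2) * (trZ γ + 2) = (trZ γ - 2 * e) * (trZ γ + 2 * e) := by
    linear_combination 4 * he2
  have hc : ∀ v : ℤ, ¬ (p : ℤ) ∣ v → IsCoprime ((p : ℤ) ^ (2 * j + 2)) v := fun v hv =>
    IsCoprime.pow_left ((hp'.coprime_iff_not_dvd).2 hv)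
  have hc1 : (p : ℤ) ^ (2 * j + 2) ∣ (trZ γ - 2 * e) * (trZ γ + 2 * e) ↔
      (p : ℤ) ^ (2 * j + 2) ∣ trZ γ - 2 * e :=
    ⟨(hc _ htp).dvd_of_dvd_mul_right, fun h => h.mul_right _⟩
  have hc2 : (p : ℤ) ^ (2 * j + 2) ∣ γ 0 0 * (trZ γ - 2 * e) ↔
      (p : ℤ) ^ (2 * j + 2) ∣ trZ γ - 2 * e :=
    ⟨(hc _ ha).dvd_of_dvd_mul_left, fun h => h.mul_left _⟩
  rw [hprod, hc1, ← hc2, hw, pow_add, mul_dvd_mul_iff_left (pow_ne_zero _ hp'.ne_zero)]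

theorem scalarDisc_eq_of_odd [NeZero p] (hp : p.Prime) (h2 : p ≠ 2) {j : ℕ} (hj : 1 ≤ j) :
    scalarDisc p j =
      coordSet 1 (p ^ j) (p ^ 2) (quadric p) ∪ coordSet (-1) (p ^ j) (p ^ 2) (quadric p) := by
  have hU := scalarMod_eq_of_odd hp h2 j
  ext γ
  constructor
  · intro h
    have hγ := scalarDisc_subset p j h
    have hγ' := hγ
    rw [hU] at hγ'
    rcases hγ' with ⟨x, y, z, hx, hy, hz, -⟩ | ⟨x, y, z, hx, hy, hz, -⟩ <;>
      push_cast at hx hy hz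
    · refine .inl ⟨x, y, z, by push_cast; exact hx, by push_cast; exact hy,
        by push_cast; exact hz, mem_quadric_iff.2 ?_⟩
      exact (mem_scalarDisc_iff_of_coord hp h2 hj (.inl rfl) hx hy hz hγ).1 h
    · refine .inr ⟨x, y, z, by push_cast; exact hx, by push_cast; exact hy,
        by push_cast; exact hz, mem_quadric_iff.2 ?_⟩
      exact (mem_scalarDisc_iff_of_coord hp h2 hj (.inr rfl) hx hy hz hγ).1 h
  · intro h
    have hγ : γ ∈ scalarMod p j := by
      rw [hU]
      rcases h with ⟨x, y, z, hx, hy, hz, -⟩ | ⟨x, y, z, hx, hy, hz, -⟩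
      · exact .inl ⟨x, y, z, hx, hy, hz, Finset.mem_univ _⟩
      · exact .inr ⟨x, y, z, hx, hy, hz, Finset.mem_univ _⟩
    rcases h with ⟨x, y, z, hx, hy, hz, h⟩ | ⟨x, y, z, hx, hy, hz, h⟩ <;>
      push_cast at hx hy hz
    · exact (mem_scalarDisc_iff_of_coord hp h2 hj (.inl rfl) hx hy hz hγ).2 (mem_quadric_iff.1 h)
    · exact (mem_scalarDisc_iff_of_coord hp h2 hj (.inr rfl) hx hy hz hγ).2 (mem_quadric_iff.1 h)

theorem scalarDisc_zero_eq_of_odd (hp : p.Prime) (h2 : p ≠ 2) : scalarDisc p 0 =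
    {γ | (trZ γ : ZMod (p ^ 2)) = 2 * ((1 : ℤ) : ZMod (p ^ 2))} ∪
      {γ | (trZ γ : ZMod (p ^ 2)) = 2 * ((-1 : ℤ) : ZMod (p ^ 2))} := by
  ext γ
  have hcast : ∀ e : ℤ, (trZ γ : ZMod (p ^ 2)) = 2 * (e : ZMod (p ^ 2)) ↔
      (p : ℤ) ^ 2 ∣ trZ γ - 2 * e := by
    intro e
    have := ZMod.intCast_eq_intCast_iff_dvd_sub (2 * e) (trZ γ) (p ^ 2)
    push_cast at this
    rw [← this, eq_comm]
  rw [mem_scalarDisc_iff_of_odd hp h2, Set.mem_union, Set.mem_ofPred_eq, Set.mem_ofPred_eq, hcast,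
    hcast]
  have h0 : γ ∈ scalarMod p 0 := by simp [mem_scalarMod_iff]
  rw [and_iff_right h0]
  have e1 : trZ γ - 2 * 1 = trZ γ - 2 := by ring
  have e2 : trZ γ - 2 * -1 = trZ γ + 2 := by ring
  rw [e1, e2]
  refine ⟨pow_dvd_or_of_dvd_mul hp fun h => not_dvd_two_pow hp h2 2 ?_, ?_⟩
  · rw [← dvd_neg]; ring_nf at h ⊢; exact h
  · rintro (h | h)
    · exact h.mul_right _
    · exact h.mul_left _

end Odd

/-- The local densities at `p` of the sets of matrices whose order is not maximal at `p` exist,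
with sum `b`. -/
def HasLocalDensities (p : ℕ) (b : ℝ) : Prop :=
  ∃ β υ : ℕ → ℝ, (∀ j, LocalDens p (scalarDisc p j \ scalarMod p (j + 1)) (β j)) ∧
    (∀ᶠ j in atTop, LocalDens p (scalarMod p (j + 1)) (υ j)) ∧ Tendsto υ atTop (𝓝 0) ∧ HasSum β b

section Odd

variable {p : ℕ}

theorem not_pow_dvd_two_of_odd (hp : p.Prime) (h2 : p ≠ 2) {j : ℕ} (hj : 1 ≤ j) :
    ¬ ((p ^ j : ℕ) : ℤ) ∣ 2 := by
  intro h
  push_cast at h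
  refine not_dvd_two_pow hp h2 1 ((dvd_pow_self (p : ℤ) (by omega : j ≠ 0)).trans ?_)
  simpa using h

theorem localDens_scalarMod_of_odd (hp : p.Prime) (h2 : p ≠ 2) (j : ℕ) :
    LocalDens p (scalarMod p (j + 1)) (2 / (slCard p : ℝ) * (1 / (p : ℝ) ^ 3) ^ j) := by
  have h := localDens_coordSet_union_neg hp (Nat.le_add_left 1 j)
    (not_pow_dvd_two_of_odd hp h2 (Nat.le_add_left 1 j)) 0 Finset.univ
  rw [← scalarMod_eq_of_odd hp h2, add_zero, slCard_prime_pow hp] at h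
  convert h using 1
  simp only [Finset.card_univ, Fintype.card_prod, ZMod.card, pow_zero]
  rw [one_div, inv_pow, ← pow_mul, ← div_eq_mul_inv, div_div, mul_comm ((p : ℝ) ^ _)]
  norm_num

theorem localDens_scalarDisc_of_odd (hp : p.Prime) (h2 : p ≠ 2) (j : ℕ) :
    LocalDens p (scalarDisc p j)
      (2 * ((p : ℝ) ^ 4 + p ^ 3 - p ^ 2) / ((p : ℝ) ^ (3 * (j + 1)) * slCard p)) := by
  have : NeZero p := ⟨hp.ne_zero⟩
  have hQ : ((quadric p).card : ℝ) = (p : ℝ) ^ 4 + p ^ 3 - p ^ 2 := card_quadric_zmod_sq hp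
  rcases Nat.eq_zero_or_pos j with rfl | hj
  · have h1 := hasDens_trace (N := p ^ 2) (e := 1) (by norm_num)
    have h3 := hasDens_trace (N := p ^ 2) (e := -1) (by norm_num)
    have hdisj : Disjoint {γ : SL2Z | (trZ γ : ZMod (p ^ 2)) = 2 * ((1 : ℤ) : ZMod (p ^ 2))}
        {γ | (trZ γ : ZMod (p ^ 2)) = 2 * ((-1 : ℤ) : ZMod (p ^ 2))} := by
      rw [Set.disjoint_left]
      intro γ ha hb
      rw [Set.mem_ofPred_eq] at ha hb
      have h4 : ((4 : ℤ) : ZMod (p ^ 2)) = 0 := by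
        push_cast at ha hb ⊢
        linear_combination hb - ha
      rw [ZMod.intCast_zmod_eq_zero_iff_dvd] at h4
      refine not_dvd_two_pow hp h2 2 (dvd_trans ?_ h4)
      push_cast
      exact dvd_pow_self _ two_ne_zero
    have h := LocalDens.disjUnion (p := p) ⟨⟨2, h1.1⟩, h1.2⟩ ⟨⟨2, h3.1⟩, h3.2⟩ hdisj
    rw [← scalarDisc_zero_eq_of_odd hp h2, ← two_mul, ← mul_div_assoc, card_quadric_zmod_sq hp,
      slCard_prime_pow hp 1] at h
    exact h
  · have h := localDens_coordSet_union_neg hp hj (not_pow_dvd_two_of_odd hp h2 hj) 2 (quadric p)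
    rw [← scalarDisc_eq_of_odd hp h2 hj, hQ, show j + 2 = j + 1 + 1 from rfl,
      slCard_prime_pow hp] at h
    exact h

theorem hasLocalDensities_of_odd (hp : p.Prime) (h2 : p ≠ 2) :
    HasLocalDensities p (2 * p / ((p : ℝ) ^ 3 - 1)) := by
  have hp1 : (1 : ℝ) < p := by exact_mod_cast hp.one_lt
  have hp0 : (p : ℝ) ≠ 0 := by positivity
  have hp2 : (p : ℝ) ^ 2 - 1 ≠ 0 := by nlinarith
  have hp3' : 1 < (p : ℝ) ^ 3 := one_lt_pow₀ hp1 three_ne_zero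
  have hp3 : (p : ℝ) ^ 3 - 1 ≠ 0 := by linarith
  have hr0 : 0 ≤ 1 / (p : ℝ) ^ 3 := by positivity
  have hr1 : 1 / (p : ℝ) ^ 3 < 1 := by rw [div_lt_one (by positivity)]; exact hp3'
  refine ⟨fun j => 2 / (p : ℝ) ^ 2 * (1 / (p : ℝ) ^ 3) ^ j,
    fun j => 2 / (slCard p : ℝ) * (1 / (p : ℝ) ^ 3) ^ j, fun j => ?_,
    .of_forall fun j => localDens_scalarMod_of_odd hp h2 j, ?_, ?_⟩
  · convert (localDens_scalarDisc_of_odd hp h2 j).sdiff (localDens_scalarMod_of_odd hp h2 j)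
      (scalarMod_succ_subset p j) using 1
    have hq : (p : ℝ) ^ (3 * j) ≠ 0 := pow_ne_zero _ hp0
    have hr : (1 / (p : ℝ) ^ 3) ^ j = 1 / (p : ℝ) ^ (3 * j) := by
      rw [_root_.one_div_pow, ← pow_mul]
    simp only [slCard_prime hp, hr, mul_add, pow_add]
    generalize (p : ℝ) ^ (3 * j) = q at hq ⊢
    field_simp
    ring
  · simpa using (tendsto_pow_atTop_nhds_zero_of_lt_one hr0 hr1).const_mul (2 / (slCard p : ℝ))
  · have h : 2 * (p : ℝ) / ((p : ℝ) ^ 3 - 1) = 2 / (p : ℝ) ^ 2 * (1 - 1 / (p : ℝ) ^ 3)⁻¹ := by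
      have h4 : 1 - 1 / (p : ℝ) ^ 3 = ((p : ℝ) ^ 3 - 1) / (p : ℝ) ^ 3 := by field_simp
      rw [h4]
      field_simp
    rw [h]
    exact (hasSum_geometric_of_lt_one hr0 hr1).mul_left (2 / (p : ℝ) ^ 2)

end Odd

/-! ### Local densities at the prime two -/

theorem isCoprime_two_pow_of_odd {a : ℤ} (ha : a % 2 = 1) (k : ℕ) : IsCoprime ((2 : ℤ) ^ k) a :=
  IsCoprime.pow_left ⟨-(a / 2), 1, by omega⟩

theorem exists_sign_four_dvd_sub {a : ℤ} (ha : a % 2 = 1) :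
    ∃ e : ℤ, (e = 1 ∨ e = -1) ∧ (4 : ℤ) ∣ a - e := by
  rcases (by omega : a % 4 = 1 ∨ a % 4 = 3) with h | h
  · exact ⟨1, .inl rfl, by omega⟩
  · exact ⟨-1, .inr rfl, by omega⟩

theorem sq_eq_one_of_sign {e : ℤ} (he : e = 1 ∨ e = -1) : e ^ 2 = 1 := by
  rcases he with rfl | rfl <;> norm_num

theorem mem_scalarMod_two_iff {j : ℕ} {γ : SL2Z} : γ ∈ scalarMod 2 j ↔
    (2 : ℤ) ^ j ∣ γ 1 0 ∧ (2 : ℤ) ^ j ∣ γ 1 1 - γ 0 0 ∧ (2 : ℤ) ^ j ∣ γ 0 1 := by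
  simpa using mem_scalarMod_iff (p := 2) (j := j) (γ := γ)

theorem mem_scalarDisc_two_iff {j : ℕ} {γ : SL2Z} : γ ∈ scalarDisc 2 j ↔
    γ ∈ scalarMod 2 j ∧
      ∃ n : ℤ, (n % 4 = 0 ∨ n % 4 = 1) ∧ trZ γ ^ 2 - 4 = (2 : ℤ) ^ (2 * j + 2) * n := by
  simp [scalarDisc, scalarMod]

theorem entry_odd_of_mem_scalarMod_two {j : ℕ} (hj : 1 ≤ j) {γ : SL2Z} (h : γ ∈ scalarMod 2 j) :
    γ 0 0 % 2 = 1 := by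
  have hdet := det_entries γ
  obtain ⟨y, hy⟩ := (dvd_pow_self (2 : ℤ) (by omega : j ≠ 0)).trans (mem_scalarMod_two_iff.1 h).2.2
  by_contra ha
  obtain ⟨k, hk⟩ : (2 : ℤ) ∣ γ 0 0 := by omega
  have : 2 * (k * γ 1 1 - y * γ 1 0) = 1 := by
    rw [hk, hy] at hdet
    linarith
  omega

theorem entry_odd_of_coord {j : ℕ} (hj : 1 ≤ j) {a e x : ℤ} (he : e = 1 ∨ e = -1)
    (hx : a = e + 2 ^ j * x) : a % 2 = 1 := by
  obtain ⟨k, hk⟩ := dvd_pow_self (2 : ℤ) (by omega : j ≠ 0)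
  rw [hx, hk, mul_assoc]
  omega

/-- Trace and scalar part of a matrix congruent to `± 1` modulo `2 ^ j`. -/
theorem exists_trace_coord {j : ℕ} (hj : 1 ≤ j) {γ : SL2Z} {e x y z : ℤ} (he : e = 1 ∨ e = -1)
    (hx : γ 0 0 = e + 2 ^ j * x) (hy : γ 0 1 = 2 ^ j * y) (hz : γ 1 0 = 2 ^ j * z) :
    γ ∈ scalarMod 2 j ∧
      ∃ v, trZ γ - 2 * e = 2 ^ (2 * j) * v ∧ γ 0 0 * v = x ^ 2 + y * z := by
  have hw : γ 0 0 * (trZ γ - 2 * e) = 2 ^ (2 * j) * (x ^ 2 + y * z) := by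
    rw [entry_mul_trZ_sub γ (sq_eq_one_of_sign he), hx, hy, hz]; ring
  obtain ⟨v, hv⟩ : (2 : ℤ) ^ (2 * j) ∣ trZ γ - 2 * e :=
    (isCoprime_two_pow_of_odd (entry_odd_of_coord hj he hx) _).dvd_of_dvd_mul_left
      (Dvd.intro _ hw.symm)
  refine ⟨mem_scalarMod_two_iff.2 ⟨⟨z, hz⟩, ⟨2 ^ j * v - 2 * x, ?_⟩, ⟨y, hy⟩⟩, v, hv, ?_⟩
  · unfold trZ at hv
    linear_combination hv - 2 * hx
  · refine mul_left_cancel₀ (pow_ne_zero (2 * j) (two_ne_zero (α := ℤ))) ?_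
    rw [← hw, hv]; ring

theorem scalarDisc_two_zero_eq :
    scalarDisc 2 0 = {γ | (trZ γ : ZMod (2 ^ 2)) = 2 * ((1 : ℤ) : ZMod (2 ^ 2))} := by
  ext γ
  have hcast : (trZ γ : ZMod (2 ^ 2)) = 2 * ((1 : ℤ) : ZMod (2 ^ 2)) ↔ (4 : ℤ) ∣ trZ γ - 2 := by
    have := ZMod.intCast_eq_intCast_iff_dvd_sub 2 (trZ γ) (2 ^ 2)
    push_cast at this ⊢
    norm_num at this ⊢
    rw [← this, eq_comm]
  have h0 : γ ∈ scalarMod 2 0 := by simp [mem_scalarMod_two_iff]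
  rw [mem_scalarDisc_two_iff, and_iff_right h0, Set.mem_ofPred_eq, hcast]
  constructor
  · rintro ⟨n, hn, h⟩
    norm_num at h
    rcases Int.emod_two_eq_zero_or_one (trZ γ) with ht | ht
    · obtain ⟨s, hs⟩ : ∃ s, trZ γ = 2 * s := ⟨trZ γ / 2, by omega⟩
      rw [hs] at h ⊢
      have h1 : n = s ^ 2 - 1 := by linarith
      rcases Int.emod_two_eq_zero_or_one s with h2 | h2
      · obtain ⟨l, rfl⟩ : ∃ l, s = 2 * l := ⟨s / 2, by omega⟩
        ring_nf at h1; omega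
      · omega
    · obtain ⟨s, hs⟩ : ∃ s, trZ γ = 2 * s + 1 := ⟨trZ γ / 2, by omega⟩
      rw [hs] at h
      ring_nf at h; omega
  · rintro ⟨k, hk⟩
    refine ⟨4 * (k ^ 2 + k), .inl (by omega), ?_⟩
    rw [show trZ γ = 4 * k + 2 by omega]
    ring

theorem scalarMod_two_one_eq : scalarMod 2 1 =
    {γ | ((γ 0 0 : ZMod (2 ^ 1)), (γ 0 1 : ZMod (2 ^ 1)), (γ 1 0 : ZMod (2 ^ 1))) ∈
      ({(1, 0, 0)} : Finset (ZMod (2 ^ 1) × ZMod (2 ^ 1) × ZMod (2 ^ 1)))} := by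
  ext γ
  have hdet := congrArg (Int.cast : ℤ → ZMod 2) (det_entries γ)
  have h : ∀ a b c d : ZMod 2, a * d - b * c = 1 → ((c = 0 ∧ d - a = 0 ∧ b = 0) ↔
      (a, b, c) ∈ ({(1, 0, 0)} : Finset (ZMod 2 × ZMod 2 × ZMod 2))) := by decide
  push_cast at hdet
  rw [mem_scalarMod_two_iff, Set.mem_ofPred_eq]
  refine Iff.trans ?_ (h _ _ _ _ hdet)
  have e := fun m : ℤ => ZMod.intCast_zmod_eq_zero_iff_dvd m 2
  rw [← Int.cast_sub, e, e, e]
  norm_num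

theorem scalarMod_two_two_eq : scalarMod 2 2 =
    {γ | ((γ 0 0 : ZMod (2 ^ 2)), (γ 0 1 : ZMod (2 ^ 2)), (γ 1 0 : ZMod (2 ^ 2))) ∈
      ({(1, 0, 0), (3, 0, 0)} : Finset (ZMod (2 ^ 2) × ZMod (2 ^ 2) × ZMod (2 ^ 2)))} := by
  ext γ
  have hdet := congrArg (Int.cast : ℤ → ZMod 4) (det_entries γ)
  have h : ∀ a b c d : ZMod 4, a * d - b * c = 1 → ((c = 0 ∧ d - a = 0 ∧ b = 0) ↔
      (a, b, c) ∈ ({(1, 0, 0), (3, 0, 0)} : Finset (ZMod 4 × ZMod 4 × ZMod 4))) := by decide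
  push_cast at hdet
  rw [mem_scalarMod_two_iff, Set.mem_ofPred_eq]
  refine Iff.trans ?_ (h _ _ _ _ hdet)
  have e := fun m : ℤ => ZMod.intCast_zmod_eq_zero_iff_dvd m 4
  rw [← Int.cast_sub, e, e, e]
  norm_num

theorem scalarMod_two_succ_eq {j : ℕ} (hj : 2 ≤ j) : scalarMod 2 (j + 1) =
    coordSet 1 (2 ^ j) (2 ^ 1) {(0, 0, 0), (1, 0, 0)} ∪
      coordSet (-1) (2 ^ j) (2 ^ 1) {(0, 0, 0), (1, 0, 0)} := by
  have hQ : ∀ x y z : ℤ, ((x : ZMod (2 ^ 1)), (y : ZMod (2 ^ 1)), (z : ZMod (2 ^ 1))) ∈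
      ({(0, 0, 0), (1, 0, 0)} : Finset (ZMod (2 ^ 1) × ZMod (2 ^ 1) × ZMod (2 ^ 1))) ↔
      (2 : ℤ) ∣ y ∧ (2 : ℤ) ∣ z := by
    intro x y z
    have h : ∀ x y z : ZMod 2, (x, y, z) ∈
        ({(0, 0, 0), (1, 0, 0)} : Finset (ZMod 2 × ZMod 2 × ZMod 2)) ↔ y = 0 ∧ z = 0 := by decide
    refine (h x y z).trans ?_
    rw [ZMod.intCast_zmod_eq_zero_iff_dvd, ZMod.intCast_zmod_eq_zero_iff_dvd, Nat.cast_ofNat]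
  have hmem : ∀ γ : SL2Z, (γ ∈ coordSet 1 (2 ^ j) (2 ^ 1) {(0, 0, 0), (1, 0, 0)} ∪
      coordSet (-1) (2 ^ j) (2 ^ 1) {(0, 0, 0), (1, 0, 0)}) ↔
      ∃ e : ℤ, (e = 1 ∨ e = -1) ∧ ∃ x y z : ℤ, γ 0 0 = e + 2 ^ j * x ∧
        γ 0 1 = 2 ^ (j + 1) * y ∧ γ 1 0 = 2 ^ (j + 1) * z := by
    intro γ
    simp only [Set.mem_union, coordSet, Set.mem_ofPred_eq, hQ, Nat.cast_pow, Nat.cast_ofNat]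
    constructor
    · rintro (⟨x, y, z, hx, hy, hz, ⟨y', rfl⟩, ⟨z', rfl⟩⟩ |
        ⟨x, y, z, hx, hy, hz, ⟨y', rfl⟩, ⟨z', rfl⟩⟩)
      · exact ⟨1, .inl rfl, x, y', z', hx, by rw [hy]; ring, by rw [hz]; ring⟩
      · exact ⟨-1, .inr rfl, x, y', z', hx, by rw [hy]; ring, by rw [hz]; ring⟩
    · rintro ⟨e, rfl | rfl, x, y, z, hx, hy, hz⟩
      · exact .inl ⟨x, 2 * y, 2 * z, hx, by rw [hy]; ring, by rw [hz]; ring,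
          dvd_mul_right _ _, dvd_mul_right _ _⟩
      · exact .inr ⟨x, 2 * y, 2 * z, hx, by rw [hy]; ring, by rw [hz]; ring,
          dvd_mul_right _ _, dvd_mul_right _ _⟩
  ext γ
  have hdet := det_entries γ
  rw [hmem, mem_scalarMod_two_iff]
  constructor
  · intro h
    have ha := entry_odd_of_mem_scalarMod_two (by omega) (mem_scalarMod_two_iff.2 h)
    obtain ⟨e, he, k, hk⟩ := exists_sign_four_dvd_sub ha
    have he2 := sq_eq_one_of_sign he
    obtain ⟨⟨z, hz⟩, ⟨w, hw⟩, ⟨y, hy⟩⟩ := h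
    have h1 : (2 : ℤ) ^ j ∣ (2 * k + e) * (γ 0 0 - e) := by
      refine ⟨2 ^ (j + 1) * y * z - γ 0 0 * w, ?_⟩
      have h2 : 2 * ((2 * k + e) * (γ 0 0 - e)) =
          2 * (2 ^ j * (2 ^ (j + 1) * y * z - γ 0 0 * w)) := by
        have h3 : 2 * (2 * k + e) = γ 0 0 + e := by linarith
        rw [← mul_assoc, h3]
        rw [hy, hz] at hdet
        linear_combination hdet - γ 0 0 * hw - he2
      linarith
    obtain ⟨x, hx⟩ := (isCoprime_two_pow_of_odd (a := 2 * k + e)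
      (by rcases he with rfl | rfl <;> omega) j).dvd_of_dvd_mul_left h1
    exact ⟨e, he, x, y, z, by linarith, hy, hz⟩
  · rintro ⟨e, he, x, y, z, hx, hy, hz⟩
    refine ⟨⟨z, hz⟩, ?_, ⟨y, hy⟩⟩
    refine (isCoprime_two_pow_of_odd (entry_odd_of_coord (by omega) he hx) _).dvd_of_dvd_mul_left
      (?_ : (2 : ℤ) ^ (j + 1) ∣ γ 0 0 * _)
    obtain ⟨i, rfl⟩ : ∃ i, j = i + 1 := ⟨j - 1, by omega⟩
    have he2 := sq_eq_one_of_sign he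
    refine ⟨2 ^ (i + 1 + 1) * y * z - e * x - 2 ^ i * x ^ 2, ?_⟩
    rw [hy, hz] at hdet
    have h1 : γ 0 0 ^ 2 = (e + 2 ^ (i + 1) * x) ^ 2 := by rw [hx]
    ring_nf at hdet h1 he2 ⊢
    linear_combination hdet - h1 - he2

/-- Coordinates modulo `4` of the matrices congruent to `1` modulo `2` in `scalarDisc 2 1`. -/
def discTwoOne : Finset (ZMod (2 ^ 2) × ZMod (2 ^ 2) × ZMod (2 ^ 2)) :=
  Finset.univ.filter fun r => r.1 ^ 2 + r.2.1 * r.2.2 = 0 ∨ r.1 ^ 2 + r.2.1 * r.2.2 = -(1 + 2 * r.1)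

/-- Coordinates modulo `4` of the matrices congruent to `± 1` modulo `2 ^ j` in
`scalarDisc 2 j` for `j ≥ 2`. -/
def discTwo : Finset (ZMod (2 ^ 2) × ZMod (2 ^ 2) × ZMod (2 ^ 2)) :=
  Finset.univ.filter fun r => r.1 ^ 2 + r.2.1 * r.2.2 = 0 ∨ r.1 ^ 2 + r.2.1 * r.2.2 = 1

theorem card_discTwoOne : discTwoOne.card = 40 := by
  show (Finset.univ.filter fun r : ZMod 4 × ZMod 4 × ZMod 4 =>
    r.1 ^ 2 + r.2.1 * r.2.2 = 0 ∨ r.1 ^ 2 + r.2.1 * r.2.2 = -(1 + 2 * r.1)).card = 40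
  decide

theorem card_discTwo : discTwo.card = 40 := by
  show (Finset.univ.filter fun r : ZMod 4 × ZMod 4 × ZMod 4 =>
    r.1 ^ 2 + r.2.1 * r.2.2 = 0 ∨ r.1 ^ 2 + r.2.1 * r.2.2 = 1).card = 40
  decide

theorem cast_zmod_four_eq_iff (m n : ℤ) : (m : ZMod (2 ^ 2)) = n ↔ (4 : ℤ) ∣ n - m := by
  rw [ZMod.intCast_eq_intCast_iff_dvd_sub]
  norm_num

theorem mem_discTwoOne_iff {x y z : ℤ} :
    ((x : ZMod (2 ^ 2)), (y : ZMod (2 ^ 2)), (z : ZMod (2 ^ 2))) ∈ discTwoOne ↔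
      (4 : ℤ) ∣ x ^ 2 + y * z ∨ (4 : ℤ) ∣ x ^ 2 + y * z + (1 + 2 * x) := by
  have h1 := cast_zmod_four_eq_iff (x ^ 2 + y * z) 0
  have h2 := cast_zmod_four_eq_iff (x ^ 2 + y * z) (-(1 + 2 * x))
  rw [zero_sub, dvd_neg] at h1
  rw [show -(1 + 2 * x) - (x ^ 2 + y * z) = -(x ^ 2 + y * z + (1 + 2 * x)) by ring, dvd_neg] at h2
  rw [← h1, ← h2]
  simp [discTwoOne]

theorem mem_discTwo_iff {x y z : ℤ} :
    ((x : ZMod (2 ^ 2)), (y : ZMod (2 ^ 2)), (z : ZMod (2 ^ 2))) ∈ discTwo ↔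
      (x ^ 2 + y * z) % 4 = 0 ∨ (x ^ 2 + y * z) % 4 = 1 := by
  have h1 := cast_zmod_four_eq_iff (x ^ 2 + y * z) 0
  have h2 := cast_zmod_four_eq_iff (x ^ 2 + y * z) 1
  rw [show (x ^ 2 + y * z) % 4 = 0 ↔ (4 : ℤ) ∣ 0 - (x ^ 2 + y * z) by omega,
    show (x ^ 2 + y * z) % 4 = 1 ↔ (4 : ℤ) ∣ 1 - (x ^ 2 + y * z) by omega, ← h1, ← h2]
  simp [discTwo]

theorem scalarDisc_two_one_eq : scalarDisc 2 1 = coordSet 1 (2 ^ 1) (2 ^ 2) discTwoOne := by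
  have key : ∀ (γ : SL2Z) (x y z : ℤ), γ 0 0 = 1 + 2 ^ 1 * x → γ 0 1 = 2 ^ 1 * y →
      γ 1 0 = 2 ^ 1 * z → (γ ∈ scalarDisc 2 1 ↔
        (4 : ℤ) ∣ x ^ 2 + y * z ∨ (4 : ℤ) ∣ x ^ 2 + y * z + (1 + 2 * x)) := by
    intro γ x y z hx hy hz
    obtain ⟨hmem, v, hv, hw⟩ := exists_trace_coord le_rfl (.inl rfl) hx hy hz
    have ha : IsCoprime ((2 : ℤ) ^ 2) (γ 0 0) :=
      isCoprime_two_pow_of_odd (entry_odd_of_coord le_rfl (.inl rfl) hx) 2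
    have h1 : (4 : ℤ) ∣ x ^ 2 + y * z ↔ (4 : ℤ) ∣ v := by
      rw [← hw]
      exact ⟨fun h => ha.dvd_of_dvd_mul_left (by simpa using h), fun h => h.mul_left _⟩
    have h2 : (4 : ℤ) ∣ x ^ 2 + y * z + (1 + 2 * x) ↔ (4 : ℤ) ∣ v + 1 := by
      rw [← hw, show γ 0 0 * v + (1 + 2 * x) = γ 0 0 * (v + 1) by rw [hx]; ring]
      exact ⟨fun h => ha.dvd_of_dvd_mul_left (by simpa using h), fun h => h.mul_left _⟩
    have h3 : trZ γ ^ 2 - 4 = 2 ^ (2 * 1 + 2) * (v * (v + 1)) := by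
      have : trZ γ = 2 + 4 * v := by norm_num at hv; linarith
      rw [this]; ring
    rw [h1, h2, mem_scalarDisc_two_iff, and_iff_right hmem, h3]
    have h4 : (v * (v + 1)) % 4 = ((v % 4) * (v % 4 + 1)) % 4 := by
      exact (Int.mod_modEq v 4).symm.mul ((Int.mod_modEq v 4).symm.add_right 1)
    constructor
    · rintro ⟨n, hn, h⟩
      rw [← mul_left_cancel₀ (pow_ne_zero _ two_ne_zero) h, h4] at hn
      have h5 : v % 4 = 0 ∨ v % 4 = 1 ∨ v % 4 = 2 ∨ v % 4 = 3 := by omega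
      rcases h5 with h5 | h5 | h5 | h5 <;> rw [h5] at hn <;> omega
    · intro h
      refine ⟨v * (v + 1), .inl ?_, rfl⟩
      rw [h4]
      rcases (by omega : v % 4 = 0 ∨ v % 4 = 3) with h5 | h5 <;> rw [h5] <;> norm_num
  ext γ
  constructor
  · intro h
    have hmem := scalarDisc_subset 2 1 h
    have ha := entry_odd_of_mem_scalarMod_two le_rfl hmem
    obtain ⟨⟨z, hz⟩, -, ⟨y, hy⟩⟩ := mem_scalarMod_two_iff.1 hmem
    have hx : γ 0 0 = 1 + 2 ^ 1 * (γ 0 0 / 2) := by omega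
    exact ⟨γ 0 0 / 2, y, z, by simpa using hx, by simpa using hy, by simpa using hz,
      mem_discTwoOne_iff.2 ((key γ _ y z hx hy hz).1 h)⟩
  · rintro ⟨x, y, z, hx, hy, hz, h⟩
    exact (key γ x y z (by simpa using hx) (by simpa using hy) (by simpa using hz)).2
      (mem_discTwoOne_iff.1 h)

theorem mem_scalarDisc_two_iff_of_coord {j : ℕ} (hj : 2 ≤ j) {γ : SL2Z} {e x y z : ℤ}
    (he : e = 1 ∨ e = -1) (hx : γ 0 0 = e + 2 ^ j * x) (hy : γ 0 1 = 2 ^ j * y)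
    (hz : γ 1 0 = 2 ^ j * z) :
    γ ∈ scalarDisc 2 j ↔ (x ^ 2 + y * z) % 4 = 0 ∨ (x ^ 2 + y * z) % 4 = 1 := by
  obtain ⟨hmem, v, hv, hw⟩ := exists_trace_coord (by omega) he hx hy hz
  obtain ⟨i, rfl⟩ : ∃ i, j = i + 2 := ⟨j - 2, by omega⟩
  have he2 := sq_eq_one_of_sign he
  have h1 : trZ γ ^ 2 - 4 =
      2 ^ (2 * (i + 2) + 2) * (v * e + 4 * (2 ^ (2 * i) * v ^ 2)) := by
    have : trZ γ = 2 * e + 2 ^ (2 * (i + 2)) * v := by linarith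
    rw [this]
    ring_nf
    linear_combination 4 * he2
  have h2 : (v * e + 4 * (2 ^ (2 * i) * v ^ 2)) % 4 = (x ^ 2 + y * z) % 4 := by
    have h3 : x ^ 2 + y * z = v * e + 4 * (2 ^ i * x * v) := by
      rw [← hw, hx]; ring
    rw [h3]
    omega
  rw [mem_scalarDisc_two_iff, and_iff_right hmem, h1, ← h2]
  constructor
  · rintro ⟨n, hn, h⟩
    rwa [mul_left_cancel₀ (pow_ne_zero _ two_ne_zero) h]
  · exact fun h => ⟨_, h, rfl⟩

theorem exists_coord_of_mem_scalarDisc_two {j : ℕ} (hj : 2 ≤ j) {γ : SL2Z}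
    (h : γ ∈ scalarDisc 2 j) :
    ∃ e : ℤ, (e = 1 ∨ e = -1) ∧ ∃ x y z : ℤ, γ 0 0 = e + 2 ^ j * x ∧ γ 0 1 = 2 ^ j * y ∧
      γ 1 0 = 2 ^ j * z := by
  obtain ⟨hmem, n, -, hn⟩ := mem_scalarDisc_two_iff.1 h
  have ha := entry_odd_of_mem_scalarMod_two (by omega) hmem
  obtain ⟨⟨z, hz⟩, -, ⟨y, hy⟩⟩ := mem_scalarMod_two_iff.1 hmem
  obtain ⟨e, he, k, hk⟩ := exists_sign_four_dvd_sub ha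
  have he2 := sq_eq_one_of_sign he
  have hkey := entry_mul_trZ_sub γ he2
  obtain ⟨l, hl⟩ : (2 : ℤ) ^ 4 ∣ trZ γ - 2 * e := by
    refine (isCoprime_two_pow_of_odd ha 4).dvd_of_dvd_mul_left (?_ : _ ∣ γ 0 0 * _)
    obtain ⟨i, rfl⟩ : ∃ i, j = i + 2 := ⟨j - 2, by omega⟩
    refine ⟨k ^ 2 + 2 ^ (2 * i) * y * z, ?_⟩
    rw [hkey, hk, hy, hz]; ring
  have h1 : (2 : ℤ) ^ (2 * j) ∣ (4 * l + e) * (trZ γ - 2 * e) := by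
    refine ⟨n, ?_⟩
    have h2 : 4 * ((4 * l + e) * (trZ γ - 2 * e)) = 4 * (2 ^ (2 * j) * n) := by
      have h3 : 4 * (4 * l + e) = trZ γ + 2 * e := by linarith
      rw [← mul_assoc, h3]
      rw [pow_add] at hn
      linear_combination hn - 4 * he2
    linarith
  have h2 := (isCoprime_two_pow_of_odd (a := 4 * l + e)
    (by rcases he with rfl | rfl <;> omega) (2 * j)).dvd_of_dvd_mul_left h1
  have h3 : ((2 : ℤ) ^ j) ^ 2 ∣ (γ 0 0 - e) ^ 2 := by
    rw [← pow_mul, mul_comm j,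
      show (γ 0 0 - e) ^ 2 = γ 0 0 * (trZ γ - 2 * e) - 2 ^ (2 * j) * (y * z) by
        rw [hkey, hy, hz]; ring]
    exact dvd_sub (h2.mul_left _) (dvd_mul_right _ _)
  obtain ⟨x, hx⟩ := (Int.pow_dvd_pow_iff two_ne_zero).1 h3
  exact ⟨e, he, x, y, z, by linarith, hy, hz⟩

theorem scalarDisc_two_eq {j : ℕ} (hj : 2 ≤ j) : scalarDisc 2 j =
    coordSet 1 (2 ^ j) (2 ^ 2) discTwo ∪ coordSet (-1) (2 ^ j) (2 ^ 2) discTwo := by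
  ext γ
  constructor
  · intro h
    obtain ⟨e, he, x, y, z, hx, hy, hz⟩ := exists_coord_of_mem_scalarDisc_two hj h
    have hQ := mem_discTwo_iff.2 ((mem_scalarDisc_two_iff_of_coord hj he hx hy hz).1 h)
    rcases he with rfl | rfl
    · exact .inl ⟨x, y, z, by simpa using hx, by simpa using hy, by simpa using hz, hQ⟩
    · exact .inr ⟨x, y, z, by simpa using hx, by simpa using hy, by simpa using hz, hQ⟩
  · rintro (⟨x, y, z, hx, hy, hz, h⟩ | ⟨x, y, z, hx, hy, hz, h⟩)
    · exact (mem_scalarDisc_two_iff_of_coord hj (.inl rfl) (by simpa using hx) (by simpa using hy)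
        (by simpa using hz)).2 (mem_discTwo_iff.1 h)
    · exact (mem_scalarDisc_two_iff_of_coord hj (.inr rfl) (by simpa using hx) (by simpa using hy)
        (by simpa using hz)).2 (mem_discTwo_iff.1 h)

theorem slCard_two_pow (k : ℕ) : (slCard (2 ^ (k + 1)) : ℝ) = 8 ^ k * 6 := by
  have h := slCard_prime_pow Nat.prime_two k
  rw [slCard_prime Nat.prime_two, pow_mul] at h
  norm_num at h ⊢
  exact h

theorem not_two_pow_dvd_two {j : ℕ} (hj : 2 ≤ j) : ¬ ((2 ^ j : ℕ) : ℤ) ∣ 2 := by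
  intro h
  have h1 : (2 : ℤ) ^ 2 ∣ 2 := (pow_dvd_pow 2 hj).trans (by exact_mod_cast h)
  omega

theorem localDens_scalarMod_two {j : ℕ} (hj : 2 ≤ j) :
    LocalDens 2 (scalarMod 2 (j + 1)) (2 / 3 * (1 / 8) ^ j) := by
  have h := localDens_coordSet_union_neg Nat.prime_two (by omega : 1 ≤ j) (not_two_pow_dvd_two hj) 1
    {(0, 0, 0), (1, 0, 0)}
  rw [← scalarMod_two_succ_eq hj, slCard_two_pow] at h
  convert h using 1
  rw [show (({(0, 0, 0), (1, 0, 0)} : Finset (ZMod (2 ^ 1) × ZMod (2 ^ 1) × ZMod (2 ^ 1))).card) = 2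
    from rfl, _root_.one_div_pow]
  field_simp
  norm_num

theorem localDens_scalarDisc_two {j : ℕ} (hj : 2 ≤ j) :
    LocalDens 2 (scalarDisc 2 j) (5 / 3 * (1 / 8) ^ j) := by
  have h := localDens_coordSet_union_neg Nat.prime_two (by omega : 1 ≤ j) (not_two_pow_dvd_two hj) 2
    discTwo
  rw [← scalarDisc_two_eq hj, show j + 2 = j + 1 + 1 from rfl, slCard_two_pow, card_discTwo] at h
  convert h using 1
  rw [_root_.one_div_pow, pow_succ]
  field_simp
  norm_num

theorem localDens_two_zero : LocalDens 2 (scalarDisc 2 0 \ scalarMod 2 1) (1 / 4) := by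
  have h1 := hasDens_trace (N := 2 ^ 2) (e := 1) (by norm_num)
  rw [← scalarDisc_two_zero_eq, card_quadric_zmod_sq Nat.prime_two, slCard_two_pow 1] at h1
  have h2 := hasDens_entries (N := 2 ^ 1) {(1, 0, 0)} (by simp)
  rw [← scalarMod_two_one_eq, slCard_two_pow 0] at h2
  have := LocalDens.sdiff (p := 2) ⟨⟨2, h1.1⟩, h1.2⟩ ⟨⟨1, h2.1⟩, h2.2⟩ (scalarMod_succ_subset 2 0)
  convert this using 1
  norm_num

theorem localDens_two_one : LocalDens 2 (scalarDisc 2 1 \ scalarMod 2 2) (1 / 16) := by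
  have h1 := hasDens_coordSet (M := 2 ^ 1) (K := 2 ^ 2) (by norm_num)
    (isCoprime_add_mul_pow (p := 2) (.inl rfl) le_rfl 2) discTwoOne
  rw [← scalarDisc_two_one_eq, ← pow_add, slCard_two_pow 2, card_discTwoOne] at h1
  have h2 := hasDens_entries (N := 2 ^ 2) {(1, 0, 0), (3, 0, 0)} (by
    simp only [Finset.mem_insert, Finset.mem_singleton]
    rintro r (rfl | rfl)
    · exact isUnit_one
    · exact IsUnit.of_mul_eq_one (b := (3 : ZMod (2 ^ 2))) rfl)
  rw [← scalarMod_two_two_eq, slCard_two_pow 1,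
    show (({(1, 0, 0), (3, 0, 0)} :
      Finset (ZMod (2 ^ 2) × ZMod (2 ^ 2) × ZMod (2 ^ 2))).card) = 2 from rfl] at h2
  have := LocalDens.sdiff (p := 2) ⟨⟨3, h1.1⟩, h1.2⟩ ⟨⟨2, h2.1⟩, h2.2⟩ (scalarMod_succ_subset 2 1)
  convert this using 1
  norm_num

theorem hasLocalDensities_two : HasLocalDensities 2 (37 / 112) := by
  refine ⟨fun j => if j = 0 then 1 / 4 else if j = 1 then 1 / 16 else (1 / 8) ^ j,
    fun j => 2 / 3 * (1 / 8) ^ j, fun j => ?_,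
    (eventually_ge_atTop 2).mono fun j hj => localDens_scalarMod_two hj, ?_, ?_⟩
  · rcases (by omega : j = 0 ∨ j = 1 ∨ 2 ≤ j) with rfl | rfl | hj
    · simpa using localDens_two_zero
    · simpa using localDens_two_one
    · convert (localDens_scalarDisc_two hj).sdiff (localDens_scalarMod_two hj)
        (scalarMod_succ_subset 2 j) using 1
      simp only [if_neg (by omega : j ≠ 0), if_neg (by omega : j ≠ 1)]
      ring
  · simpa using (tendsto_pow_atTop_nhds_zero_of_lt_one (r := (1 / 8 : ℝ)) (by norm_num)
      (by norm_num)).const_mul (2 / 3)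
  · rw [← hasSum_nat_add_iff' 2]
    have h := (hasSum_geometric_of_lt_one (r := (1 / 8 : ℝ)) (by norm_num)
      (by norm_num)).mul_left (1 / 64)
    have h2 : ∀ j : ℕ, (if j + 2 = 0 then 1 / 4 else if j + 2 = 1 then 1 / 16
        else (1 / 8 : ℝ) ^ (j + 2)) = 1 / 64 * (1 / 8) ^ j := fun j => by
      rw [if_neg (by omega), if_neg (by omega), pow_add]
      ring
    have h3 : (37 / 112 - ∑ i ∈ Finset.range 2, if i = 0 then 1 / 4 else if i = 1 then 1 / 16
        else (1 / 8 : ℝ) ^ i) = 1 / 64 * (1 - 1 / 8)⁻¹ := by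
      norm_num [Finset.sum_range_succ]
    simp only [h2, h3]
    exact h

/-! ### Assembling the local densities -/

/-- The matrices whose order is not maximal at `p`, with scalar part of level less than `J`. -/
def notMaximalBelow (p J : ℕ) : Set SL2Z :=
  {γ | ∃ j < J, γ ∈ scalarDisc p j \ scalarMod p (j + 1)}

theorem localDens_notMaximalBelow {p : ℕ} {β : ℕ → ℝ}
    (h : ∀ j, LocalDens p (scalarDisc p j \ scalarMod p (j + 1)) (β j)) (J : ℕ) :
    LocalDens p (notMaximalBelow p J) (∑ j ∈ Finset.range J, β j) := by
  induction J with
  | zero =>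
    have h0 : notMaximalBelow p 0 = ∅ := by ext; simp [notMaximalBelow]
    rw [h0, Finset.sum_range_zero]
    exact ⟨⟨0, .empty⟩, .empty⟩
  | succ J ih =>
    have hU : notMaximalBelow p (J + 1) =
        notMaximalBelow p J ∪ (scalarDisc p J \ scalarMod p (J + 1)) := by
      ext γ
      simp only [notMaximalBelow, Set.mem_union, Set.mem_ofPred_eq]
      constructor
      · rintro ⟨j, hj, hγ⟩
        rcases Nat.lt_succ_iff_lt_or_eq.1 hj with hj | rfl
        · exact .inl ⟨j, hj, hγ⟩
        · exact .inr hγ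
      · rintro (⟨j, hj, hγ⟩ | hγ)
        · exact ⟨j, hj.trans (Nat.lt_succ_self J), hγ⟩
        · exact ⟨J, Nat.lt_succ_self J, hγ⟩
    rw [hU, Finset.sum_range_succ]
    refine ih.disjUnion (h J) (Set.disjoint_left.2 ?_)
    rintro γ ⟨j, hj, hγ⟩ hγ'
    exact hγ.2 (scalarMod_antitone p (Nat.succ_le_of_lt hj) (scalarDisc_subset p J hγ'.1))

theorem HasDens.eventually_cnt_le {S : Set SL2Z} {δ c : ℝ} (h : HasDens S δ) (hc : δ < c) :
    ∀ᶠ T in atTop, (cnt S T : ℝ) ≤ c * cnt Set.univ T := by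
  filter_upwards [(tendsto_order.1 h).2 c hc, eventually_cnt_univ_pos] with T hT hpos
  have : (0 : ℝ) < cnt Set.univ T := by exact_mod_cast hpos
  exact ((div_lt_iff₀ this).1 hT).le

theorem hasDens_of_approx {S : Set SL2Z} {δ : ℝ}
    (h : ∀ ε > 0, ∃ (S' E : Set SL2Z) (δ' : ℝ), HasDens S' δ' ∧ |δ' - δ| ≤ ε ∧ S ⊆ S' ∪ E ∧
      S' ⊆ S ∪ E ∧ ∀ᶠ T in atTop, (cnt E T : ℝ) ≤ ε * cnt Set.univ T) : HasDens S δ := by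
  refine Metric.tendsto_nhds.2 fun η hη => ?_
  obtain ⟨S', E, δ', hS', hδ, h1, h2, hE⟩ := h (η / 3) (by positivity)
  filter_upwards [Metric.tendsto_nhds.1 hS' (η / 3) (by positivity), hE,
    eventually_cnt_univ_pos] with T hT hET hpos
  have hu : (0 : ℝ) < cnt Set.univ T := by exact_mod_cast hpos
  have h3 : (cnt S T : ℝ) ≤ cnt S' T + cnt E T := by
    exact_mod_cast (cnt_mono fun γ hγ _ => h1 hγ).trans (cnt_union_le S' E T)
  have h4 : (cnt S' T : ℝ) ≤ cnt S T + cnt E T := by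
    exact_mod_cast (cnt_mono fun γ hγ _ => h2 hγ).trans (cnt_union_le S E T)
  have h5 : |(cnt S T : ℝ) / cnt Set.univ T - cnt S' T / cnt Set.univ T| ≤ η / 3 := by
    rw [← sub_div, abs_div, abs_of_pos hu, div_le_iff₀ hu]
    refine le_trans ?_ hET
    rw [abs_le]
    constructor <;> linarith
  rw [Real.dist_eq, abs_lt] at hT ⊢
  rw [abs_le] at h5 hδ
  constructor <;> linarith

theorem eventually_mul_sq_le_cnt_univ {ε : ℝ} (hε : 0 < ε) :
    ∀ᶠ T : ℝ in atTop, ε / 64 * T ^ 2 ≤ ε * cnt Set.univ T := by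
  filter_upwards [eventually_ge_atTop 4] with T hT
  have := le_cnt_univ hT
  nlinarith

theorem hasDens_conductorOne {b : ℕ → ℝ} (hb : ∀ p : ℕ, p.Prime → HasLocalDensities p (b p))
    {L : ℝ} (hL : Tendsto (fun n => ∏ p ∈ Nat.primesBelow n, (1 - b p)) atTop (𝓝 L)) :
    HasDens {γ | 2 < |trZ γ| ∧ ConductorOne γ} L := by
  choose! β υ hβ hυ hυ0 hsum using hb
  refine hasDens_of_approx fun ε hε => ?_
  obtain ⟨P, hP⟩ := exists_eventually_cnt_tail_le (ε := ε / 3 / 64) (by positivity)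
  obtain ⟨n, hn, hPn⟩ := ((Metric.tendsto_nhds.1 hL (ε / 2) (by positivity)).and
    (eventually_gt_atTop P)).exists
  set I := Nat.primesBelow n with hI
  have hIp : ∀ p ∈ I, p.Prime := fun p hp => Nat.prime_of_mem_primesBelow hp
  have hlim : Tendsto (fun J => ∏ p ∈ I, (1 - ∑ j ∈ Finset.range (J + 1), β p j)) atTop
      (𝓝 (∏ p ∈ I, (1 - b p))) :=
    tendsto_finsetProd _ fun p hp => tendsto_const_nhds.sub
      ((tendsto_add_atTop_iff_nat 1).2 (hsum p (hIp p hp)).tendsto_sum_nat)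
  have hc : 0 < ε / 3 / (I.card + 1) := by positivity
  have hυI : ∀ᶠ J in atTop, ∀ p ∈ I, υ p J < ε / 3 / (I.card + 1) ∧
      LocalDens p (scalarMod p (J + 1)) (υ p J) :=
    (eventually_all_finset I).2 fun p hp =>
      ((tendsto_order.1 (hυ0 p (hIp p hp))).2 _ hc).and (hυ p (hIp p hp))
  obtain ⟨J, hJ, hJυ⟩ :=
    ((Metric.tendsto_nhds.1 hlim (ε / 2) (by positivity)).and hυI).exists
  refine ⟨{γ | ∀ p ∈ I, γ ∈ (notMaximalBelow p (J + 1))ᶜ},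
    {γ | |trZ γ| ≤ 2} ∪ {γ | 2 < |trZ γ| ∧ ∃ p : ℕ, p.Prime ∧ P < p ∧ (p : ℤ) ^ 2 ∣ trZ γ ^ 2 - 4} ∪
      {γ | ∃ p ∈ I, γ ∈ scalarMod p (J + 1)}, _,
    LocalDens.hasDens_biInter hIp fun p hp =>
      (localDens_notMaximalBelow (hβ p (hIp p hp)) (J + 1)).compl, ?_, ?_, ?_, ?_⟩
  · rw [Real.dist_eq, abs_lt] at hn hJ
    rw [abs_le]
    constructor <;> linarith
  · rintro γ ⟨ht, hγ⟩
    refine .inl fun p hp => ?_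
    rintro ⟨j, -, hj⟩
    exact (conductorOne_iff ht).1 hγ p (hIp p hp) ((notMaximalAt_iff (hIp p hp) ht).2 ⟨j, hj⟩)
  · intro γ hγ
    by_cases ht : 2 < |trZ γ|
    · by_cases hC : ConductorOne γ
      · exact .inl ⟨ht, hC⟩
      rw [conductorOne_iff ht] at hC
      push Not at hC
      obtain ⟨p, hp, hN⟩ := hC
      by_cases hpI : p ∈ I
      · obtain ⟨j, hj⟩ := (notMaximalAt_iff hp ht).1 hN
        have hJj : J + 1 ≤ j := by
          by_contra! hlt
          exact hγ p hpI ⟨j, hlt, hj⟩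
        exact .inr (.inr ⟨p, hpI, scalarMod_antitone p hJj (scalarDisc_subset p j hj.1)⟩)
      · have hPp : P < p := by
          rw [hI, Nat.mem_primesBelow] at hpI
          by_contra! hle
          exact hpI ⟨by omega, hp⟩
        obtain ⟨m, -, hm⟩ := hN
        exact .inr (.inl (.inr ⟨ht, p, hp, hPp, ⟨(uGamma γ : ℤ) ^ 2 * m, by rw [hm]; ring⟩⟩))
    · exact .inr (.inl (.inl (not_lt.1 ht)))
  · have hU : ∀ᶠ T in atTop, ∀ p ∈ I, (cnt (scalarMod p (J + 1)) T : ℝ) ≤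
        ε / 3 / (I.card + 1) * cnt Set.univ T :=
      (eventually_all_finset I).2 fun p hp =>
        (hJυ p hp).2.2.eventually_cnt_le (hJυ p hp).1
    filter_upwards [hP, eventually_cnt_abs_trZ_le (ε := ε / 3 / 64) (by positivity),
      eventually_mul_sq_le_cnt_univ (ε := ε / 3) (by positivity), hU] with T h1 h2 h3 h4
    have h5 : (cnt {γ | ∃ p ∈ I, γ ∈ scalarMod p (J + 1)} T : ℝ) ≤ ε / 3 * cnt Set.univ T := by
      calc (cnt {γ | ∃ p ∈ I, γ ∈ scalarMod p (J + 1)} T : ℝ)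
          ≤ ∑ p ∈ I, (cnt (scalarMod p (J + 1)) T : ℝ) := by
            exact_mod_cast cnt_biUnion_le I (fun p => scalarMod p (J + 1)) T
        _ ≤ ∑ _p ∈ I, ε / 3 / (I.card + 1) * cnt Set.univ T := Finset.sum_le_sum h4
        _ = ε / 3 * cnt Set.univ T * (I.card / (I.card + 1)) := by
            rw [Finset.sum_const, nsmul_eq_mul]; ring
        _ ≤ ε / 3 * cnt Set.univ T * 1 := by
            gcongr
            exact (div_le_one (by positivity)).2 (by linarith)
        _ = _ := mul_one _
    have h6 := cnt_union_le ({γ | |trZ γ| ≤ 2} ∪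
      {γ | 2 < |trZ γ| ∧ ∃ p : ℕ, p.Prime ∧ P < p ∧ (p : ℤ) ^ 2 ∣ trZ γ ^ 2 - 4})
      {γ | ∃ p ∈ I, γ ∈ scalarMod p (J + 1)} T
    have h7 := cnt_union_le {γ | |trZ γ| ≤ 2}
      {γ | 2 < |trZ γ| ∧ ∃ p : ℕ, p.Prime ∧ P < p ∧ (p : ℤ) ^ 2 ∣ trZ γ ^ 2 - 4} T
    have h8 := h6.trans (Nat.add_le_add_right h7 _)
    refine (Nat.cast_le (α := ℝ).2 h8).trans ?_
    push_cast
    linarith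

theorem card_subtype_eq_cnt (T : ℝ) (S : Set SL2Z) (Q : SL2Z → Prop)
    (h : ∀ γ, Q γ ↔ frobNorm γ ≤ T ∧ γ ∈ S) : Nat.card {γ // Q γ} = cnt S T := by
  classical
  rw [show cnt S T = ((ballF T).filter (· ∈ S)).card by unfold cnt; congr]
  exact Nat.subtype_card _ fun γ => by rw [Finset.mem_filter, mem_ballF, h]

theorem summable_two_mul_div_cube_sub_one :
    Summable fun p : {p : ℕ // p.Prime ∧ p ≠ 2} => 2 * (p.1 : ℝ) / ((p.1 : ℝ) ^ 3 - 1) := by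
  have h : Summable fun p : {p : ℕ // p.Prime ∧ p ≠ 2} => 4 * (1 / (p.1 : ℝ) ^ 2) :=
    ((Real.summable_one_div_nat_pow.2 one_lt_two).mul_left 4).comp_injective
      Subtype.val_injective
  have h2 : ∀ p : {p : ℕ // p.Prime ∧ p ≠ 2}, (2 : ℝ) ≤ p.1 := fun p => by
    exact_mod_cast p.2.1.two_le
  have h3 : ∀ p : {p : ℕ // p.Prime ∧ p ≠ 2}, (2 : ℝ) ≤ (p.1 : ℝ) ^ 3 := fun p => by
    have := pow_le_pow_left₀ zero_le_two (h2 p) 3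
    linarith
  refine h.of_nonneg_of_le (fun p => ?_) fun p => ?_
  · exact div_nonneg (by positivity) (by linarith [h3 p])
  · have hp := h2 p
    rw [mul_one_div, div_le_div_iff₀ (by linarith [h3 p]) (by positivity)]
    nlinarith [h3 p]

theorem tendsto_prod_primesBelow : Tendsto (fun n => ∏ p ∈ Nat.primesBelow n,
      (1 - if p = 2 then 37 / 112 else 2 * (p : ℝ) / ((p : ℝ) ^ 3 - 1))) atTop
    (𝓝 ((75 / 112) * ∏' p : {p : ℕ // p.Prime ∧ p ≠ 2},
      (1 - 2 * (p.1 : ℝ) / ((p.1 : ℝ) ^ 3 - 1)))) := by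
  classical
  let s : Set ℕ := {p | p.Prime ∧ p ≠ 2}
  let g : ℕ → ℝ := fun p => 1 - 2 * (p : ℝ) / ((p : ℝ) ^ 3 - 1)
  have h1 : HasProd (fun p : s => g p) (∏' p : s, g p) := by
    refine Multipliable.hasProd ?_
    have h := multipliable_one_add_of_summable summable_two_mul_div_cube_sub_one.neg.norm
    exact h.congr fun p => (sub_eq_add_neg _ _).symm
  have h2 : HasProd (s.mulIndicator g) (∏' p : s, g p) := hasProd_subtype_iff_mulIndicator.1 h1
  have h3 := ((hasProd_ite_eq 2 (75 / 112 : ℝ)).mul h2).tendsto_prod_nat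
  refine h3.congr fun n => ?_
  rw [Nat.primesBelow, Finset.prod_filter]
  refine Finset.prod_congr rfl fun p _ => ?_
  by_cases hp : p.Prime
  · by_cases hp2 : p = 2
    · subst hp2
      norm_num [s]
    · simp [s, g, hp, hp2]
  · have hp2 : p ≠ 2 := fun h => hp (h ▸ Nat.prime_two)
    simp [s, hp, hp2]

/-- The proportion of `γ ∈ Γ_T` which are hyperbolic with `f_γ = 1` (i.e.
`Δ_γ = Δ_K`) converges to `(75/112)·∏_{p odd prime} (1 - 2p/(p³-1))`. -/
theorem statement9 :
    Tendsto (fun T : ℝ =>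
        (Nat.card {γ : SL2Z // frobNorm γ ≤ T ∧ 2 < |trZ γ| ∧ ConductorOne γ} : ℝ) /
          (Nat.card {γ : SL2Z // frobNorm γ ≤ T} : ℝ))
      atTop
      (𝓝 ((75 / 112) * ∏' p : {p : ℕ // p.Prime ∧ p ≠ 2},
        (1 - 2 * (p.1 : ℝ) / ((p.1 : ℝ) ^ 3 - 1)))) := by
  have hb : ∀ p : ℕ, p.Prime → HasLocalDensities p
      (if p = 2 then 37 / 112 else 2 * (p : ℝ) / ((p : ℝ) ^ 3 - 1)) := by
    intro p hp
    split_ifs with h2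
    · rw [h2]; exact hasLocalDensities_two
    · exact hasLocalDensities_of_odd hp h2
  refine (hasDens_conductorOne hb tendsto_prod_primesBelow).congr fun T => ?_
  rw [card_subtype_eq_cnt T {γ | 2 < |trZ γ| ∧ ConductorOne γ}
      (fun γ => frobNorm γ ≤ T ∧ 2 < |trZ γ| ∧ ConductorOne γ) fun γ => Iff.rfl,
    card_subtype_eq_cnt T Set.univ _ fun γ => by simp]
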